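/- Let N be a Niemeier lattice whose set of roots R = {r ∈ N : B(r, r) = 2} is nonempty, let h = |R|/24 be its Coxeter number, and let ρ ∈ N ⊗ ℚ be the Weyl vector relative to a ℚ-linear functional f nonvanishing on R. Then there do not exist y ∈ N and integers m, n with B(y, y) = 2 + 2mn and B(y, ρ) = m(h+1) + n·h. Equivalently, in the even unimodular Lorentzian lattice II₂₅,₁ = N ⊕ U (where U has basis e, f with e² = f² = 0 and (e, f) = −1), the norm-0 vector w = ρ + h·e + (h+1)·f has no roots of II₂₅,₁ orthogonal to it; thus w is a primitive norm-0 vector corresponding to the Leech lattice, and every one of the 23 'holy constructions' yields the Leech lattice. -/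

import Mathlib

section

open Set MeasureTheory Complex

/-- The periodisation of a function on `ι → ℝ`, as a function on the torus. -/
noncomputable def torusPeriodization {ι : Type*} (g : (ι → ℝ) → ℂ) (y : UnitAddTorus ι) : ℂ :=
  ∑' n : ι → ℤ, g (fun i => (AddCircle.equivIco 1 0 (y i) : ℝ) + n i)

theorem torusPeriodization_coe {ι : Type*} (g : (ι → ℝ) → ℂ) (x : ι → ℝ) :
    torusPeriodization g (fun i => (x i : UnitAddCircle)) =
      ∑' n : ι → ℤ, g (fun i => x i + n i) := by
  have h : ∀ i, ∃ k : ℤ, x i = (AddCircle.equivIco 1 0 (x i : UnitAddCircle) : ℝ) + k := by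
    intro i
    refine ⟨toIcoDiv one_pos 0 (x i), ?_⟩
    rw [AddCircle.coe_equivIco_mk_apply, ← sub_eq_iff_eq_add]
    simp [toIcoDiv_eq_floor]
  choose k hk using h
  rw [torusPeriodization, ← (Equiv.addLeft k).tsum_eq]
  refine tsum_congr fun n => congrArg g (funext fun i => ?_)
  conv_rhs => rw [hk i]
  simp [add_assoc]

theorem continuous_torusPeriodization {ι : Type*} [Fintype ι] {g : (ι → ℝ) → ℂ}
    (hg : Continuous g) {u : (ι → ℤ) → ℝ} (hu : Summable u)
    (hgu : ∀ n (x : ι → ℝ), (∀ i, x i ∈ Icc (0 : ℝ) 1) → ‖g (fun i => x i + n i)‖ ≤ u n) :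
    Continuous (torusPeriodization g) := by
  let q : (univ.pi fun _ : ι => Icc (0 : ℝ) 1) → UnitAddTorus ι := fun x i => (x.1 i : UnitAddCircle)
  have hq : Continuous q := by
    refine continuous_pi fun i => ?_
    exact (AddCircle.continuous_mk' 1).comp ((continuous_apply i).comp continuous_subtype_val)
  have : CompactSpace (univ.pi fun _ : ι => Icc (0 : ℝ) 1) :=
    isCompact_iff_compactSpace.mp (isCompact_univ_pi fun _ => isCompact_Icc)
  have hsurj : Function.Surjective q := by
    intro y
    refine ⟨⟨fun i => (AddCircle.equivIco 1 0 (y i) : ℝ), fun i _ => ?_⟩, ?_⟩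
    · have := (AddCircle.equivIco 1 0 (y i)).2
      simp only [zero_add] at this
      exact Ico_subset_Icc_self this
    · funext i
      exact AddCircle.coe_equivIco
  have hqq : Topology.IsQuotientMap q := hq.isClosedMap.isQuotientMap hq hsurj
  rw [hqq.continuous_iff]
  have : torusPeriodization g ∘ q = fun x => ∑' n : ι → ℤ, g (fun i => x.1 i + n i) := by
    funext x
    exact torusPeriodization_coe g x.1
  rw [this]
  refine continuous_tsum (fun n => hg.comp ?_) hu fun n x => hgu n x.1 fun i => x.2 i trivial
  exact continuous_pi fun i => ((continuous_apply i).comp continuous_subtype_val).add continuous_const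

theorem poisson_summation_pi {ι : Type*} [Fintype ι] {g : (ι → ℝ) → ℂ}
    (hg : Continuous g) {u : (ι → ℤ) → ℝ} (hu : Summable u)
    (hgu : ∀ n (x : ι → ℝ), (∀ i, x i ∈ Icc (0 : ℝ) 1) → ‖g (fun i => x i + n i)‖ ≤ u n)
    (hF : Summable fun m : ι → ℤ => ∫ y : ι → ℝ, cexp (-(2 * Real.pi * I * (∑ i, m i * y i : ℝ))) * g y) :
    ∑' n : ι → ℤ, g (fun i => n i) =
      ∑' m : ι → ℤ, ∫ y : ι → ℝ, cexp (-(2 * Real.pi * I * (∑ i, m i * y i : ℝ))) * g y := by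
  let F : C(UnitAddTorus ι, ℂ) := ⟨torusPeriodization g, continuous_torusPeriodization hg hu hgu⟩
  let C : Set (ι → ℝ) := {x : ι → ℝ | ∀ i, x i ∈ Ioc (0 : ℝ) (0 + 1)}
  have hCm : MeasurableSet C := MeasurableSet.univ_pi' (fun i => measurableSet_Ioc)
  have hCI : C ⊆ Icc 0 1 := fun x hx => ⟨fun i => (hx i).1.le, fun i => by simpa using (hx i).2⟩
  have hCfin : volume C < ⊤ := (measure_mono hCI).trans_lt isCompact_Icc.measure_lt_top
  have hcoef : ∀ m : ι → ℤ, UnitAddTorus.mFourierCoeff F m =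
      ∫ y : ι → ℝ, cexp (-(2 * Real.pi * I * (∑ i, m i * y i : ℝ))) * g y := by
    intro m
    let e : (ι → ℝ) → ℂ := fun y => cexp (-(2 * Real.pi * I * (∑ i, m i * y i : ℝ)))
    have he : Continuous e := by fun_prop
    have he1 : ∀ y, ‖e y‖ = 1 := by
      intro y
      have : -(2 * Real.pi * I * ((∑ i, m i * y i : ℝ) : ℂ)) = ((-(2 * Real.pi * ∑ i, m i * y i) : ℝ) : ℂ) * I := by
        push_cast; ring
      simp only [e, this, norm_exp_ofReal_mul_I]
    have heper : ∀ (n : ι → ℤ) y, e (fun i => y i + n i) = e y := by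
      intro n y
      simp only [e]
      rw [Complex.exp_eq_exp_iff_exists_int]
      refine ⟨-∑ i, m i * n i, ?_⟩
      push_cast
      simp only [mul_add, Finset.sum_add_distrib]
      ring
    have hfour : ∀ y : ι → ℝ, UnitAddTorus.mFourier (-m) (fun i => (y i : UnitAddCircle)) = e y := by
      intro y
      simp only [UnitAddTorus.mFourier, ContinuousMap.coe_mk, fourier_coe_apply, e, ← Complex.exp_sum]
      congr 1
      push_cast
      rw [Finset.mul_sum, ← Finset.sum_neg_distrib]
      refine Finset.sum_congr rfl fun i _ => ?_
      simp
      ring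
    let s : (ι → ℤ) → Set (ι → ℝ) := fun n => (fun x : ι → ℝ => x - fun i => (n i : ℝ)) ⁻¹' C
    have hsm : ∀ n, MeasurableSet (s n) := fun n => hCm.preimage (by fun_prop)
    have hsun : ⋃ n, s n = univ := by
      refine eq_univ_of_forall fun x => mem_iUnion.2 ⟨fun i => ⌈x i⌉ - 1, fun i => ?_⟩
      have h1 := Int.le_ceil (x i)
      have h2 := Int.ceil_lt_add_one (x i)
      simp only [Pi.sub_apply, mem_Ioc]
      push_cast
      constructor <;> linarith
    have hsd : Pairwise (Function.onFun Disjoint s) := by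
      intro a b hab
      refine Set.disjoint_left.2 fun x hxa hxb => hab (funext fun i => ?_)
      have h1 := hxa i
      have h2 := hxb i
      simp only [Pi.sub_apply, mem_Ioc] at h1 h2
      have h3 : (a i : ℝ) < b i + 1 := by linarith
      have h4 : (b i : ℝ) < a i + 1 := by linarith
      have h3' : a i < b i + 1 := by exact_mod_cast h3
      have h4' : b i < a i + 1 := by exact_mod_cast h4
      omega
    have hshift : ∀ (n : ι → ℤ) (f : (ι → ℝ) → ℂ), ∫ x in s n, f x = ∫ x in C, f (fun i => x i + n i) := by
      intro n f
      have := (measurePreserving_sub_right (volume : Measure (ι → ℝ)) (fun i => (n i : ℝ))).setIntegral_preimage_emb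
        (MeasurableEquiv.subRight (fun i => (n i : ℝ))).measurableEmbedding
        (fun x => f (fun i => x i + n i)) C
      simpa using this
    have hbC : ∀ n, ∀ x ∈ C, ‖g (fun i => x i + n i)‖ ≤ u n := fun n x hx =>
      hgu n x fun i => ⟨(hx i).1.le, by simpa using (hx i).2⟩
    have hint : ∀ n : ι → ℤ, IntegrableOn (fun x => e x * g (fun i => x i + n i)) C := by
      intro n
      refine Measure.integrableOn_of_bounded hCfin.ne
        (Continuous.aestronglyMeasurable (by fun_prop)) (M := u n) ?_
      filter_upwards [ae_restrict_mem hCm] with x hx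
      rw [norm_mul, he1, one_mul]
      exact hbC n x hx
    have hsumnorm : Summable fun n : ι → ℤ => ∫ x in C, ‖e x * g (fun i => x i + n i)‖ := by
      refine Summable.of_nonneg_of_le (fun n => integral_nonneg fun x => norm_nonneg _) (fun n => ?_)
        (hu.mul_right (volume.real C))
      calc ∫ x in C, ‖e x * g (fun i => x i + n i)‖ ≤ ∫ x in C, u n := by
            refine setIntegral_mono_on (hint n).norm (integrableOn_const hCfin.ne) hCm fun x hx => ?_
            rw [norm_mul, he1, one_mul]
            exact hbC n x hx
        _ = u n * volume.real C := by simp [mul_comm]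
    have hsum := hasSum_integral_of_summable_integral_norm (μ := volume.restrict C) hint hsumnorm
    have hinteg : Integrable (fun y => e y * g y) := by
      rw [← integrableOn_univ, ← hsun]
      refine integrableOn_iUnion_of_summable_integral_norm (fun n => ?_) ?_
      · have := (measurePreserving_sub_right (volume : Measure (ι → ℝ)) (fun i => (n i : ℝ))).integrableOn_comp_preimage
          (MeasurableEquiv.subRight (fun i => (n i : ℝ))).measurableEmbedding
          (f := fun x => e x * g (fun i => x i + n i)) (s := C)
        have h2 := this.2 (hint n)
        refine (integrableOn_congr_fun (fun x _ => ?_) (hsm n)).1 h2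
        have h3 := heper n (x - fun i => (n i : ℝ))
        simp only [Pi.sub_apply, sub_add_cancel] at h3
        simp only [Function.comp, Pi.sub_apply, sub_add_cancel, ← h3]
      · refine hsumnorm.congr fun n => ?_
        have := (measurePreserving_sub_right (volume : Measure (ι → ℝ)) (fun i => (n i : ℝ))).setIntegral_preimage_emb
          (MeasurableEquiv.subRight (fun i => (n i : ℝ))).measurableEmbedding
          (fun x => ‖e x * g (fun i => x i + n i)‖) C
        rw [← this]
        refine setIntegral_congr_fun (hsm n) fun x _ => ?_
        have h3 := heper n (x - fun i => (n i : ℝ))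
        simp only [Pi.sub_apply, sub_add_cancel] at h3
        simp only [Pi.sub_apply, sub_add_cancel, ← h3]
    have h1 := hasSum_integral_iUnion hsm hsd (f := fun y => e y * g y) (μ := volume) hinteg.integrableOn
    rw [hsun, setIntegral_univ] at h1
    rw [UnitAddTorus.mFourierCoeff_eq_integral _ _ 0]
    refine Eq.trans ?_ (hsum.tsum_eq.symm.trans ((tsum_congr fun n => ?_).trans h1.tsum_eq))
    · refine setIntegral_congr_fun hCm fun x _ => ?_
      simp only [smul_eq_mul, hfour]
      rw [tsum_mul_left]
      congr 1
      exact torusPeriodization_coe g x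
    · rw [hshift]
      exact setIntegral_congr_fun hCm fun x _ => by simp only [heper]
  have hs : Summable (UnitAddTorus.mFourierCoeff F) := hF.congr fun m => (hcoef m).symm
  have := (UnitAddTorus.hasSum_mFourier_series_apply_of_summable hs 0).tsum_eq
  have h0 : F 0 = ∑' n : ι → ℤ, g (fun i => n i) := by
    have := torusPeriodization_coe g (0 : ι → ℝ)
    simp only [Pi.zero_apply, zero_add] at this
    exact this
  rw [← h0, ← this]
  refine tsum_congr fun m => ?_
  rw [hcoef]
  simp [UnitAddTorus.mFourier]

end

section

open Set MeasureTheory Complex Matrix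

theorem summable_exp_neg_sum_abs (ι : Type*) [Fintype ι] :
    Summable fun n : ι → ℤ => Real.exp (-∑ i, |(n i : ℝ)|) := by
  classical
  have h1 : Summable fun k : ℤ => Real.exp (-|(k : ℝ)|) := by
    have h := Real.summable_exp_neg_nat
    refine Summable.of_nat_of_neg ?_ ?_ <;> simpa using h
  refine summable_of_sum_le (c := (∑' k : ℤ, Real.exp (-|(k : ℝ)|)) ^ Fintype.card ι)
    (fun n => (Real.exp_pos _).le) fun s => ?_
  calc ∑ n ∈ s, Real.exp (-∑ i, |(n i : ℝ)|)
      ≤ ∑ n ∈ Fintype.piFinset fun i => s.image fun n : ι → ℤ => n i, Real.exp (-∑ i, |(n i : ℝ)|) := by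
        refine Finset.sum_le_sum_of_subset_of_nonneg (fun n hn => ?_) fun _ _ _ => (Real.exp_pos _).le
        exact Fintype.mem_piFinset.2 fun i => Finset.mem_image_of_mem _ hn
    _ = ∏ i, ∑ k ∈ s.image fun n : ι → ℤ => n i, Real.exp (-|(k : ℝ)|) := by
        rw [Finset.prod_univ_sum]
        refine Finset.sum_congr rfl fun n _ => ?_
        rw [← Real.exp_sum, Finset.sum_neg_distrib]
    _ ≤ ∏ _i : ι, ∑' k : ℤ, Real.exp (-|(k : ℝ)|) := by
        refine Finset.prod_le_prod (fun i _ => Finset.sum_nonneg fun _ _ => (Real.exp_pos _).le)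
          fun i _ => h1.sum_le_tsum _ fun _ _ => (Real.exp_pos _).le
    _ = _ := by simp

section

variable {ι : Type*} [Fintype ι]

/-- The squared length of `A x`. -/
def matrixNormSq (A : Matrix ι ι ℝ) (x : ι → ℝ) : ℝ := ∑ i, (A *ᵥ x) i ^ 2

/-- The complex linear form `x ↦ (A x) · w`. -/
noncomputable def matrixForm (A : Matrix ι ι ℝ) (w : ι → ℂ) (x : ι → ℝ) : ℂ :=
  ∑ i, ((A *ᵥ x) i : ℂ) * w i

theorem exists_le_matrixNormSq [DecidableEq ι] {A : Matrix ι ι ℝ} (hA : IsUnit A.det) :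
    ∃ c > 0, ∀ x : ι → ℝ, c * (∑ i, |x i|) ^ 2 ≤ matrixNormSq A x := by
  let M : ℝ := ∑ i, ∑ j, |A⁻¹ i j|
  have hM : 0 ≤ M := Finset.sum_nonneg fun _ _ => Finset.sum_nonneg fun _ _ => abs_nonneg _
  have key : ∀ x : ι → ℝ, (∑ i, |x i|) ^ 2 ≤ M ^ 2 * Fintype.card ι * matrixNormSq A x := by
    intro x
    have h1 : ∑ i, |x i| ≤ M * ∑ j, |(A *ᵥ x) j| := by
      have hx : x = A⁻¹ *ᵥ (A *ᵥ x) := by rw [mulVec_mulVec, nonsing_inv_mul _ hA, one_mulVec]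
      rw [Finset.sum_mul]
      refine Finset.sum_le_sum fun i _ => ?_
      calc |x i| = |∑ j, A⁻¹ i j * (A *ᵥ x) j| := by
            conv_lhs => rw [hx]
            rfl
        _ ≤ ∑ j, |A⁻¹ i j| * |(A *ᵥ x) j| := by
            refine (Finset.abs_sum_le_sum_abs _ _).trans (le_of_eq ?_)
            simp [abs_mul]
        _ ≤ ∑ j, |A⁻¹ i j| * ∑ j, |(A *ᵥ x) j| := by
            refine Finset.sum_le_sum fun j hj => mul_le_mul_of_nonneg_left ?_ (abs_nonneg _)
            exact Finset.single_le_sum (f := fun j => |(A *ᵥ x) j|) (fun _ _ => abs_nonneg _) hj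
        _ = _ := (Finset.sum_mul ..).symm
    have h2 : (∑ j, |(A *ᵥ x) j|) ^ 2 ≤ Fintype.card ι * matrixNormSq A x := by
      have := sq_sum_le_card_mul_sum_sq (s := Finset.univ) (f := fun j => |(A *ᵥ x) j|)
      simpa [matrixNormSq] using this
    calc (∑ i, |x i|) ^ 2 ≤ (M * ∑ j, |(A *ᵥ x) j|) ^ 2 :=
          pow_le_pow_left₀ (Finset.sum_nonneg fun _ _ => abs_nonneg _) h1 2
      _ = M ^ 2 * (∑ j, |(A *ᵥ x) j|) ^ 2 := mul_pow ..
      _ ≤ M ^ 2 * (Fintype.card ι * matrixNormSq A x) := by gcongr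
      _ = _ := by ring
  refine ⟨(M ^ 2 * Fintype.card ι + 1)⁻¹, by positivity, fun x => ?_⟩
  have h0 : 0 ≤ matrixNormSq A x := Finset.sum_nonneg fun _ _ => sq_nonneg _
  rw [inv_mul_le_iff₀ (by positivity)]
  linarith [key x]

theorem exists_norm_matrixForm_le (A : Matrix ι ι ℝ) (w : ι → ℂ) :
    ∃ W : ℝ, 0 ≤ W ∧ ∀ x : ι → ℝ, ‖matrixForm A w x‖ ≤ W * ∑ i, |x i| := by
  refine ⟨∑ i, (∑ j, |A i j|) * ‖w i‖, Finset.sum_nonneg fun i _ => mul_nonneg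
    (Finset.sum_nonneg fun _ _ => abs_nonneg _) (norm_nonneg _), fun x => ?_⟩
  rw [Finset.sum_mul]
  refine (norm_sum_le _ _).trans (Finset.sum_le_sum fun i _ => ?_)
  rw [norm_mul, mul_right_comm]
  refine mul_le_mul_of_nonneg_right ?_ (norm_nonneg _)
  rw [norm_real, Real.norm_eq_abs]
  calc |(A *ᵥ x) i| ≤ ∑ j, |A i j| * |x j| := by
        refine (Finset.abs_sum_le_sum_abs _ _).trans (le_of_eq ?_)
        simp [abs_mul]
    _ ≤ ∑ j, |A i j| * ∑ j, |x j| := by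
        refine Finset.sum_le_sum fun j hj => mul_le_mul_of_nonneg_left ?_ (abs_nonneg _)
        exact Finset.single_le_sum (f := fun j => |x j|) (fun _ _ => abs_nonneg _) hj
    _ = _ := (Finset.sum_mul ..).symm

/-- A Gaussian dominates an exponential. -/
theorem exp_quadratic_le {a : ℝ} (ha : 0 < a) (b : ℝ) (t : ℝ) :
    Real.exp (-a * t ^ 2 + b * t) ≤ Real.exp ((b + 1) ^ 2 / (4 * a)) * Real.exp (-t) := by
  rw [← Real.exp_add]
  refine Real.exp_le_exp.2 ?_
  have h : 0 ≤ (2 * a * t - (b + 1)) ^ 2 / (4 * a) := by positivity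
  have h2 : (2 * a * t - (b + 1)) ^ 2 / (4 * a) = a * t ^ 2 - (b + 1) * t + (b + 1) ^ 2 / (4 * a) := by
    field_simp; ring
  linarith

/-- The Gaussian whose sum over the integer lattice is the shifted theta series. -/
noncomputable def thetaGaussian (A : Matrix ι ι ℝ) (w : ι → ℂ) (τ s : ℂ) (x : ι → ℝ) : ℂ :=
  cexp (Real.pi * I * τ * matrixNormSq A x + 2 * Real.pi * I * s * matrixForm A w x)

theorem norm_thetaGaussian_le (A : Matrix ι ι ℝ) (w : ι → ℂ) (τ s : ℂ) (x : ι → ℝ) :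
    ‖thetaGaussian A w τ s x‖ ≤
      Real.exp (-(Real.pi * τ.im) * matrixNormSq A x + 2 * Real.pi * ‖s‖ * ‖matrixForm A w x‖) := by
  rw [thetaGaussian, norm_exp, Real.exp_le_exp, add_re]
  refine add_le_add (le_of_eq ?_) ?_
  · rw [re_mul_ofReal]
    simp
  · refine (re_le_norm _).trans (le_of_eq ?_)
    simp [Real.pi_nonneg]

theorem exists_norm_thetaGaussian_le [DecidableEq ι] {A : Matrix ι ι ℝ} (hA : IsUnit A.det)
    (w : ι → ℂ) {δ : ℝ} (hδ : 0 < δ) (R : ℝ) :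
    ∃ K : ℝ, ∀ (τ s : ℂ), δ ≤ τ.im → ‖s‖ ≤ R → ∀ x : ι → ℝ,
      ‖thetaGaussian A w τ s x‖ ≤ K * Real.exp (-∑ i, |x i|) := by
  obtain ⟨c, hc, hcA⟩ := exists_le_matrixNormSq hA
  obtain ⟨W, hW, hWA⟩ := exists_norm_matrixForm_le A w
  have hpos : 0 < Real.pi * δ * c := by positivity
  refine ⟨_, fun τ s hτ hs x => (norm_thetaGaussian_le A w τ s x).trans
    (le_trans ?_ (exp_quadratic_le hpos (2 * Real.pi * R * W) (∑ i, |x i|)))⟩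
  rw [Real.exp_le_exp]
  have hR : 0 ≤ R := (norm_nonneg s).trans hs
  have h0 : 0 ≤ matrixNormSq A x := Finset.sum_nonneg fun _ _ => sq_nonneg _
  refine add_le_add ?_ ?_
  · have h1 : Real.pi * δ * (c * (∑ i, |x i|) ^ 2) ≤ Real.pi * τ.im * matrixNormSq A x :=
      mul_le_mul (by gcongr) (hcA x) (by positivity) (by have := hδ.le.trans hτ; positivity)
    linarith
  · have := hWA x
    calc 2 * Real.pi * ‖s‖ * ‖matrixForm A w x‖ ≤ 2 * Real.pi * R * (W * ∑ i, |x i|) := by gcongr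
      _ = _ := by ring

theorem exists_summable_norm_thetaGaussian_le [DecidableEq ι] {A : Matrix ι ι ℝ} (hA : IsUnit A.det)
    (w : ι → ℂ) {δ : ℝ} (hδ : 0 < δ) (R : ℝ) :
    ∃ u : (ι → ℤ) → ℝ, Summable u ∧ ∀ (τ s : ℂ), δ ≤ τ.im → ‖s‖ ≤ R → ∀ (n : ι → ℤ) (x : ι → ℝ),
      (∀ i, x i ∈ Icc (0 : ℝ) 1) → ‖thetaGaussian A w τ s (fun i => x i + n i)‖ ≤ u n := by
  obtain ⟨K, hK⟩ := exists_norm_thetaGaussian_le hA w hδ R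
  refine ⟨fun n => |K| * Real.exp (Fintype.card ι) * Real.exp (-∑ i, |(n i : ℝ)|),
    (summable_exp_neg_sum_abs ι).mul_left _, fun τ s hτ hs n x hx => ?_⟩
  refine (hK τ s hτ hs _).trans ?_
  simp only [mul_assoc, ← Real.exp_add]
  refine mul_le_mul (le_abs_self K) (Real.exp_le_exp.2 ?_) (Real.exp_pos _).le (abs_nonneg _)
  have : ∑ i, |(n i : ℝ)| ≤ ∑ i, (|x i + n i| + 1) := by
    refine Finset.sum_le_sum fun i _ => ?_
    have h1 := (hx i).1
    have h2 := (hx i).2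
    calc |(n i : ℝ)| = |x i + n i - x i| := by ring_nf
      _ ≤ |x i + n i| + |x i| := abs_sub _ _
      _ ≤ _ := by rw [abs_of_nonneg h1]; linarith
  rw [Finset.sum_add_distrib] at this
  simp at this
  linarith

end

end

section

open Set MeasureTheory Complex Matrix

section

variable {ι : Type*} [Fintype ι]

theorem integral_comp_mulVec [DecidableEq ι] {A : Matrix ι ι ℝ} (hA : |A.det| = 1)
    (φ : (ι → ℝ) → ℂ) : ∫ y, φ (A *ᵥ y) = ∫ v, φ v := by
  have hdet : A.det ≠ 0 := fun h => by simp [h] at hA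
  have hmap := Real.map_matrix_volume_pi_eq_smul_volume_pi hdet
  rw [abs_inv, hA] at hmap
  simp only [inv_one, ENNReal.ofReal_one, one_smul] at hmap
  have hemb : MeasurableEmbedding (Matrix.toLin' A) := by
    let e := (Matrix.toLinearEquiv' A (A.invertibleOfIsUnitDet (isUnit_iff_ne_zero.2 hdet))).toContinuousLinearEquiv
    exact e.toHomeomorph.toMeasurableEquiv.measurableEmbedding
  conv_rhs => rw [← hmap, hemb.integral_map]
  rfl

theorem integral_thetaGaussian [DecidableEq ι] (hcard : Fintype.card ι = 24)
    {A : Matrix ι ι ℝ} (hA : |A.det| = 1) {w : ι → ℂ} (hw : ∑ i, w i ^ 2 = 0)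
    {τ : ℂ} (hτ : 0 < τ.im) (s : ℂ) (m x : ι → ℝ)
    (hm : ∀ y : ι → ℝ, ∑ i, m i * y i = ∑ i, (A *ᵥ x) i * (A *ᵥ y) i) :
    ∫ y : ι → ℝ, cexp (-(2 * Real.pi * I * (∑ i, m i * y i : ℝ))) * thetaGaussian A w τ (τ * s) y =
      (τ ^ 12)⁻¹ * thetaGaussian A w (-1 / τ) s x := by
  have hτ0 : τ ≠ 0 := fun h => by simp [h] at hτ
  have hpi : (Real.pi : ℂ) ≠ 0 := by exact_mod_cast Real.pi_ne_zero
  let b : ℂ := -(Real.pi * I * τ)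
  have hb : 0 < b.re := by simp [b]; positivity
  let c : ι → ℂ := fun i => 2 * Real.pi * I * (τ * s * w i - (A *ᵥ x) i)
  have h1 := GaussianFourier.integral_cexp_neg_sum_mul_add (b := fun _ : ι => b) (fun _ => hb) c
  rw [← integral_comp_mulVec hA] at h1
  convert h1 using 1
  · refine integral_congr_ae (Filter.Eventually.of_forall fun y => ?_)
    simp only [thetaGaussian]
    rw [← Complex.exp_add]
    congr 1
    rw [hm, matrixNormSq, matrixForm]
    push_cast
    simp only [b, c, Finset.mul_sum, ← Finset.sum_neg_distrib, ← Finset.sum_add_distrib]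
    refine Finset.sum_congr rfl fun i _ => ?_
    ring
  · rw [Finset.prod_mul_distrib, ← Complex.exp_sum, Finset.prod_const, Finset.card_univ, hcard]
    congr 1
    · have : (Real.pi / b : ℂ) ^ (1 / 2 : ℂ) = (Real.pi / b : ℂ) ^ ((2 : ℕ) : ℂ)⁻¹ := by norm_num
      rw [this, show 24 = 2 * 12 from rfl, pow_mul, cpow_nat_inv_pow _ two_ne_zero]
      have : (Real.pi / b : ℂ) = I * τ⁻¹ := by
        simp only [b]
        field_simp
        simp
      rw [this, mul_pow, inv_pow, show (12 : ℕ) = 4 * 3 from rfl, pow_mul I, I_pow_four]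
      simp
    · rw [thetaGaussian, matrixNormSq, matrixForm]
      congr 1
      have h2 : ∀ i, c i ^ 2 / (4 * b) = Real.pi * I * (-1 / τ) * ((A *ᵥ x) i : ℂ) ^ 2 +
          2 * Real.pi * I * s * (((A *ᵥ x) i : ℂ) * w i) - Real.pi * I * τ * s ^ 2 * w i ^ 2 := by
        intro i
        simp only [b, c]
        field_simp
        ring_nf
        try simp only [I_sq]
        try ring_nf
      simp only [h2, Finset.sum_sub_distrib, Finset.sum_add_distrib, ← Finset.mul_sum, hw]
      push_cast
      ring

/-- The functional equation of theta series of unimodular lattices of rank `24`, twisted by an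
isotropic linear form. -/
theorem theta_functional_equation [DecidableEq ι] (hcard : Fintype.card ι = 24)
    {A : Matrix ι ι ℝ} {G : Matrix ι ι ℤ} (hG : IsUnit G.det) (hAG : Aᵀ * A = G.map (Int.cast))
    {w : ι → ℂ} (hw : ∑ i, w i ^ 2 = 0) {τ : ℂ} (hτ : 0 < τ.im) (s : ℂ) :
    ∑' n : ι → ℤ, thetaGaussian A w τ (τ * s) (fun i => n i) =
      (τ ^ 12)⁻¹ * ∑' n : ι → ℤ, thetaGaussian A w (-1 / τ) s (fun i => n i) := by
  have hdet : A.det ^ 2 = (G.det : ℝ) := by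
    have h := congrArg Matrix.det hAG
    rw [det_mul, det_transpose] at h
    rw [sq, h]
    exact (Int.cast_det G).symm
  have hA : |A.det| = 1 := by
    rcases Int.isUnit_iff.1 hG with h | h
    · rw [h] at hdet
      rcases (by simpa using hdet : A.det = 1 ∨ A.det = -1) with h | h <;> simp [h]
    · rw [h] at hdet
      have := sq_nonneg A.det
      norm_num at hdet
      linarith
  have hAu : IsUnit A.det := isUnit_iff_ne_zero.2 fun h => by simp [h] at hA
  let e : (ι → ℤ) ≃ (ι → ℤ) := (Matrix.toLinearEquiv' G (G.invertibleOfIsUnitDet hG)).toEquiv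
  have he : ∀ k, e k = G *ᵥ k := fun k => rfl
  have hm : ∀ (k : ι → ℤ) (y : ι → ℝ),
      ∑ i, (e k i : ℝ) * y i = ∑ i, (A *ᵥ fun i => (k i : ℝ)) i * (A *ᵥ y) i := by
    intro k y
    have h1 : (fun i => (e k i : ℝ)) = (Aᵀ * A) *ᵥ fun i => (k i : ℝ) := by
      rw [hAG]
      funext i
      simp [he, mulVec, dotProduct]
    have h2 : ∑ i, (e k i : ℝ) * y i = (fun i => (e k i : ℝ)) ⬝ᵥ y := rfl
    rw [h2, h1, ← mulVec_mulVec, mulVec_transpose, ← dotProduct_mulVec]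
    rfl
  have hint : ∀ k : ι → ℤ, ∫ y : ι → ℝ, cexp (-(2 * Real.pi * I * (∑ i, e k i * y i : ℝ))) *
      thetaGaussian A w τ (τ * s) y =
      (τ ^ 12)⁻¹ * thetaGaussian A w (-1 / τ) s (fun i => k i) := fun k =>
    integral_thetaGaussian hcard hA hw hτ s (fun i => e k i) (fun i => k i) (hm k)
  have hτ' : 0 < (-1 / τ).im := by
    rw [neg_div, one_div, neg_im, inv_im]
    have : 0 < normSq τ := normSq_pos.2 fun h => by simp [h] at hτ
    rw [neg_div, neg_neg]
    positivity
  obtain ⟨u, hu, hub⟩ := exists_summable_norm_thetaGaussian_le hAu w hτ ‖τ * s‖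
  obtain ⟨u', hu', hub'⟩ := exists_summable_norm_thetaGaussian_le hAu w hτ' ‖s‖
  have hsum' : Summable fun k : ι → ℤ => thetaGaussian A w (-1 / τ) s (fun i => k i) := by
    refine Summable.of_norm_bounded hu' fun n => ?_
    simpa using hub' (-1 / τ) s le_rfl le_rfl n 0 (fun i => by simp)
  have hcont : Continuous (thetaGaussian A w τ (τ * s)) := by
    unfold thetaGaussian matrixNormSq matrixForm
    refine continuous_exp.comp ?_
    fun_prop
  have hP := poisson_summation_pi hcont hu (fun n x hx => hub τ (τ * s) le_rfl le_rfl n x hx) (by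
    rw [← e.summable_iff]
    refine (hsum'.mul_left (τ ^ 12)⁻¹).congr fun k => ?_
    exact (hint k).symm)
  rw [hP, ← e.tsum_eq, tsum_congr hint, tsum_mul_left]

end

end

section

open Set MeasureTheory Complex Matrix

theorem hasSum_deriv_deriv_of_summable_norm {α : Type*} {f : α → ℂ → ℂ} {u : α → ℝ}
    (hu : Summable u) (hf : ∀ n, Differentiable ℂ (f n))
    (hfu : ∀ n, ∀ s ∈ Metric.ball (0 : ℂ) 3, ‖f n s‖ ≤ u n) :
    HasSum (fun n => deriv (deriv (f n)) 0) (deriv (deriv fun s => ∑' n, f n s) 0) := by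
  have h1 : ∀ z ∈ Metric.ball (0 : ℂ) 1,
      HasSum (fun n => deriv (f n) z) (deriv (fun s => ∑' n, f n s) z) := fun z hz =>
    hasSum_deriv_of_summable_norm hu (fun n => (hf n).differentiableOn) Metric.isOpen_ball hfu
      (Metric.ball_subset_ball (by norm_num) hz)
  have h2 : ∀ n, ∀ z ∈ Metric.ball (0 : ℂ) 1, ‖deriv (f n) z‖ ≤ u n := by
    intro n z hz
    have := Complex.norm_deriv_le_of_forall_mem_sphere_norm_le (c := z) one_pos
      (hf n).diffContOnCl (C := u n) fun w hw => hfu n w (by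
        rw [mem_ball_zero_iff] at hz ⊢
        rw [mem_sphere_iff_norm] at hw
        have := norm_le_norm_add_norm_sub' w z
        linarith)
    simpa using this
  have hd : ∀ n, DifferentiableOn ℂ (deriv (f n)) (Metric.ball (0 : ℂ) 1) := fun n =>
    ((hf n).differentiableOn (s := Metric.ball (0 : ℂ) 1)).deriv Metric.isOpen_ball
  have h3 := hasSum_deriv_of_summable_norm (F := fun n => deriv (f n)) hu hd Metric.isOpen_ball h2
    (Metric.mem_ball_self (x := (0 : ℂ)) zero_lt_one)
  have h4 : deriv (deriv fun s => ∑' n, f n s) 0 = deriv (fun s => ∑' n, deriv (f n) s) 0 := by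
    refine Filter.EventuallyEq.deriv_eq ?_
    filter_upwards [Metric.ball_mem_nhds (0 : ℂ) one_pos] with z hz
    exact (h1 z hz).tsum_eq.symm
  rw [h4]
  exact h3

theorem deriv_deriv_cexp_affine (a b : ℂ) :
    deriv (deriv fun s => cexp (a + s * b)) 0 = b ^ 2 * cexp a := by
  have h : ∀ s, HasDerivAt (fun s => cexp (a + s * b)) (cexp (a + s * b) * b) s := by
    intro s
    have := ((hasDerivAt_id s).mul_const b).const_add a
    simpa using this.cexp
  have h1 : deriv (fun s => cexp (a + s * b)) = fun s => cexp (a + s * b) * b :=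
    funext fun s => (h s).deriv
  rw [h1, ((h 0).mul_const b).deriv]
  simp
  ring

section

variable {ι : Type*} [Fintype ι]

/-- The theta series with coefficients the squares of a linear form. -/
noncomputable def thetaSq (A : Matrix ι ι ℝ) (w : ι → ℂ) (τ : ℂ) : ℂ :=
  ∑' n : ι → ℤ, matrixForm A w (fun i => n i) ^ 2 *
    cexp (Real.pi * I * τ * matrixNormSq A (fun i => n i))

theorem hasSum_deriv_deriv_theta [DecidableEq ι] {A : Matrix ι ι ℝ} (hA : IsUnit A.det)
    (w : ι → ℂ) {τ : ℂ} (hτ : 0 < τ.im) (a : ℂ) :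
    HasSum (fun n : ι → ℤ => (2 * Real.pi * I * a) ^ 2 * (matrixForm A w (fun i => n i) ^ 2 *
      cexp (Real.pi * I * τ * matrixNormSq A (fun i => n i))))
      (deriv (deriv fun s => ∑' n : ι → ℤ, thetaGaussian A w τ (a * s) (fun i => n i)) 0) := by
  obtain ⟨u, hu, hub⟩ := exists_summable_norm_thetaGaussian_le hA w hτ (‖a‖ * 3)
  have h := hasSum_deriv_deriv_of_summable_norm
    (f := fun (n : ι → ℤ) s => thetaGaussian A w τ (a * s) (fun i => n i)) hu
    (fun n => by unfold thetaGaussian; fun_prop) (fun n s hs => by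
      have := hub τ (a * s) le_rfl (by
        rw [norm_mul]
        rw [mem_ball_zero_iff] at hs
        gcongr) n 0 (fun i => by simp)
      simpa using this)
  convert h using 2 with n
  have h2 : (fun s => thetaGaussian A w τ (a * s) (fun i => n i)) = fun s =>
      cexp (Real.pi * I * τ * matrixNormSq A (fun i => n i) +
        s * (2 * Real.pi * I * a * matrixForm A w (fun i => n i))) := by
    funext s
    rw [thetaGaussian]
    ring_nf
  rw [h2, deriv_deriv_cexp_affine]
  ring

theorem summable_thetaSq_bound [DecidableEq ι] {A : Matrix ι ι ℝ} (hA : IsUnit A.det)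
    (w : ι → ℂ) {δ : ℝ} (hδ : 0 < δ) :
    Summable fun n : ι → ℤ => ‖matrixForm A w (fun i => n i)‖ ^ 2 *
      Real.exp (-(Real.pi * δ * matrixNormSq A (fun i => n i))) := by
  have h := (hasSum_deriv_deriv_theta hA w (τ := δ * I) (by simpa using hδ) 1).summable.norm
  have h2 : ‖(2 * Real.pi * I * 1 : ℂ) ^ 2‖ ≠ 0 := by
    simp [Real.pi_ne_zero]
  simp only [norm_mul _ (matrixForm _ _ _ ^ 2 * _)] at h
  refine ((summable_mul_left_iff h2).1 h).congr fun n => ?_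
  rw [norm_mul, norm_pow, norm_exp]
  congr 2
  rw [re_mul_ofReal]
  simp [mul_assoc]

theorem norm_thetaSq_term (A : Matrix ι ι ℝ) (w : ι → ℂ) (τ : ℂ) (n : ι → ℝ) :
    ‖matrixForm A w n ^ 2 * cexp (Real.pi * I * τ * matrixNormSq A n)‖ =
      ‖matrixForm A w n‖ ^ 2 * Real.exp (-(Real.pi * τ.im * matrixNormSq A n)) := by
  rw [norm_mul, norm_pow, norm_exp]
  congr 2
  rw [re_mul_ofReal]
  simp [mul_assoc]

theorem thetaSq_neg_inv [DecidableEq ι] (hcard : Fintype.card ι = 24)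
    {A : Matrix ι ι ℝ} {G : Matrix ι ι ℤ} (hG : IsUnit G.det) (hA : IsUnit A.det)
    (hAG : Aᵀ * A = G.map (Int.cast))
    {w : ι → ℂ} (hw : ∑ i, w i ^ 2 = 0) {τ : ℂ} (hτ : 0 < τ.im) :
    thetaSq A w (-1 / τ) = τ ^ 14 * thetaSq A w τ := by
  have hτ0 : τ ≠ 0 := fun h => by simp [h] at hτ
  have hτ' : 0 < (-1 / τ).im := by
    rw [neg_div, one_div, neg_im, inv_im, neg_div, neg_neg]
    have : 0 < normSq τ := normSq_pos.2 hτ0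
    positivity
  have h1 := (hasSum_deriv_deriv_theta hA w hτ τ).tsum_eq
  have h2 := (hasSum_deriv_deriv_theta hA w hτ' 1).tsum_eq
  simp only [theta_functional_equation hcard hG hAG hw hτ, tsum_mul_left] at h1
  simp only [one_mul, tsum_mul_left] at h2
  have h3 : ∀ F : ℂ → ℂ, deriv (deriv fun s => (τ ^ 12)⁻¹ * F s) 0 = (τ ^ 12)⁻¹ * deriv (deriv F) 0 := by
    intro F
    have : (deriv fun s => (τ ^ 12)⁻¹ * F s) = fun s => (τ ^ 12)⁻¹ * deriv F s := by
      funext s; exact deriv_const_mul_field _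
    rw [this]
    exact deriv_const_mul_field _
  rw [h3, ← h2] at h1
  change (2 * Real.pi * I * τ) ^ 2 * thetaSq A w τ =
    (τ ^ 12)⁻¹ * ((2 * Real.pi * I * 1) ^ 2 * thetaSq A w (-1 / τ)) at h1
  have hpi : (Real.pi : ℂ) ≠ 0 := by exact_mod_cast Real.pi_ne_zero
  have h4 : (2 * Real.pi * I * 1 : ℂ) ^ 2 ≠ 0 := by simp [hpi]
  rw [eq_inv_mul_iff_mul_eq₀ (pow_ne_zero _ hτ0)] at h1
  refine mul_left_cancel₀ h4 ?_
  rw [← h1]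
  ring

theorem differentiableOn_thetaSq [DecidableEq ι] {A : Matrix ι ι ℝ} (hA : IsUnit A.det)
    (w : ι → ℂ) : DifferentiableOn ℂ (thetaSq A w) {τ | 0 < τ.im} := by
  intro τ hτ
  have hδ : 0 < τ.im / 2 := half_pos hτ
  have hopen : IsOpen {z : ℂ | τ.im / 2 < z.im} := isOpen_lt continuous_const continuous_im
  have h := differentiableOn_tsum_of_summable_norm (summable_thetaSq_bound hA w hδ)
    (F := fun (n : ι → ℤ) (τ : ℂ) => matrixForm A w (fun i => n i) ^ 2 *
      cexp (Real.pi * I * τ * matrixNormSq A (fun i => n i)))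
    (fun n => by fun_prop) hopen fun n z hz => by
      rw [norm_thetaSq_term]
      have h0 : 0 ≤ matrixNormSq A (fun i => (n i : ℝ)) := Finset.sum_nonneg fun _ _ => sq_nonneg _
      have hz' : τ.im / 2 ≤ z.im := le_of_lt hz
      gcongr
  exact (h.differentiableAt (hopen.mem_nhds (by simpa using hτ))).differentiableWithinAt

theorem matrixNormSq_intCast {A : Matrix ι ι ℝ} {G : Matrix ι ι ℤ}
    (hAG : Aᵀ * A = G.map (Int.cast)) (n : ι → ℤ) :
    matrixNormSq A (fun i => n i) = ((n ⬝ᵥ G *ᵥ n : ℤ) : ℝ) := by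
  have h1 : matrixNormSq A (fun i => n i) =
      (A *ᵥ fun i => (n i : ℝ)) ⬝ᵥ (A *ᵥ fun i => (n i : ℝ)) := by
    simp [matrixNormSq, dotProduct, sq]
  rw [h1, dotProduct_mulVec, ← mulVec_transpose, mulVec_mulVec, hAG, dotProduct_comm]
  simp [dotProduct, mulVec]

theorem thetaSq_add_one {A : Matrix ι ι ℝ} {G : Matrix ι ι ℤ}
    (hAG : Aᵀ * A = G.map (Int.cast)) (heven : ∀ n : ι → ℤ, Even (n ⬝ᵥ G *ᵥ n))
    (w : ι → ℂ) (τ : ℂ) : thetaSq A w (τ + 1) = thetaSq A w τ := by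
  refine tsum_congr fun n => ?_
  congr 1
  obtain ⟨k, hk⟩ := heven n
  rw [matrixNormSq_intCast hAG, hk, Complex.exp_eq_exp_iff_exists_int]
  refine ⟨k, ?_⟩
  push_cast
  ring

end

end

section

open Set MeasureTheory Complex Matrix

open UpperHalfPlane hiding I

open scoped MatrixGroups ModularForm Topology

variable {ι : Type*} [Fintype ι]

theorem matrixNormSq_nonneg (A : Matrix ι ι ℝ) (x : ι → ℝ) : 0 ≤ matrixNormSq A x :=
  Finset.sum_nonneg fun _ _ => sq_nonneg _

theorem matrixForm_eq_zero {A : Matrix ι ι ℝ} {x : ι → ℝ} (hx : matrixNormSq A x = 0)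
    (w : ι → ℂ) : matrixForm A w x = 0 := by
  have : ∀ i, (A *ᵥ x) i = 0 := fun i => by
    simpa using (Finset.sum_eq_zero_iff_of_nonneg fun _ _ => sq_nonneg _).1 hx i
  simp [matrixForm, this]

theorem norm_thetaSq_le_of_one_le_im [DecidableEq ι] {A : Matrix ι ι ℝ} {G : Matrix ι ι ℤ}
    (hA : IsUnit A.det) (hAG : Aᵀ * A = G.map (Int.cast)) (w : ι → ℂ) {τ : ℂ} (hτ : 1 ≤ τ.im) :
    ‖thetaSq A w τ‖ ≤ Real.exp (-(Real.pi * (τ.im - 1))) *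
      ∑' n : ι → ℤ, ‖matrixForm A w (fun i => n i)‖ ^ 2 *
        Real.exp (-(Real.pi * 1 * matrixNormSq A (fun i => n i))) := by
  rw [← tsum_mul_left]
  refine tsum_of_norm_bounded
    ((summable_thetaSq_bound hA w one_pos).mul_left _).hasSum fun n => ?_
  rw [norm_thetaSq_term, mul_left_comm, ← Real.exp_add]
  have h0 := matrixNormSq_nonneg A (fun i => (n i : ℝ))
  by_cases hn : matrixNormSq A (fun i => (n i : ℝ)) = 0
  · simp [matrixForm_eq_zero hn]
  · have h1 : 1 ≤ matrixNormSq A (fun i => (n i : ℝ)) := by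
      rw [matrixNormSq_intCast hAG] at h0 hn ⊢
      exact_mod_cast Int.cast_pos.1 (lt_of_le_of_ne h0 (Ne.symm hn))
    gcongr
    nlinarith [Real.pi_pos, mul_nonneg (mul_nonneg Real.pi_pos.le (sub_nonneg.2 hτ))
      (sub_nonneg.2 h1)]

theorem thetaSq_T_invariant {A : Matrix ι ι ℝ} {G : Matrix ι ι ℤ}
    (hAG : Aᵀ * A = G.map (Int.cast)) (heven : ∀ n : ι → ℤ, Even (n ⬝ᵥ G *ᵥ n)) (w : ι → ℂ) :
    ((fun z : ℍ => thetaSq A w z) ∣[(14 : ℤ)] ModularGroup.T) = fun z : ℍ => thetaSq A w z := by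
  funext z
  rw [ModularForm.SL_slash_apply, ModularGroup.denom_apply, modular_T_smul, coe_vadd, ofReal_one, add_comm,
    thetaSq_add_one hAG heven]
  simp [ModularGroup.coe_T]

variable [DecidableEq ι]

theorem thetaSq_S_invariant (hcard : Fintype.card ι = 24)
    {A : Matrix ι ι ℝ} {G : Matrix ι ι ℤ} (hG : IsUnit G.det) (hA : IsUnit A.det)
    (hAG : Aᵀ * A = G.map (Int.cast)) {w : ι → ℂ} (hw : ∑ i, w i ^ 2 = 0) :
    ((fun z : ℍ => thetaSq A w z) ∣[(14 : ℤ)] ModularGroup.S) = fun z : ℍ => thetaSq A w z := by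
  funext z
  have h := thetaSq_neg_inv hcard hG hA hAG hw z.2
  have hS : ((ModularGroup.S • z : ℍ) : ℂ) = -1 / (z : ℂ) := by
    rw [UpperHalfPlane.modular_S_smul, coe_mk, neg_div, one_div, inv_neg]
  rw [ModularForm.SL_slash_apply, ModularGroup.denom_S, hS]
  erw [h]
  rw [mul_comm, ← mul_assoc, ← zpow_natCast, ← zpow_add₀ z.ne_zero]
  simp

theorem thetaSq_eq_zero (hcard : Fintype.card ι = 24)
    {A : Matrix ι ι ℝ} {G : Matrix ι ι ℤ} (hG : IsUnit G.det) (hA : IsUnit A.det)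
    (hAG : Aᵀ * A = G.map (Int.cast)) (heven : ∀ n : ι → ℤ, Even (n ⬝ᵥ G *ᵥ n))
    {w : ι → ℂ} (hw : ∑ i, w i ^ 2 = 0) {τ : ℂ} (hτ : 0 < τ.im) : thetaSq A w τ = 0 := by
  have hS := thetaSq_S_invariant hcard hG hA hAG hw
  have hT := thetaSq_T_invariant hAG heven w
  let F : CuspForm 𝒮ℒ 14 :=
    { toFun := fun z : ℍ => thetaSq A w z
      slash_action_eq' := fun g hg => by
        obtain ⟨g, rfl⟩ := hg
        exact SlashInvariantForm.slash_action_generators_SL2Z hS hT g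
      holo' := by
        rw [UpperHalfPlane.mdifferentiable_iff]
        refine (differentiableOn_thetaSq hA w).congr fun z hz => ?_
        simp [ofComplex_apply_of_im_pos hz]
      zero_at_cusps' := fun hc => by
        rw [Subgroup.IsArithmetic.isCusp_iff_isCusp_SL2Z] at hc
        rw [OnePoint.isZeroAt_iff_forall_SL2Z hc]
        intro γ _
        rw [SlashInvariantForm.slash_action_generators_SL2Z hS hT]
        rw [isZeroAtImInfty_iff]
        intro ε hε
        set C := ∑' n : ι → ℤ, ‖matrixForm A w (fun i => n i)‖ ^ 2 *
          Real.exp (-(Real.pi * 1 * matrixNormSq A (fun i => n i))) with hC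
        have hlim : Filter.Tendsto (fun t : ℝ => Real.exp (-(Real.pi * (t - 1))) * C)
            Filter.atTop (𝓝 (0 * C)) := by
          refine (Real.tendsto_exp_neg_atTop_nhds_zero.comp ?_).mul_const C
          exact (Filter.tendsto_atTop_add_const_right _ _ Filter.tendsto_id).const_mul_atTop
            Real.pi_pos
        rw [zero_mul] at hlim
        obtain ⟨T, hT⟩ := ((hlim.eventually_le_const hε).and
          (Filter.eventually_ge_atTop 1)).exists_forall_of_atTop
        refine ⟨T, fun z hz => ?_⟩
        have := hT z.im hz
        exact (norm_thetaSq_le_of_one_le_im hA hAG w this.2).trans this.1 }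
  have hF : F = 0 := by
    have h := ModularForm.levelOne_weight_two_rank_zero
    rw [rank_zero_iff_forall_zero] at h
    exact (CuspForm.discriminantEquiv (k := 14)).map_eq_zero_iff.1 (h _)
  exact congrArg (fun f : CuspForm 𝒮ℒ 14 => f ⟨τ, hτ⟩) hF

/-- The weight-14 theta series has vanishing first coefficient. -/
theorem sum_matrixForm_sq_eq_zero (hcard : Fintype.card ι = 24)
    {A : Matrix ι ι ℝ} {G : Matrix ι ι ℤ} (hG : IsUnit G.det) (hA : IsUnit A.det)
    (hAG : Aᵀ * A = G.map (Int.cast)) (heven : ∀ n : ι → ℤ, Even (n ⬝ᵥ G *ᵥ n))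
    {w : ι → ℂ} (hw : ∑ i, w i ^ 2 = 0) :
    ∑' n : ι → ℤ, (if n ⬝ᵥ G *ᵥ n = 2 then matrixForm A w (fun i => n i) ^ 2 else 0) = 0 := by
  have hQ : ∀ n : ι → ℤ, matrixNormSq A (fun i => n i) = 0 ∨ matrixNormSq A (fun i => n i) = 2 ∨
      2 < matrixNormSq A (fun i => n i) := by
    intro n
    have h0 := matrixNormSq_nonneg A (fun i => (n i : ℝ))
    rw [matrixNormSq_intCast hAG] at h0 ⊢
    norm_cast at h0 ⊢
    have := heven n
    grind
  have hlim : Filter.Tendsto (fun t : ℝ => ∑' n : ι → ℤ, matrixForm A w (fun i => n i) ^ 2 *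
      (Real.exp (-(Real.pi * t * (matrixNormSq A (fun i => n i) - 2))) : ℂ)) Filter.atTop
      (𝓝 (∑' n : ι → ℤ, (if n ⬝ᵥ G *ᵥ n = 2 then matrixForm A w (fun i => n i) ^ 2 else 0))) := by
    refine tendsto_tsum_of_dominated_convergence
      ((summable_thetaSq_bound hA w one_pos).mul_left (Real.exp (2 * Real.pi))) ?_ ?_
    · intro n
      have h0 := matrixNormSq_nonneg A (fun i => (n i : ℝ))
      by_cases h2 : n ⬝ᵥ G *ᵥ n = 2
      · rw [if_pos h2, matrixNormSq_intCast hAG, h2]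
        simp
      rw [if_neg h2]
      rcases hQ n with h | h | h
      · simp [matrixForm_eq_zero h]
      · exact absurd (by rw [matrixNormSq_intCast hAG] at h; exact_mod_cast h) h2
      have h3 : Filter.Tendsto (fun t : ℝ =>
          Real.exp (-(Real.pi * t * (matrixNormSq A (fun i => n i) - 2)))) Filter.atTop (𝓝 0) := by
        refine Real.tendsto_exp_neg_atTop_nhds_zero.comp ?_
        exact (Filter.tendsto_id.const_mul_atTop Real.pi_pos).atTop_mul_const (by linarith)
      have h4 := ((continuous_ofReal.tendsto 0).comp h3).const_mul
        (matrixForm A w (fun i => n i) ^ 2)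
      simpa using h4
    · filter_upwards [Filter.eventually_ge_atTop 1] with t ht n
      rw [norm_mul, norm_pow, norm_real, Real.norm_of_nonneg (Real.exp_pos _).le, mul_left_comm,
        ← Real.exp_add]
      rcases hQ n with h | h
      · simp [matrixForm_eq_zero h]
      · have h1 : 0 ≤ matrixNormSq A (fun i => n i) - 2 := by rcases h with h | h <;> linarith
        gcongr
        nlinarith [Real.pi_pos, mul_nonneg (mul_nonneg Real.pi_pos.le (sub_nonneg.2 ht)) h1]
  have hz : ∀ t : ℝ, 0 < t → ∑' n : ι → ℤ, matrixForm A w (fun i => n i) ^ 2 *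
      (Real.exp (-(Real.pi * t * (matrixNormSq A (fun i => n i) - 2))) : ℂ) = 0 := by
    intro t ht
    have h := thetaSq_eq_zero hcard hG hA hAG heven hw (τ := t * I) (by simpa using ht)
    have h2 : ∀ n : ι → ℤ, matrixForm A w (fun i => n i) ^ 2 *
      (Real.exp (-(Real.pi * t * (matrixNormSq A (fun i => n i) - 2))) : ℂ) =
      cexp (2 * Real.pi * t) * (matrixForm A w (fun i => n i) ^ 2 *
        cexp (Real.pi * I * (t * I) * matrixNormSq A (fun i => n i))) := by
      intro n
      rw [mul_left_comm, ← Complex.exp_add, ofReal_exp]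
      congr 2
      push_cast
      linear_combination (Real.pi * t * matrixNormSq A (fun i => n i)) * (-I_sq)
    simp only [h2, tsum_mul_left]
    rw [thetaSq] at h
    rw [h, mul_zero]
  refine tendsto_nhds_unique hlim (tendsto_const_nhds.congr' ?_)
  filter_upwards [Filter.eventually_gt_atTop 0] with t ht
  exact (hz t ht).symm

end

section

variable {V : Type*} [AddCommGroup V] [Module ℚ V]

theorem isTorsionFree_int_of_rat (V : Type*) [AddCommGroup V] [Module ℚ V] :
    Module.IsTorsionFree ℤ V :=
  .of_smul_eq_zero fun r m h => by
    rw [← Int.cast_smul_eq_zsmul ℚ, smul_eq_zero] at h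
    simpa using h

/-- `L` is an even unimodular positive definite lattice of full rank 24 in `(V, B)`. -/
structure IsNiemeier (B : V →ₗ[ℚ] V →ₗ[ℚ] ℚ) (L : Submodule ℤ V) : Prop where
  fg : L.FG
  span_eq : Submodule.span ℚ (L : Set V) = ⊤
  finrank_eq : Module.finrank ℚ V = 24
  symm : ∀ x y, B x y = B y x
  int : ∀ x ∈ L, ∀ y ∈ L, ∃ n : ℤ, B x y = n
  pos : ∀ x ∈ L, x ≠ 0 → 0 < B x x
  even : ∀ x ∈ L, ∃ n : ℤ, B x x = 2 * n
  unimodular : ∀ v, (∀ y ∈ L, ∃ n : ℤ, B v y = n) → v ∈ L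

namespace IsNiemeier

variable {B : V →ₗ[ℚ] V →ₗ[ℚ] ℚ} {L : Submodule ℤ V}

theorem exists_smul_mem (hL : IsNiemeier B L) (x : V) : ∃ N : ℤ, N ≠ 0 ∧ N • x ∈ L := by
  have hx : x ∈ Submodule.span ℚ (L : Set V) := hL.span_eq ▸ Submodule.mem_top
  induction hx using Submodule.span_induction with
  | mem x hx => exact ⟨1, one_ne_zero, by simpa using hx⟩
  | zero => exact ⟨1, one_ne_zero, by simp⟩
  | add x y _ _ hx hy =>
    obtain ⟨N, hN, hx⟩ := hx
    obtain ⟨M, hM, hy⟩ := hy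
    refine ⟨M * N, mul_ne_zero hM hN, ?_⟩
    rw [smul_add, mul_smul, mul_comm M N, mul_smul]
    exact L.add_mem (L.smul_mem _ hx) (L.smul_mem _ hy)
  | smul q x _ hx =>
    obtain ⟨N, hN, hx⟩ := hx
    refine ⟨q.den * N, mul_ne_zero (by exact_mod_cast q.den_ne_zero) hN, ?_⟩
    have : ((q.den : ℤ) * N) • q • x = q.num • N • x := by
      simp only [← Int.cast_smul_eq_zsmul ℚ, smul_smul]
      congr 1
      push_cast
      linear_combination (N : ℚ) * q.den_mul_eq_num
    rw [this]
    exact L.smul_mem _ hx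

theorem pos_of_ne_zero (hL : IsNiemeier B L) {x : V} (hx : x ≠ 0) : 0 < B x x := by
  have := isTorsionFree_int_of_rat V
  obtain ⟨N, hN, h⟩ := hL.exists_smul_mem x
  have h1 := hL.pos _ h (smul_ne_zero hN hx)
  simp only [map_zsmul, LinearMap.smul_apply, zsmul_eq_mul] at h1
  have : (0 : ℚ) < N ^ 2 := by positivity
  nlinarith

theorem self_nonneg (hL : IsNiemeier B L) (x : V) : 0 ≤ B x x := by
  rcases eq_or_ne x 0 with rfl | hx
  · simp
  · exact (hL.pos_of_ne_zero hx).le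

theorem eq_zero_of_self (hL : IsNiemeier B L) {x : V} (hx : B x x = 0) : x = 0 := by
  by_contra h
  exact (hL.pos_of_ne_zero h).ne' hx

theorem exists_basis (hL : IsNiemeier B L) :
    ∃ b : Module.Basis (Fin 24) ℚ V, (∀ i, b i ∈ L) ∧
      ∀ x ∈ L, ∃ n : Fin 24 → ℤ, x = ∑ i, n i • b i := by
  have : Module.Finite ℤ L := Module.Finite.iff_fg.2 hL.fg
  have := isTorsionFree_int_of_rat V
  have : Module.IsTorsionFree ℤ L := inferInstance
  have : Module.Free ℤ L := inferInstance
  let b := Module.finBasis ℤ L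
  have h1 : LinearIndependent ℤ fun i => (b i : V) :=
    b.linearIndependent.map' L.subtype (Submodule.ker_subtype L)
  have h2 : LinearIndependent ℚ fun i => (b i : V) := (LinearIndependent.iff_fractionRing ℤ ℚ).1 h1
  have h4 : ∀ x ∈ L, ∃ n : Fin (Module.finrank ℤ L) → ℤ, x = ∑ i, n i • (b i : V) := by
    intro x hx
    refine ⟨fun i => b.repr ⟨x, hx⟩ i, ?_⟩
    have := congrArg L.subtype (b.sum_repr ⟨x, hx⟩)
    rw [map_sum] at this
    exact this.symm
  have h3 : ⊤ ≤ Submodule.span ℚ (Set.range fun i => (b i : V)) := by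
    rw [← hL.span_eq, Submodule.span_le]
    intro x hx
    obtain ⟨n, rfl⟩ := h4 x hx
    refine Submodule.sum_mem _ fun i _ => ?_
    rw [← Int.cast_smul_eq_zsmul ℚ]
    exact Submodule.smul_mem _ _ (Submodule.subset_span ⟨i, rfl⟩)
  let c := Module.Basis.mk h2 h3
  have hn : Module.finrank ℤ L = 24 := by
    rw [← hL.finrank_eq, Module.finrank_eq_card_basis c, Fintype.card_fin]
  have hc : ∀ i, c i = b i := fun i => Module.Basis.mk_apply h2 h3 i
  refine ⟨c.reindex (finCongr hn), fun i => by simp [hc], fun x hx => ?_⟩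
  obtain ⟨n, hn'⟩ := h4 x hx
  refine ⟨n ∘ (finCongr hn).symm, ?_⟩
  rw [hn', ← (finCongr hn).sum_comp]
  simp [hc]

theorem exists_coords (hL : IsNiemeier B L) :
    ∃ φ : V →+ (Fin 24 → ℝ), ∀ x y, (B x y : ℝ) = ∑ i, φ x i * φ y i := by
  have : FiniteDimensional ℚ V := Module.finite_of_finrank_pos (by rw [hL.finrank_eq]; norm_num)
  obtain ⟨v, hv⟩ := LinearMap.BilinForm.exists_orthogonal_basis (B := B) ⟨fun x y => hL.symm x y⟩
  let e := v.reindex (finCongr hL.finrank_eq)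
  have he : ∀ i j, i ≠ j → B (e i) (e j) = 0 := by
    intro i j hij
    simp only [e, Module.Basis.reindex_apply]
    exact hv (fun h => hij (by simpa using h))
  refine ⟨⟨⟨fun x i => (e.repr x i : ℝ) * Real.sqrt (B (e i) (e i) : ℚ), ?_⟩, ?_⟩, ?_⟩
  · ext i; simp
  · intro x y; ext i; simp [add_mul]
  · intro x y
    conv_lhs => rw [← e.sum_repr x, ← e.sum_repr y]
    simp only [map_sum, LinearMap.sum_apply, map_smul, LinearMap.smul_apply, smul_eq_mul]
    rw [Rat.cast_sum]
    refine Finset.sum_congr rfl fun i _ => ?_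
    rw [Finset.sum_eq_single i]
    · have : (0 : ℝ) ≤ (B (e i) (e i) : ℚ) := by exact_mod_cast hL.self_nonneg _
      have h2 := Real.mul_self_sqrt this
      simp only [AddMonoidHom.coe_mk, ZeroHom.coe_mk]
      push_cast
      linear_combination (-(e.repr x i : ℝ) * (e.repr y i : ℝ)) * h2
    · intro j _ hj
      simp [he j i hj]
    · simp

end IsNiemeier

end

section

open Matrix

variable {V : Type*} [AddCommGroup V] [Module ℚ V]

open Classical in
/-- The roots of `L`, as a finset. -/
noncomputable def rootFinset (B : V →ₗ[ℚ] V →ₗ[ℚ] ℚ) (L : Submodule ℤ V) : Finset V :=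
  if h : {x | x ∈ L ∧ B x x = 2}.Finite then h.toFinset else ∅

namespace IsNiemeier

variable {B : V →ₗ[ℚ] V →ₗ[ℚ] ℚ} {L : Submodule ℤ V}

theorem nondegenerate (hL : IsNiemeier B L) : LinearMap.BilinForm.Nondegenerate B :=
  ⟨fun x h => hL.eq_zero_of_self (h x), fun x h => hL.eq_zero_of_self (h x)⟩

theorem exists_gram (hL : IsNiemeier B L) :
    ∃ (b : Module.Basis (Fin 24) ℚ V) (φ : V →+ (Fin 24 → ℝ)) (A : Matrix (Fin 24) (Fin 24) ℝ)
      (G : Matrix (Fin 24) (Fin 24) ℤ),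
      (∀ i, b i ∈ L) ∧ (∀ x ∈ L, ∃ n : Fin 24 → ℤ, x = ∑ i, n i • b i) ∧
      (∀ x y, (B x y : ℝ) = ∑ i, φ x i * φ y i) ∧
      (∀ n : Fin 24 → ℤ, A *ᵥ (fun i => (n i : ℝ)) = φ (∑ i, n i • b i)) ∧
      (∀ n m : Fin 24 → ℤ, B (∑ i, n i • b i) (∑ i, m i • b i) = (n ⬝ᵥ G *ᵥ m : ℤ)) ∧
      IsUnit G.det ∧ IsUnit A.det ∧ Aᵀ * A = G.map (Int.cast) := by
  obtain ⟨b, hb, hbL⟩ := hL.exists_basis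
  obtain ⟨φ, hφ⟩ := hL.exists_coords
  choose G hG using fun i j => hL.int (b i) (hb i) (b j) (hb j)
  have hAG : (Matrix.of fun i j => φ (b j) i)ᵀ * (Matrix.of fun i j => φ (b j) i) =
      (Matrix.of G).map (Int.cast : ℤ → ℝ) := by
    ext i j
    have := hφ (b i) (b j)
    rw [hG] at this
    simp only [mul_apply, transpose_apply, of_apply, map_apply]
    rw [← this]
    simp
  have hGB : ∀ n m : Fin 24 → ℤ,
      B (∑ i, n i • b i) (∑ i, m i • b i) = (n ⬝ᵥ (Matrix.of G) *ᵥ m : ℤ) := by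
    intro n m
    simp only [map_sum, LinearMap.sum_apply, map_zsmul, LinearMap.smul_apply, hG]
    simp only [dotProduct, mulVec, of_apply, Finset.mul_sum, Finset.smul_sum]
    rw [Finset.sum_comm]
    push_cast
    refine Finset.sum_congr rfl fun i _ => Finset.sum_congr rfl fun j _ => ?_
    simp only [zsmul_eq_mul]
    ring
  have hdet : IsUnit (Matrix.of G).det := by
    let d := LinearMap.BilinForm.dualBasis B hL.nondegenerate b
    have hd : ∀ i j, B (d i) (b j) = if j = i then 1 else 0 :=
      LinearMap.BilinForm.apply_dualBasis_left hL.nondegenerate b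
    have hdL : ∀ i, d i ∈ L := fun i => hL.unimodular _ fun y hy => by
      obtain ⟨n, rfl⟩ := hbL y hy
      refine ⟨n i, ?_⟩
      simp [hd]
    choose H hH using fun i => hbL (d i) (hdL i)
    have : Matrix.of H * Matrix.of G = 1 := by
      ext i j
      have h1 := hd i j
      rw [hH] at h1
      simp only [map_sum, LinearMap.sum_apply, map_zsmul, LinearMap.smul_apply, hG,
        zsmul_eq_mul] at h1
      rw [one_apply, mul_apply]
      simp only [of_apply]
      have h2 : (if i = j then (1 : ℤ) else 0) = if j = i then 1 else 0 := by simp [eq_comm]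
      rw [h2]
      exact_mod_cast h1
    exact Matrix.isUnit_det_of_left_inverse this
  refine ⟨b, φ, Matrix.of fun i j => φ (b j) i, Matrix.of G, hb, hbL, hφ, fun n => ?_, hGB, hdet,
    ?_, hAG⟩
  · ext i
    simp [mulVec, dotProduct, mul_comm]
  · have h1 := congrArg det hAG
    rw [det_mul, det_transpose] at h1
    have h2 : ((Matrix.of G).map (Int.cast : ℤ → ℝ)).det = ((Matrix.of G).det : ℝ) :=
      (Int.cast_det _).symm
    rw [h2] at h1
    have h3 : (((Matrix.of G).det : ℤ) : ℝ) ≠ 0 := by exact_mod_cast hdet.ne_zero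
    rw [isUnit_iff_ne_zero]
    intro h
    rw [h, zero_mul] at h1
    exact h3 h1.symm

theorem finite_roots (hL : IsNiemeier B L) : {x | x ∈ L ∧ B x x = 2}.Finite := by
  obtain ⟨b, φ, A, G, hb, hbL, hφ, hA, hGB, hG, hAu, hAG⟩ := hL.exists_gram
  obtain ⟨c, hc, h⟩ := exists_le_matrixNormSq hAu
  obtain ⟨K, hK⟩ := exists_nat_ge (1 + 2 / c)
  refine ((Set.Finite.pi' fun _ : Fin 24 => Set.finite_Icc (-(K : ℤ)) K).image
    fun n => ∑ i, n i • b i).subset ?_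
  rintro x ⟨hx, hx2⟩
  obtain ⟨n, rfl⟩ := hbL x hx
  refine ⟨n, fun i => ?_, rfl⟩
  have h1 := h fun i => n i
  rw [matrixNormSq_intCast hAG] at h1
  rw [hGB] at hx2
  have hx3 : (n ⬝ᵥ G *ᵥ n : ℤ) = 2 := by exact_mod_cast hx2
  rw [hx3] at h1
  have h2 : |(n i : ℝ)| ≤ ∑ i, |(n i : ℝ)| :=
    Finset.single_le_sum (f := fun i => |(n i : ℝ)|) (fun _ _ => abs_nonneg _) (Finset.mem_univ i)
  have h3 : (∑ i, |(n i : ℝ)|) ^ 2 ≤ 2 / c := by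
    rw [le_div_iff₀ hc]
    push_cast at h1
    linarith
  have h4 : |(n i : ℝ)| ≤ K := by nlinarith [sq_nonneg (∑ i, |(n i : ℝ)| - 1)]
  exact abs_le.1 (by exact_mod_cast h4)

theorem mem_rootFinset (hL : IsNiemeier B L) {r : V} :
    r ∈ rootFinset B L ↔ r ∈ L ∧ B r r = 2 := by
  rw [rootFinset, dif_pos hL.finite_roots]
  simp

theorem exists_coords_isotropic (hL : IsNiemeier B L) :
    ∃ φ : V →+ (Fin 24 → ℝ), (∀ x y, (B x y : ℝ) = ∑ i, φ x i * φ y i) ∧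
      ∀ w : Fin 24 → ℂ, ∑ i, w i ^ 2 = 0 →
        ∑ r ∈ rootFinset B L, (∑ i, (φ r i : ℂ) * w i) ^ 2 = 0 := by
  obtain ⟨b, φ, A, G, hb, hbL, hφ, hA, hGB, hG, hAu, hAG⟩ := hL.exists_gram
  refine ⟨φ, hφ, fun w hw => ?_⟩
  have hmem : ∀ n : Fin 24 → ℤ, ∑ i, n i • b i ∈ L := fun n =>
    Submodule.sum_mem _ fun i _ => L.smul_mem _ (hb i)
  have heven : ∀ n : Fin 24 → ℤ, Even (n ⬝ᵥ G *ᵥ n) := by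
    intro n
    obtain ⟨k, hk⟩ := hL.even _ (hmem n)
    rw [hGB] at hk
    exact ⟨k, by rw [← two_mul]; exact_mod_cast hk⟩
  have hinj : Function.Injective fun n : Fin 24 → ℤ => ∑ i, n i • b i := by
    intro n m h
    have h1 : ∑ i, (n i : ℚ) • b i = ∑ i, (m i : ℚ) • b i := by
      simpa only [Int.cast_smul_eq_zsmul] using h
    funext i
    have := congrArg (fun x => b.repr x i) h1
    simpa [Finsupp.single_apply] using this
  have hroot : ∀ n : Fin 24 → ℤ, ∑ i, n i • b i ∈ rootFinset B L ↔ n ⬝ᵥ G *ᵥ n = 2 := by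
    intro n
    rw [hL.mem_rootFinset, hGB]
    exact ⟨fun h => by exact_mod_cast h.2, fun h => ⟨hmem n, by rw [h]; norm_num⟩⟩
  have h := sum_matrixForm_sq_eq_zero (by simp) hG hAu hAG heven hw
  rw [← h, ← Finset.sum_preimage (fun n : Fin 24 → ℤ => ∑ i, n i • b i) _ hinj.injOn
    (fun x => (∑ i, (φ x i : ℂ) * w i) ^ 2), tsum_eq_sum (s := (rootFinset B L).preimage _ hinj.injOn)]
  · refine Finset.sum_congr rfl fun n hn => ?_
    rw [Finset.mem_preimage, hroot] at hn
    rw [if_pos hn, matrixForm, hA]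
  · intro n hn
    rw [Finset.mem_preimage, hroot] at hn
    rw [if_neg hn]
  · intro x hx hx'
    obtain ⟨n, rfl⟩ := hbL x (hL.mem_rootFinset.1 hx).1
    exact absurd ⟨n, rfl⟩ hx'

/-- The roots of an even unimodular lattice of rank 24 form a spherical 2-design. -/
theorem sum_roots_sq (hL : IsNiemeier B L) (x : V) :
    ∑ r ∈ rootFinset B L, B x r ^ 2 = (rootFinset B L).card / 12 * B x x := by
  obtain ⟨φ, hφ, hw⟩ := hL.exists_coords_isotropic
  have key : ∀ j k, j ≠ k → ∑ r ∈ rootFinset B L, φ r j * φ r k = 0 ∧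
      ∑ r ∈ rootFinset B L, φ r j ^ 2 = ∑ r ∈ rootFinset B L, φ r k ^ 2 := by
    intro j k hjk
    have h := hw (Pi.single j 1 + Pi.single k Complex.I) (by
      have : ∀ i, (Pi.single j 1 + Pi.single k Complex.I : Fin 24 → ℂ) i ^ 2 =
          (if i = j then 1 else 0) + if i = k then -1 else 0 := by
        intro i
        by_cases h1 : i = j
        · subst h1; simp [hjk]
        · by_cases h2 : i = k
          · subst h2; simp [h1]
          · simp [h1, h2]
      simp only [this, Finset.sum_add_distrib, Finset.sum_ite_eq', Finset.mem_univ, if_true]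
      norm_num)
    have h1 : ∀ r : V, (∑ i, (φ r i : ℂ) * (Pi.single j 1 + Pi.single k Complex.I : Fin 24 → ℂ) i) ^ 2
        = ((φ r j ^ 2 - φ r k ^ 2 : ℝ) : ℂ) + ((2 * (φ r j * φ r k) : ℝ) : ℂ) * Complex.I := by
      intro r
      simp only [Pi.add_apply, mul_add, Finset.sum_add_distrib, Pi.single_apply, mul_ite, mul_one,
        mul_zero, Finset.sum_ite_eq', Finset.mem_univ, if_true]
      push_cast
      linear_combination (φ r k : ℂ) ^ 2 * Complex.I_sq
    simp only [h1, Finset.sum_add_distrib, ← Finset.sum_mul, ← Complex.ofReal_sum] at h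
    have h2 := congrArg Complex.re h
    have h3 := congrArg Complex.im h
    simp only [Complex.add_re, Complex.add_im, Complex.mul_re, Complex.mul_im, Complex.ofReal_re,
      Complex.ofReal_im, Complex.I_re, Complex.I_im, Complex.zero_re, Complex.zero_im,
      Finset.sum_sub_distrib, ← Finset.mul_sum] at h2 h3
    exact ⟨by linarith, by linarith⟩
  have hdiag : ∀ j, ∑ r ∈ rootFinset B L, φ r j ^ 2 = (rootFinset B L).card / 12 := by
    intro j
    have h1 : ∑ i, ∑ r ∈ rootFinset B L, φ r i ^ 2 = 2 * (rootFinset B L).card := by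
      rw [Finset.sum_comm]
      have : ∀ r ∈ rootFinset B L, ∑ i, φ r i ^ 2 = 2 := by
        intro r hr
        have := hφ r r
        rw [(hL.mem_rootFinset.1 hr).2] at this
        simpa [sq] using this.symm
      rw [Finset.sum_congr rfl this]
      simp [mul_comm]
    have h2 : ∀ i, ∑ r ∈ rootFinset B L, φ r i ^ 2 = ∑ r ∈ rootFinset B L, φ r j ^ 2 := by
      intro i
      rcases eq_or_ne i j with rfl | h
      · rfl
      · exact (key i j h).2
    simp only [h2, Finset.sum_const, Finset.card_univ, Fintype.card_fin] at h1
    simp only [nsmul_eq_mul] at h1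
    push_cast at h1
    linarith
  have hreal : ∑ r ∈ rootFinset B L, (B x r : ℝ) ^ 2 =
      (rootFinset B L).card / 12 * (B x x : ℝ) := by
    have h1 : ∀ r, (B x r : ℝ) ^ 2 = ∑ j, ∑ k, φ x j * φ x k * (φ r j * φ r k) := by
      intro r
      rw [hφ, sq, Finset.sum_mul_sum]
      exact Finset.sum_congr rfl fun _ _ => Finset.sum_congr rfl fun _ _ => by ring
    simp only [h1]
    rw [Finset.sum_comm, hφ, Finset.mul_sum]
    refine Finset.sum_congr rfl fun j _ => ?_
    rw [Finset.sum_comm, Finset.sum_eq_single j]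
    · rw [← Finset.mul_sum, ← hdiag j]
      simp only [sq]
      ring
    · intro k _ hk
      rw [← Finset.mul_sum, (key j k hk.symm).1, mul_zero]
    · simp
  have h2 : ((∑ r ∈ rootFinset B L, B x r ^ 2 : ℚ) : ℝ) =
      (((rootFinset B L).card / 12 * B x x : ℚ) : ℝ) := by
    push_cast
    exact hreal
  exact Rat.cast_injective h2

end IsNiemeier

end

section

variable {V : Type*} [AddCommGroup V] [Module ℚ V]

namespace IsNiemeier

variable {B : V →ₗ[ℚ] V →ₗ[ℚ] ℚ} {L : Submodule ℤ V}

local notation "R" => rootFinset B L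

theorem root_mem (hL : IsNiemeier B L) {r : V} (hr : r ∈ R) : r ∈ L := (hL.mem_rootFinset.1 hr).1

theorem root_self (hL : IsNiemeier B L) {r : V} (hr : r ∈ R) : B r r = 2 :=
  (hL.mem_rootFinset.1 hr).2

theorem neg_root (hL : IsNiemeier B L) {r : V} (hr : r ∈ R) : -r ∈ R :=
  hL.mem_rootFinset.2 ⟨L.neg_mem (hL.root_mem hr), by simpa using hL.root_self hr⟩

theorem neg_root_iff (hL : IsNiemeier B L) {r : V} : -r ∈ R ↔ r ∈ R :=
  ⟨fun h => by simpa using hL.neg_root h, hL.neg_root⟩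

theorem self_sub (hL : IsNiemeier B L) (x y : V) :
    B (x - y) (x - y) = B x x - 2 * B x y + B y y := by
  simp only [map_sub, LinearMap.sub_apply]
  rw [hL.symm y x]
  ring

theorem self_add (hL : IsNiemeier B L) (x y : V) :
    B (x + y) (x + y) = B x x + 2 * B x y + B y y := by
  simp only [map_add, LinearMap.add_apply]
  rw [hL.symm y x]
  ring

theorem root_pair (hL : IsNiemeier B L) {r s : V} (hr : r ∈ R) (hs : s ∈ R) :
    B r s = 0 ∨ B r s = 1 ∨ B r s = -1 ∨ r = s ∨ r = -s := by
  obtain ⟨n, hn⟩ := hL.int r (hL.root_mem hr) s (hL.root_mem hs)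
  have h1 := hL.self_sub r s
  have h2 := hL.self_add r s
  have h3 := hL.self_nonneg (r - s)
  have h4 := hL.self_nonneg (r + s)
  rw [hL.root_self hr, hL.root_self hs, hn] at h1 h2
  have h5 : n ≤ 2 := by
    have : (n : ℚ) ≤ 2 := by linarith
    exact_mod_cast this
  have h6 : -2 ≤ n := by
    have : (-2 : ℚ) ≤ n := by linarith
    exact_mod_cast this
  rw [hn]
  obtain rfl | rfl | rfl | rfl | rfl : n = 0 ∨ n = 1 ∨ n = -1 ∨ n = 2 ∨ n = -2 := by omega
  · simp
  · simp
  · simp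
  · refine .inr (.inr (.inr (.inl ?_)))
    rw [← sub_eq_zero]
    exact hL.eq_zero_of_self (by rw [h1]; norm_num)
  · refine .inr (.inr (.inr (.inr ?_)))
    rw [← sub_eq_zero, sub_neg_eq_add]
    exact hL.eq_zero_of_self (by rw [h2]; norm_num)

theorem sub_root (hL : IsNiemeier B L) {r s : V} (hr : r ∈ R) (hs : s ∈ R) (h : B r s = 1) :
    r - s ∈ R :=
  hL.mem_rootFinset.2 ⟨L.sub_mem (hL.root_mem hr) (hL.root_mem hs), by
    rw [hL.self_sub, hL.root_self hr, hL.root_self hs, h]; norm_num⟩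

theorem add_root (hL : IsNiemeier B L) {r s : V} (hr : r ∈ R) (hs : s ∈ R) (h : B r s = -1) :
    r + s ∈ R := by
  have := hL.sub_root hr (hL.neg_root hs) (by simp [h])
  simpa using this

open Classical in
/-- The roots at angle `π / 3` to `s`. -/
noncomputable def _root_.adjRoots (B : V →ₗ[ℚ] V →ₗ[ℚ] ℚ) (L : Submodule ℤ V) (s : V) : Finset V :=
  {a ∈ rootFinset B L | B a s = 1}

local notation "N" => adjRoots B L

theorem _root_.mem_adjRoots {a s : V} : a ∈ N s ↔ a ∈ R ∧ B a s = 1 := by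
  classical simp [adjRoots]

theorem sub_mem_adjRoots (hL : IsNiemeier B L) {a s : V} (hs : s ∈ R) (ha : a ∈ N s) :
    s - a ∈ N s := by
  rw [mem_adjRoots] at ha ⊢
  refine ⟨hL.sub_root hs ha.1 (by rw [hL.symm]; exact ha.2), ?_⟩
  rw [map_sub, LinearMap.sub_apply, hL.root_self hs, ha.2]
  norm_num

theorem sub_mem_of_adjRoots (hL : IsNiemeier B L) {a s : V} (hs : s ∈ R) (ha : a ∈ N s) :
    a - s ∈ R := hL.sub_root (mem_adjRoots.1 ha).1 hs (mem_adjRoots.1 ha).2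

theorem sum_adjRoots_sub (hL : IsNiemeier B L) {s : V} (hs : s ∈ R) (ψ : V → ℚ) :
    ∑ a ∈ N s, ψ (s - a) = ∑ a ∈ N s, ψ a :=
  Finset.sum_nbij' (fun a => s - a) (fun a => s - a) (fun _ => hL.sub_mem_adjRoots hs)
    (fun _ => hL.sub_mem_adjRoots hs) (by simp) (by simp) (by simp)

theorem even_card_adjRoots (hL : IsNiemeier B L) {s : V} (hs : s ∈ R) (p : V → Prop)
    [DecidablePred p] (hp : ∀ a ∈ N s, p a → p (s - a)) : Even (Finset.card {a ∈ N s | p a}) := by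
  rw [← ZMod.natCast_eq_zero_iff_even]
  have : ∑ a ∈ N s with p a, (1 : ZMod 2) = 0 := by
    refine Finset.sum_involution (fun a _ => s - a) ?_ ?_ ?_ ?_
    · intro a _; decide
    · intro a ha _ h
      have h1 : s = a + a := by rw [← sub_eq_iff_eq_add]; exact h
      have h2 := hL.root_self hs
      rw [h1, hL.self_add, hL.root_self (mem_adjRoots.1 (Finset.mem_filter.1 ha).1).1] at h2
      norm_num at h2
    · intro a ha
      rw [Finset.mem_filter] at ha ⊢
      exact ⟨hL.sub_mem_adjRoots hs ha.1, hp a ha.1 ha.2⟩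
    · intro a _; simp
  simpa using this

theorem sum_mul_pair (hL : IsNiemeier B L) {s : V} (hs : s ∈ R) (ψ : V → ℚ) :
    ∑ r ∈ R, ψ r * B r s = 2 * ψ s - 2 * ψ (-s) + ∑ a ∈ N s, (ψ a - ψ (a - s)) := by
  classical
  have h1 : ∀ r ∈ R, ψ r * B r s = (if r = s then 2 * ψ s else 0) - (if r = -s then 2 * ψ (-s) else 0)
      + ((if B r s = 1 then ψ r else 0) - if B r s = -1 then ψ r else 0) := by
    intro r hr
    have hne : s ≠ -s := fun h => by
      have := hL.root_self hs
      nth_rw 1 [h] at this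
      rw [map_neg, LinearMap.neg_apply, hL.root_self hs] at this
      norm_num at this
    have hrs : r = s → B r s = 2 := fun h => h ▸ hL.root_self (h ▸ hs)
    have hrs' : r = -s → B r s = -2 := fun h => by rw [h]; simp [hL.root_self hs]
    rcases hL.root_pair hr hs with h | h | h | h | h
    · have h2 : r ≠ s := fun h' => by rw [hrs h'] at h; norm_num at h
      have h3 : r ≠ -s := fun h' => by rw [hrs' h'] at h; norm_num at h
      simp [h, h2, h3]
    · have h2 : r ≠ s := fun h' => by rw [hrs h'] at h; norm_num at h
      have h3 : r ≠ -s := fun h' => by rw [hrs' h'] at h; norm_num at h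
      simp only [h, h2, h3, if_true, if_false]; norm_num
    · have h2 : r ≠ s := fun h' => by rw [hrs h'] at h; norm_num at h
      have h3 : r ≠ -s := fun h' => by rw [hrs' h'] at h; norm_num at h
      simp only [h, h2, h3, if_true, if_false]; norm_num
    · subst h
      rw [hrs rfl]; simp only [if_true, if_neg hne]; norm_num; ring
    · subst h
      rw [hrs' rfl]; simp only [if_true, if_neg hne.symm]; norm_num; ring
  rw [Finset.sum_congr rfl h1]
  simp only [Finset.sum_add_distrib, Finset.sum_sub_distrib, Finset.sum_ite_eq', if_pos hs,
    if_pos (hL.neg_root hs)]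
  rw [← Finset.sum_filter, ← Finset.sum_filter]
  congr 2
  · refine Finset.sum_nbij' (fun r => r + s) (fun a => a - s) ?_ ?_ (by simp) (by simp) (by simp)
    · intro r hr
      rw [Finset.mem_filter] at hr
      exact mem_adjRoots.2 ⟨hL.add_root hr.1 hs hr.2, by
        rw [map_add, LinearMap.add_apply, hr.2, hL.root_self hs]; norm_num⟩
    · intro a ha
      rw [Finset.mem_filter]
      refine ⟨hL.sub_mem_of_adjRoots hs ha, ?_⟩
      rw [map_sub, LinearMap.sub_apply, (mem_adjRoots.1 ha).2, hL.root_self hs]; norm_num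

theorem exists_coxeter (hL : IsNiemeier B L) (hne : (R).Nonempty) :
    ∃ h : ℕ, (R).card = 24 * h ∧ 2 ≤ h ∧ ∀ s ∈ R, (N s).card = 2 * h - 4 := by
  have hc : ∀ s ∈ R, ((R).card : ℚ) = 48 + 12 * (N s).card := by
    intro s hs
    have h1 := hL.sum_mul_pair hs fun r => B r s
    have h2 := hL.sum_roots_sq s
    have h3 : ∑ a ∈ N s, (B a s - B (a - s) s) = 2 * (N s).card := by
      rw [Finset.sum_congr rfl (g := fun _ => (2 : ℚ))]
      · simp [mul_comm]
      · intro a ha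
        rw [map_sub, LinearMap.sub_apply, (mem_adjRoots.1 ha).2, hL.root_self hs]; norm_num
    rw [h3] at h1
    simp only [hL.root_self hs, map_neg, LinearMap.neg_apply] at h1 h2
    have h4 : ∑ r ∈ R, B s r ^ 2 = ∑ r ∈ R, B r s * B r s :=
      Finset.sum_congr rfl fun r _ => by rw [hL.symm s r, sq]
    rw [h4, h1] at h2
    linarith
  obtain ⟨s, hs⟩ := hne
  obtain ⟨k, hk⟩ := hL.even_card_adjRoots hs (fun _ => True) (fun _ _ _ => trivial)
  rw [Finset.filter_true] at hk
  have h0 : (R).card = 48 + 12 * (N s).card := by exact_mod_cast hc s hs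
  refine ⟨k + 2, by omega, by omega, fun s' hs' => ?_⟩
  have h0' : (R).card = 48 + 12 * (N s').card := by exact_mod_cast hc s' hs'
  omega

end IsNiemeier

end

section

variable {V : Type*} [AddCommGroup V] [Module ℚ V]

namespace IsNiemeier

variable {B : V →ₗ[ℚ] V →ₗ[ℚ] ℚ} {L : Submodule ℤ V}

local notation "R" => rootFinset B L

local notation "N" => adjRoots B L

theorem ext_pair (hL : IsNiemeier B L) {x y : V} (h : ∀ z, B x z = B y z) : x = y := by
  rw [← sub_eq_zero]
  refine hL.eq_zero_of_self ?_
  rw [map_sub B, LinearMap.sub_apply, h, sub_self]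

variable {h : ℕ}

theorem card_adjRoots (hL : IsNiemeier B L) (hc : (R).card = 24 * h) {s : V} (hs : s ∈ R) :
    ((N s).card : ℚ) = 2 * h - 4 := by
  obtain ⟨h', h1, h2, h3⟩ := hL.exists_coxeter ⟨s, hs⟩
  obtain rfl : h' = h := by omega
  rw [h3 s hs, Nat.cast_sub (by omega)]
  push_cast
  ring

theorem sum_roots_sq' (hL : IsNiemeier B L) (hc : (R).card = 24 * h) (x : V) :
    ∑ r ∈ R, B x r ^ 2 = 2 * h * B x x := by
  rw [hL.sum_roots_sq, hc]
  push_cast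
  ring

theorem sum_roots_mul (hL : IsNiemeier B L) (hc : (R).card = 24 * h) (x y : V) :
    ∑ r ∈ R, B x r * B y r = 2 * h * B x y := by
  have h1 := hL.sum_roots_sq' hc (x + y)
  have h2 := hL.sum_roots_sq' hc x
  have h3 := hL.sum_roots_sq' hc y
  rw [hL.self_add] at h1
  have h4 : ∑ r ∈ R, B (x + y) r ^ 2 =
      ∑ r ∈ R, B x r ^ 2 + 2 * ∑ r ∈ R, B x r * B y r + ∑ r ∈ R, B y r ^ 2 := by
    rw [Finset.mul_sum, ← Finset.sum_add_distrib, ← Finset.sum_add_distrib]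
    refine Finset.sum_congr rfl fun r _ => ?_
    rw [map_add, LinearMap.add_apply]
    ring
  linarith

theorem sum_roots_smul (hL : IsNiemeier B L) (hc : (R).card = 24 * h) (x : V) :
    ∑ r ∈ R, B x r • r = (2 * h : ℚ) • x := by
  refine hL.ext_pair fun z => ?_
  simp only [map_sum, LinearMap.sum_apply, map_smul, LinearMap.smul_apply, smul_eq_mul]
  rw [← hL.sum_roots_mul hc]
  exact Finset.sum_congr rfl fun r _ => by rw [hL.symm r z]

theorem eq_zero_of_forall_roots (hL : IsNiemeier B L) (hc : (R).card = 24 * h) (hh : h ≠ 0) {x : V}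
    (hx : ∀ r ∈ R, B x r = 0) : x = 0 := by
  have h1 := hL.sum_roots_sq' hc x
  rw [Finset.sum_eq_zero fun r hr => by rw [hx r hr]; norm_num] at h1
  refine hL.eq_zero_of_self ?_
  have : (h : ℚ) ≠ 0 := by exact_mod_cast hh
  simpa [this] using h1.symm

/-- A choice of positive roots, closed under addition. -/
structure _root_.IsPositiveSystem (B : V →ₗ[ℚ] V →ₗ[ℚ] ℚ) (L : Submodule ℤ V) (P : Finset V) :
    Prop where
  subset : P ⊆ rootFinset B L
  neg_iff : ∀ r ∈ rootFinset B L, -r ∈ P ↔ r ∉ P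
  add_mem : ∀ r ∈ P, ∀ s ∈ P, r + s ∈ rootFinset B L → r + s ∈ P

/-- Half the sum of the positive roots. -/
def _root_.weylVector (P : Finset V) : V := (2⁻¹ : ℚ) • ∑ r ∈ P, r

variable {P : Finset V}

theorem sum_roots_eq (hL : IsNiemeier B L) (hP : IsPositiveSystem B L P) {M : Type*}
    [AddCommMonoid M] (F : V → M) : ∑ r ∈ R, F r = ∑ r ∈ P, (F r + F (-r)) := by
  classical
  rw [Finset.sum_add_distrib, ← Finset.sum_filter_add_sum_filter_not R (· ∈ P)]
  congr 1
  · exact Finset.sum_congr (by ext; simpa using fun h => hP.subset h) fun _ _ => rfl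
  · refine Finset.sum_nbij' (fun r => -r) (fun r => -r) ?_ ?_ (by simp) (by simp) (by simp)
    · intro r hr
      rw [Finset.mem_filter] at hr
      exact (hP.neg_iff r hr.1).2 hr.2
    · intro r hr
      rw [Finset.mem_filter]
      refine ⟨hL.neg_root (hP.subset hr), fun h1 => ?_⟩
      exact (hP.neg_iff r (hP.subset hr)).1 h1 hr

theorem card_positive (hL : IsNiemeier B L) (hP : IsPositiveSystem B L P)
    (hc : (R).card = 24 * h) : P.card = 12 * h := by
  have := hL.sum_roots_eq hP fun _ => 1
  simp only [Finset.sum_const, smul_eq_mul] at this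
  omega

theorem pair_weylVector (x : V) : 2 * B x (weylVector P) = ∑ r ∈ P, B x r := by
  simp [weylVector]

open Classical in
theorem weylVector_pair_root (hL : IsNiemeier B L) (hP : IsPositiveSystem B L P) {s : V}
    (hs : s ∈ P) : 2 * B s (weylVector P) =
      2 + (Finset.card {a ∈ N s | a ∈ P ∧ s - a ∈ P} : ℚ) := by
  have hsR := hP.subset hs
  have h1 := hL.sum_mul_pair hsR fun r => if r ∈ P then 1 else 0
  have h2 : -s ∉ P := fun h => (hP.neg_iff s hsR).1 h hs
  simp only [ite_mul, one_mul, zero_mul, if_pos hs, if_neg h2] at h1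
  rw [← Finset.sum_filter, Finset.filter_mem_eq_inter, Finset.inter_eq_right.2 hP.subset] at h1
  rw [pair_weylVector, Finset.sum_congr rfl fun r _ => hL.symm s r, h1, Finset.card_filter]
  push_cast
  rw [mul_one, mul_zero, sub_zero]
  congr 1
  refine Finset.sum_congr rfl fun a ha => ?_
  have h3 := hP.neg_iff _ (hL.sub_mem_of_adjRoots hsR ha)
  rw [neg_sub] at h3
  by_cases h4 : a ∈ P
  · by_cases h5 : a - s ∈ P <;> simp [h4, h5, h3]
  · have h5 : a - s ∉ P := fun h5 => h4 (by
      have := hP.add_mem _ h5 _ hs (by simpa using (mem_adjRoots.1 ha).1)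
      simpa using this)
    simp [h4, h5]

theorem one_le_weylVector_pair (hL : IsNiemeier B L) (hP : IsPositiveSystem B L P) {s : V}
    (hs : s ∈ P) : 1 ≤ B s (weylVector P) := by
  classical
  have := hL.weylVector_pair_root hP hs
  have h2 : (0 : ℚ) ≤ (Finset.card {a ∈ N s | a ∈ P ∧ s - a ∈ P} : ℚ) := Nat.cast_nonneg _
  linarith

theorem weylVector_pair_le (hL : IsNiemeier B L) (hP : IsPositiveSystem B L P)
    (hc : (R).card = 24 * h) {s : V} (hs : s ∈ P) : B s (weylVector P) ≤ h - 1 := by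
  classical
  have h1 := hL.weylVector_pair_root hP hs
  have h2 := hL.card_adjRoots hc (hP.subset hs)
  have h3 : (Finset.card {a ∈ N s | a ∈ P ∧ s - a ∈ P} : ℚ) ≤ (N s).card := by
    exact_mod_cast Finset.card_filter_le _ _
  linarith

theorem exists_add_of_weylVector_pair (hL : IsNiemeier B L) (hP : IsPositiveSystem B L P) {s : V}
    (hs : s ∈ P) (h : B s (weylVector P) ≠ 1) : ∃ a ∈ P, ∃ b ∈ P, s = a + b := by
  classical
  have h1 := hL.weylVector_pair_root hP hs
  have h2 : Finset.card {a ∈ N s | a ∈ P ∧ s - a ∈ P} ≠ 0 := fun h2 => h (by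
    rw [h2] at h1
    push_cast at h1
    linarith)
  obtain ⟨a, ha⟩ := Finset.card_pos.1 (Nat.pos_of_ne_zero h2)
  have := (Finset.mem_filter.1 ha).2
  exact ⟨a, this.1, s - a, this.2, by simp⟩

theorem sum_positive_sq (hL : IsNiemeier B L) (hP : IsPositiveSystem B L P)
    (hc : (R).card = 24 * h) (x : V) : ∑ r ∈ P, B x r ^ 2 = h * B x x := by
  have h1 := hL.sum_roots_sq' hc x
  rw [hL.sum_roots_eq hP] at h1
  have h2 : ∀ r, B x r ^ 2 + B x (-r) ^ 2 = 2 * B x r ^ 2 := fun r => by rw [map_neg]; ring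
  simp only [h2, ← Finset.mul_sum] at h1
  linarith

theorem weylVector_mem (hL : IsNiemeier B L) (hP : IsPositiveSystem B L P)
    (hc : (R).card = 24 * h) : weylVector P ∈ L := by
  refine hL.unimodular _ fun y hy => ?_
  have h1 : ∀ r ∈ P, ∃ n : ℤ, B y r * (B y r - 1) = 2 * n := by
    intro r hr
    obtain ⟨n, hn⟩ := hL.int y hy r (hL.root_mem (hP.subset hr))
    obtain ⟨k, hk⟩ := Int.even_mul_pred_self n
    refine ⟨k, ?_⟩
    rw [hn]
    have : ((n * (n - 1) : ℤ) : ℚ) = ((k + k : ℤ) : ℚ) := by rw [hk]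
    push_cast at this
    linarith
  obtain ⟨m, hm⟩ : ∃ m : ℤ, ∑ r ∈ P, B y r * (B y r - 1) = 2 * m := by
    choose! n hn using h1
    refine ⟨∑ r ∈ P, n r, ?_⟩
    rw [Finset.sum_congr rfl hn, ← Finset.mul_sum]
    push_cast
    rfl
  obtain ⟨k, hk⟩ := hL.even y hy
  have h2 := hL.sum_positive_sq hP hc y
  have h3 := pair_weylVector (B := B) (P := P) y
  have h4 : ∑ r ∈ P, B y r * (B y r - 1) = ∑ r ∈ P, B y r ^ 2 - ∑ r ∈ P, B y r := by
    rw [← Finset.sum_sub_distrib]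
    exact Finset.sum_congr rfl fun _ _ => by ring
  refine ⟨h * k - m, ?_⟩
  rw [hL.symm]
  push_cast
  rw [hk] at h2
  linarith

theorem weylVector_pair_le_self (hL : IsNiemeier B L) (hP : IsPositiveSystem B L P)
    (hc : (R).card = 24 * h) {y : V} (hy : y ∈ L) : 2 * B y (weylVector P) ≤ h * B y y := by
  have h2 := hL.sum_positive_sq hP hc y
  rw [pair_weylVector, ← h2]
  refine Finset.sum_le_sum fun r hr => ?_
  obtain ⟨n, hn⟩ := hL.int y hy r (hL.root_mem (hP.subset hr))
  rw [hn]
  exact_mod_cast Int.le_self_sq n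

theorem weylVector_self (hL : IsNiemeier B L) (hP : IsPositiveSystem B L P)
    (hc : (R).card = 24 * h) : B (weylVector P) (weylVector P) = 2 * h * (h + 1) := by
  classical
  let X (p : V → V → Prop) [∀ r, DecidablePred (p r)] : Finset (Σ _ : V, V) := P.sigma fun r => {a ∈ N r | p r a}
  have hX : ∀ (p : V → V → Prop) [∀ r, DecidablePred (p r)] (r a), (⟨r, a⟩ : Σ _ : V, V) ∈ X p ↔ r ∈ P ∧ (a ∈ R ∧ B a r = 1) ∧ p r a := by
    intro p _ r a
    simp [X, mem_adjRoots]
  have hcard : ∀ (p : V → V → Prop) [∀ r, DecidablePred (p r)], (X p).card = ∑ r ∈ P, Finset.card {a ∈ N r | p r a} := fun p _ =>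
    Finset.card_sigma _ _
  have h1 : (4 : ℚ) * B (weylVector P) (weylVector P) =
      24 * h + (X fun r a => a ∈ P ∧ r - a ∈ P).card := by
    have h2 : 4 * B (weylVector P) (weylVector P) = ∑ r ∈ P, 2 * B r (weylVector P) := by
      have := pair_weylVector (B := B) (P := P) (weylVector P)
      rw [← Finset.mul_sum, Finset.sum_congr rfl fun r _ => hL.symm r _]
      linarith
    have h3 : ∀ r ∈ P, 2 * B r (weylVector P) =
        2 + (Finset.card {a ∈ N r | a ∈ P ∧ r - a ∈ P} : ℚ) := fun r hr => by
      convert hL.weylVector_pair_root hP hr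
    rw [h2, Finset.sum_congr rfl h3, hcard,
      Finset.sum_add_distrib, Finset.sum_const, hL.card_positive hP hc]
    push_cast
    simp only [nsmul_eq_mul]
    push_cast
    ring
  have h2 : (X fun r a => a ∈ P ∧ a - r ∈ P).card = (X fun r a => a ∈ P ∧ r - a ∈ P).card := by
    refine Finset.card_nbij' (fun x => ⟨x.2, x.1⟩) (fun x => ⟨x.2, x.1⟩) ?_ ?_
      (fun _ _ => rfl) (fun _ _ => rfl)
    all_goals
      rintro ⟨r, a⟩ hx
      simp only [Finset.mem_coe, hX] at hx ⊢
      exact ⟨hx.2.2.1, ⟨hP.subset hx.1, by rw [hL.symm]; exact hx.2.1.2⟩, hx.1, hx.2.2.2⟩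
  have h3 : (X fun r a => a ∉ P).card = (X fun r a => a ∈ P ∧ r - a ∈ P).card := by
    refine Finset.card_nbij' (fun x => ⟨x.1 - x.2, x.1⟩) (fun x => ⟨x.2, x.2 - x.1⟩) ?_ ?_ ?_ ?_
    · rintro ⟨r, a⟩ hx
      simp only [Finset.mem_coe, hX] at hx ⊢
      obtain ⟨h3, ⟨h4, h5⟩, h6⟩ := hx
      have h7 := (hP.neg_iff a h4).2 h6
      have h8 : r - a ∈ R := hL.sub_root (hP.subset h3) h4 (by rw [hL.symm]; exact h5)
      refine ⟨?_, ⟨hP.subset h3, ?_⟩, h3, by simpa using h7⟩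
      · have := hP.add_mem r h3 _ h7 (by simpa [sub_eq_add_neg] using h8)
        simpa [sub_eq_add_neg] using this
      · rw [map_sub, hL.root_self (hP.subset h3), hL.symm, h5]; norm_num
    · rintro ⟨r, a⟩ hx
      simp only [Finset.mem_coe, hX] at hx ⊢
      obtain ⟨h3, ⟨h4, h5⟩, h6, h7⟩ := hx
      refine ⟨h6, ⟨hL.sub_root h4 (hP.subset h3) h5, ?_⟩, fun h8 => ?_⟩
      · rw [map_sub, LinearMap.sub_apply, hL.root_self h4, hL.symm, h5]; norm_num
      · exact (hP.neg_iff _ (hP.subset h8)).1 (by simpa using h7) h8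
    · rintro ⟨r, a⟩ _; simp
    · rintro ⟨r, a⟩ _; simp
  have h4 : ∑ r ∈ P, (N r).card = (X fun r a => a ∈ P ∧ r - a ∈ P).card +
      (X fun r a => a ∈ P ∧ a - r ∈ P).card + (X fun r a => a ∉ P).card := by
    simp only [hcard, ← Finset.sum_add_distrib]
    refine Finset.sum_congr rfl fun r hr => ?_
    rw [← Finset.card_filter_add_card_filter_not (s := N r) (· ∈ P)]
    congr 1
    rw [← Finset.card_filter_add_card_filter_not (s := {a ∈ N r | a ∈ P}) (fun a => r - a ∈ P),
      Finset.filter_filter, Finset.filter_filter]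
    congr 2
    refine Finset.filter_congr fun a ha => ?_
    have := hP.neg_iff _ (hL.sub_mem_of_adjRoots (hP.subset hr) ha)
    rw [neg_sub] at this
    simp only [this, not_not]
  have h5 : ∑ r ∈ P, ((N r).card : ℚ) = 12 * h * (2 * h - 4) := by
    rw [Finset.sum_congr rfl fun r hr => hL.card_adjRoots hc (hP.subset hr), Finset.sum_const,
      hL.card_positive hP hc]
    simp
  have h6 : ∑ r ∈ P, ((N r).card : ℚ) = 3 * (X fun r a => a ∈ P ∧ r - a ∈ P).card := by
    rw [h2, h3] at h4
    rw [← Nat.cast_sum, h4]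
    push_cast
    ring
  nlinarith

end IsNiemeier

end

section

variable {V : Type*} [AddCommGroup V] [Module ℚ V]

/-- The lattice `w⊥ / w` for the norm `0` vector `w = ρ + h e + (h + 1) f` of `L ⊕ U`, identified
with a subgroup of `L ⊗ ℚ`. -/
def holyLattice (B : V →ₗ[ℚ] V →ₗ[ℚ] ℚ) (L : Submodule ℤ V) (ρ : V) (h : ℕ) : Submodule ℤ V where
  carrier := {x | (∃ t : ℤ, B x ρ = t) ∧ x - (B x ρ / h) • ρ ∈ L}
  zero_mem' := ⟨⟨0, by simp⟩, by simp⟩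
  add_mem' := by
    rintro x y ⟨⟨t, ht⟩, hx⟩ ⟨⟨u, hu⟩, hy⟩
    refine ⟨⟨t + u, by simp [ht, hu]⟩, ?_⟩
    convert L.add_mem hx hy using 1
    rw [map_add, LinearMap.add_apply]
    module
  smul_mem' := by
    rintro n x ⟨⟨t, ht⟩, hx⟩
    refine ⟨⟨n * t, by simp [ht]⟩, ?_⟩
    convert L.smul_mem n hx using 1
    rw [map_zsmul, LinearMap.smul_apply, zsmul_eq_mul, ← Int.cast_smul_eq_zsmul ℚ,
      ← Int.cast_smul_eq_zsmul ℚ]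
    module

namespace IsNiemeier

variable {B : V →ₗ[ℚ] V →ₗ[ℚ] ℚ} {L : Submodule ℤ V}

variable {h : ℕ}

theorem mem_holyLattice {ρ x : V} :
    x ∈ holyLattice B L ρ h ↔ (∃ t : ℤ, B x ρ = t) ∧ x - (B x ρ / h) • ρ ∈ L := Iff.rfl

theorem pair_sub_holyLattice (hL : IsNiemeier B L) {ρ : V} (hρ : B ρ ρ = 2 * h * (h + 1))
    (hh : h ≠ 0) (x y : V) : B (x - (B x ρ / h) • ρ) (y - (B y ρ / h) • ρ) =
    B x y + 2 * (B x ρ * B y ρ) := by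
  have : (h : ℚ) ≠ 0 := by exact_mod_cast hh
  simp only [map_sub, LinearMap.sub_apply, map_smul, LinearMap.smul_apply, smul_eq_mul, hρ,
    hL.symm ρ y]
  field_simp
  ring

theorem isNiemeier_holyLattice (hL : IsNiemeier B L) {ρ : V} (hρL : ρ ∈ L)
    (hρ : B ρ ρ = 2 * h * (h + 1)) (hh : h ≠ 0) : IsNiemeier B (holyLattice B L ρ h) where
  fg := by
    have := isTorsionFree_int_of_rat V
    have : Module.Finite ℤ L := Module.Finite.iff_fg.2 hL.fg
    have hmem : ∀ x ∈ holyLattice B L ρ h, h • x ∈ L := by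
      rintro x ⟨⟨t, ht⟩, hx⟩
      have h1 := L.add_mem (L.smul_mem (h : ℤ) hx) (L.smul_mem t hρL)
      convert h1 using 1
      have : (h : ℚ) ≠ 0 := by exact_mod_cast hh
      rw [ht, ← Int.cast_smul_eq_zsmul ℚ, ← Int.cast_smul_eq_zsmul ℚ, ← Nat.cast_smul_eq_nsmul ℚ,
        smul_sub, smul_smul]
      push_cast
      rw [mul_div_cancel₀ _ this, sub_add_cancel]
    let g : holyLattice B L ρ h →ₗ[ℤ] L :=
      LinearMap.codRestrict L ((h : ℤ) • (holyLattice B L ρ h).subtype)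
        fun x => by simpa using hmem x x.2
    have hg : Function.Injective g := by
      intro x y hxy
      have h1 : (h : ℤ) • (x : V) = (h : ℤ) • (y : V) := congrArg Subtype.val hxy
      exact Subtype.ext (smul_right_injective V (by exact_mod_cast hh) h1)
    exact Module.Finite.iff_fg.1 (Module.Finite.of_injective g hg)
  span_eq := by
    rw [eq_top_iff, ← hL.span_eq, Submodule.span_le]
    intro l hl
    have hn : (h : ℚ) ≠ 0 := by exact_mod_cast hh
    obtain ⟨n, hn'⟩ := hL.int l hl ρ hρL
    have h1 : (h : ℚ) • l ∈ holyLattice B L ρ h := by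
      refine ⟨⟨h * n, by simp [hn']⟩, ?_⟩
      rw [map_smul, LinearMap.smul_apply, hn', smul_eq_mul, mul_div_cancel_left₀ _ hn,
        Nat.cast_smul_eq_nsmul, Int.cast_smul_eq_zsmul]
      exact L.sub_mem (L.nsmul_mem hl _) (L.smul_mem _ hρL)
    have h2 := Submodule.smul_mem (Submodule.span ℚ (holyLattice B L ρ h : Set V)) (h : ℚ)⁻¹
      (Submodule.subset_span h1)
    rwa [smul_smul, inv_mul_cancel₀ hn, one_smul] at h2
  finrank_eq := hL.finrank_eq
  symm := hL.symm
  int := by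
    rintro x ⟨⟨t, ht⟩, hx⟩ y ⟨⟨u, hu⟩, hy⟩
    obtain ⟨n, hn⟩ := hL.int _ hx _ hy
    rw [hL.pair_sub_holyLattice hρ hh, ht, hu] at hn
    exact ⟨n - 2 * (t * u), by push_cast; linarith⟩
  pos := fun x _ hx => hL.pos_of_ne_zero hx
  even := by
    rintro x ⟨⟨t, ht⟩, hx⟩
    obtain ⟨n, hn⟩ := hL.even _ hx
    rw [hL.pair_sub_holyLattice hρ hh, ht] at hn
    exact ⟨n - t * t, by push_cast; linarith⟩
  unimodular := by
    have hn : (h : ℚ) ≠ 0 := by exact_mod_cast hh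
    intro v hv
    refine ⟨hv ρ ⟨⟨2 * h * (h + 1), by rw [hρ]; push_cast; ring⟩, ?_⟩, ?_⟩
    · have : B ρ ρ / h = ((2 * (h + 1) : ℤ) : ℚ) := by rw [hρ]; push_cast; field_simp
      rw [this, Int.cast_smul_eq_zsmul]
      exact L.sub_mem hρL (L.smul_mem _ hρL)
    · refine hL.unimodular _ fun y hy => ?_
      obtain ⟨c, hc⟩ := hL.int y hy ρ hρL
      have h1 : y - (c / h : ℚ) • ρ ∈ holyLattice B L ρ h := by
        have h2 : B (y - (c / h : ℚ) • ρ) ρ = ((-c * (2 * h + 1) : ℤ) : ℚ) := by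
          rw [map_sub, LinearMap.sub_apply, map_smul, LinearMap.smul_apply, hρ, hc, smul_eq_mul]
          push_cast
          field_simp
          ring
        refine ⟨⟨_, h2⟩, ?_⟩
        have h3 : y - (c / h : ℚ) • ρ - (B (y - (c / h : ℚ) • ρ) ρ / h) • ρ = y + (2 * c) • ρ := by
          rw [h2, sub_sub, ← add_smul, ← Int.cast_smul_eq_zsmul ℚ, sub_eq_add_neg, ← neg_smul]
          congr 2
          push_cast
          field_simp
          ring
        rw [h3]
        exact L.add_mem hy (L.smul_mem _ hρL)
      obtain ⟨n, h2⟩ := hv _ h1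
      refine ⟨n, ?_⟩
      rw [← h2]
      simp only [map_sub, LinearMap.sub_apply, map_smul, LinearMap.smul_apply, smul_eq_mul]
      rw [hL.symm ρ y, hc]
      ring

end IsNiemeier

end

section

variable {V : Type*} [AddCommGroup V] [Module ℚ V]

/-- The roots on which `f` is positive. -/
noncomputable def positiveRoots (B : V →ₗ[ℚ] V →ₗ[ℚ] ℚ) (L : Submodule ℤ V) (f : V →ₗ[ℚ] ℚ) :
    Finset V := {r ∈ rootFinset B L | 0 < f r}

namespace IsNiemeier

variable {B : V →ₗ[ℚ] V →ₗ[ℚ] ℚ} {L : Submodule ℤ V}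

local notation "R" => rootFinset B L

local notation "N" => adjRoots B L

variable {h : ℕ} {P : Finset V}

theorem isPositiveSystem_positiveRoots (hL : IsNiemeier B L) (f : V →ₗ[ℚ] ℚ)
    (hf : ∀ r ∈ R, f r ≠ 0) : IsPositiveSystem B L (positiveRoots B L f) where
  subset := Finset.filter_subset _ _
  neg_iff := by
    intro r hr
    simp only [positiveRoots, Finset.mem_filter, hL.neg_root hr, hr, true_and, map_neg, not_lt]
    exact ⟨fun h => by linarith, fun h => by have := lt_of_le_of_ne h (hf r hr); linarith⟩
  add_mem := by
    intro r hr s hs hrs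
    simp only [positiveRoots, Finset.mem_filter, map_add] at hr hs ⊢
    exact ⟨hrs, by linarith [hr.2, hs.2]⟩

theorem mem_positiveRoots {f : V →ₗ[ℚ] ℚ} {r : V} : r ∈ positiveRoots B L f ↔ r ∈ R ∧ 0 < f r := by
  simp [positiveRoots]

theorem abs_pair_weylVector_le (hL : IsNiemeier B L) (hP : IsPositiveSystem B L P)
    (hc : (R).card = 24 * h) {s : V} (hs : s ∈ R) : |B s (weylVector P)| ≤ h - 1 := by
  by_cases h1 : s ∈ P
  · have h2 := hL.one_le_weylVector_pair hP h1
    have h3 := hL.weylVector_pair_le hP hc h1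
    rw [abs_of_nonneg (by linarith)]
    exact h3
  · have h1 := (hP.neg_iff s hs).2 h1
    have h2 := hL.one_le_weylVector_pair hP h1
    have h3 := hL.weylVector_pair_le hP hc h1
    rw [map_neg, LinearMap.neg_apply] at h2 h3
    rw [abs_of_nonpos (by linarith)]
    exact h3

theorem exists_add_mem_of_weylVector_pair (hL : IsNiemeier B L) (hP : IsPositiveSystem B L P)
    (hc : (R).card = 24 * h) {s : V} (hs : s ∈ P) (hs' : B s (weylVector P) ≠ h - 1) :
    ∃ b ∈ P, s + b ∈ P := by
  classical
  by_contra! hcon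
  refine hs' ?_
  have h1 := hL.weylVector_pair_root hP hs
  have hsR := hP.subset hs
  rw [Finset.filter_true_of_mem] at h1
  · rw [hL.card_adjRoots hc hsR] at h1
    linarith
  · have key : ∀ a ∈ N s, a ∈ P := by
      intro a ha
      by_contra h2
      have h3 := hL.sub_mem_adjRoots hsR ha
      have h4 := (hP.neg_iff a (mem_adjRoots.1 ha).1).2 h2
      refine hcon _ h4 (hP.add_mem _ hs _ h4 ?_)
      rw [← sub_eq_add_neg]
      exact (mem_adjRoots.1 h3).1
    exact fun a ha => ⟨key a ha, key _ (hL.sub_mem_adjRoots hsR ha)⟩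

theorem positive_induction (hL : IsNiemeier B L) (hP : IsPositiveSystem B L P) {p : V → Prop}
    (simple : ∀ r ∈ P, B r (weylVector P) = 1 → p r)
    (add_of_mem : ∀ a ∈ P, ∀ b ∈ P, a + b ∈ P → p a → p b → p (a + b)) : ∀ r ∈ P, p r := by
  have key : ∀ n : ℕ, ∀ r ∈ P, B r (weylVector P) ≤ n → p r := by
    intro n
    induction n with
    | zero =>
      intro r hr hn
      have := hL.one_le_weylVector_pair hP hr
      push_cast at hn
      linarith
    | succ n ih =>
      intro r hr hn
      by_cases h1 : B r (weylVector P) = 1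
      · exact simple r hr h1
      · obtain ⟨a, ha, b, hb, rfl⟩ := hL.exists_add_of_weylVector_pair hP hr h1
        rw [map_add, LinearMap.add_apply] at hn
        have h2 := hL.one_le_weylVector_pair hP ha
        have h3 := hL.one_le_weylVector_pair hP hb
        push_cast at hn
        exact add_of_mem a ha b hb hr (ih a ha (by linarith)) (ih b hb (by linarith))
  intro r hr
  obtain ⟨n, hn⟩ := exists_nat_ge (B r (weylVector P))
  exact key n r hr hn

theorem positive_induction_down (hL : IsNiemeier B L) (hP : IsPositiveSystem B L P)
    (hc : (R).card = 24 * h) {p : V → Prop}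
    (highest : ∀ r ∈ P, B r (weylVector P) = h - 1 → p r)
    (of_add : ∀ a ∈ P, ∀ b ∈ P, a + b ∈ P → p (a + b) → p a) : ∀ r ∈ P, p r := by
  have key : ∀ n : ℕ, ∀ r ∈ P, h - 1 - n ≤ B r (weylVector P) → p r := by
    intro n
    induction n with
    | zero =>
      intro r hr hn
      push_cast at hn
      exact highest r hr (le_antisymm (hL.weylVector_pair_le hP hc hr) (by linarith))
    | succ n ih =>
      intro r hr hn
      by_cases h1 : B r (weylVector P) = h - 1
      · exact highest r hr h1
      · obtain ⟨b, hb, hab⟩ := hL.exists_add_mem_of_weylVector_pair hP hc hr h1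
        have h3 := hL.one_le_weylVector_pair hP hb
        refine of_add r hr b hb hab (ih _ hab ?_)
        rw [map_add, LinearMap.add_apply]
        push_cast at hn
        linarith
  intro r hr
  obtain ⟨n, hn⟩ := exists_nat_ge (h - 1 - B r (weylVector P))
  exact key n r hr (by linarith)

theorem weylVector_pair_le_mul (hL : IsNiemeier B L) (hP : IsPositiveSystem B L P) {x : V} {q : ℚ}
    (hx : ∀ r ∈ P, 0 < q * B x r) (hx' : ∀ r ∈ P, ∃ n : ℤ, q * B x r = n) :
    ∀ r ∈ P, B r (weylVector P) ≤ q * B x r := by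
  refine hL.positive_induction hP ?_ ?_
  · intro r hr h1
    obtain ⟨n, hn⟩ := hx' r hr
    have h2 := hx r hr
    rw [h1, hn] at *
    have : 0 < n := by exact_mod_cast h2
    exact_mod_cast this
  · intro a _ b _ _ h1 h2
    rw [map_add, map_add, LinearMap.add_apply]
    linarith

/-- A vector of `h⁻¹ L*` off all the root hyperplanes is at least as long as `h⁻¹ ρ`. -/
theorem le_self_of_mul_pair_int (hL : IsNiemeier B L) (hc : (R).card = 24 * h) (hh : h ≠ 0) {x : V}
    (hx : ∀ r ∈ R, B x r ≠ 0) (hx' : ∀ r ∈ R, ∃ n : ℤ, h * B x r = n) :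
    2 * (h + 1) ≤ h * B x x := by
  have hP := hL.isPositiveSystem_positiveRoots (B x) hx
  set P := positiveRoots B L (B x)
  have h0 : (0 : ℚ) < h := by exact_mod_cast Nat.pos_of_ne_zero hh
  have h1 := hL.weylVector_pair_le_mul hP (x := x) (q := h)
    (fun r hr => mul_pos h0 (mem_positiveRoots.1 hr).2) fun r hr => hx' r (hP.subset hr)
  have h2 : ∑ r ∈ P, B (weylVector P) r ^ 2 ≤ ∑ r ∈ P, h ^ 2 * B x r ^ 2 := by
    refine Finset.sum_le_sum fun r hr => ?_
    have h3 := hL.one_le_weylVector_pair hP hr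
    have h4 := h1 r hr
    rw [hL.symm, ← mul_pow]
    exact pow_le_pow_left₀ (by linarith) h4 2
  rw [← Finset.mul_sum, hL.sum_positive_sq hP hc, hL.sum_positive_sq hP hc,
    hL.weylVector_self hP hc] at h2
  have h3 : (h : ℚ) ^ 2 * (2 * (h + 1)) ≤ h ^ 2 * (h * B x x) := by linarith
  exact le_of_mul_le_mul_left h3 (by positivity)

theorem exists_minimal (hL : IsNiemeier B L) {x : V} {q : ℕ} (hq : q ≠ 0) (hx : (q : ℚ) • x ∈ L) :
    ∃ z, x - z ∈ L ∧ ∀ z', x - z' ∈ L → B z z ≤ B z' z' := by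
  classical
  have h0 : (0 : ℚ) < q := by exact_mod_cast Nat.pos_of_ne_zero hq
  have key : ∀ z, x - z ∈ L → ∃ n : ℕ, (q : ℚ) ^ 2 * B z z = 2 * n := by
    intro z hz
    have h1 : (q : ℚ) • z ∈ L := by
      have := L.sub_mem hx (L.nsmul_mem hz q)
      rw [← Nat.cast_smul_eq_nsmul ℚ, smul_sub, sub_sub_cancel] at this
      exact this
    obtain ⟨n, hn⟩ := hL.even _ h1
    simp only [map_smul, LinearMap.smul_apply, smul_eq_mul] at hn
    have h2 := mul_nonneg (sq_nonneg (q : ℚ)) (hL.self_nonneg z)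
    have h3 : 0 ≤ n := by
      have : (0 : ℚ) ≤ n := by linarith
      exact_mod_cast this
    lift n to ℕ using h3
    exact ⟨n, by push_cast at hn; linarith⟩
  have hex : ∃ n : ℕ, ∃ z, x - z ∈ L ∧ (q : ℚ) ^ 2 * B z z = 2 * n := by
    obtain ⟨n, hn⟩ := key x (by simp)
    exact ⟨n, x, by simp, hn⟩
  obtain ⟨z, hz, hz'⟩ := Nat.find_spec hex
  refine ⟨z, hz, fun z' h1 => ?_⟩
  obtain ⟨n, hn⟩ := key z' h1
  have h2 : (Nat.find hex : ℚ) ≤ n := by exact_mod_cast Nat.find_min' hex ⟨z', h1, hn⟩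
  refine le_of_mul_le_mul_left (?_ : (q : ℚ) ^ 2 * _ ≤ _) (by positivity)
  linarith

theorem exists_even_nat (hL : IsNiemeier B L) {y : V} (hy : y ∈ L) : ∃ n : ℕ, B y y = 2 * n := by
  obtain ⟨n, hn⟩ := hL.even y hy
  have h1 := hL.self_nonneg y
  have h3 : 0 ≤ n := by
    have : (0 : ℚ) ≤ n := by linarith
    exact_mod_cast this
  lift n to ℕ using h3
  exact ⟨n, by exact_mod_cast hn⟩

/-- A vector `y ∈ L` with `y² ≤ 2` and `2 (y, ρ) = ± h y²` vanishes. -/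
theorem eq_zero_of_self_le_two (hL : IsNiemeier B L) (hP : IsPositiveSystem B L P)
    (hc : (R).card = 24 * h) {y : V} (hy : y ∈ L) (hy' : B y y ≤ 2)
    (h1 : |2 * B y (weylVector P)| = h * B y y) : y = 0 := by
  obtain ⟨n, hn⟩ := hL.exists_even_nat hy
  have h2 : n ≤ 1 := by
    have : (n : ℚ) ≤ 1 := by linarith
    exact_mod_cast this
  interval_cases n
  · exact hL.eq_zero_of_self (by rw [hn]; norm_num)
  · have h3 := hL.abs_pair_weylVector_le hP hc (hL.mem_rootFinset.2 ⟨hy, by rw [hn]; norm_num⟩)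
    rw [abs_mul, hn] at h1
    norm_num at h1
    linarith

theorem not_forall_pair_not_int (hL : IsNiemeier B L) (hc : (R).card = 24 * h) (hh : h ≠ 0) {x : V}
    (hx2 : B x x = 2) (hx : ((h + 1 : ℕ) : ℚ) • x ∈ L) :
    ∃ r ∈ R, ∃ n : ℤ, B x r = n := by
  by_contra! hcon
  obtain ⟨z, hz, hmin⟩ := hL.exists_minimal (by omega) hx
  have h0 : (0 : ℚ) < h := by exact_mod_cast Nat.pos_of_ne_zero hh
  have hz2 : B z z ≤ 2 := hx2 ▸ hmin x (by simp)
  have hzi : ∀ r ∈ R, ∀ n : ℤ, B z r ≠ n := by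
    intro r hr n hn
    obtain ⟨m, hm⟩ := hL.int _ hz r (hL.root_mem hr)
    rw [map_sub, LinearMap.sub_apply, hn] at hm
    exact hcon r hr (m + n) (by push_cast; linarith)
  have hz1 : ∀ r ∈ R, B z r < 1 := by
    intro r hr
    have h1 := hmin (z - r) (by
      rw [sub_sub_eq_add_sub, add_sub_right_comm]
      exact L.add_mem hz (hL.root_mem hr))
    rw [hL.self_sub, hL.root_self hr] at h1
    exact lt_of_le_of_ne (by linarith) (by simpa using hzi r hr 1)
  have hqz : ((h : ℚ) + 1) • z ∈ L := by
    have := L.sub_mem hx (L.nsmul_mem hz (h + 1))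
    rw [← Nat.cast_smul_eq_nsmul ℚ, smul_sub, sub_sub_cancel] at this
    exact_mod_cast this
  have hP := hL.isPositiveSystem_positiveRoots (B z) fun r hr => by simpa using hzi r hr 0
  set P := positiveRoots B L (B z)
  set ρ := weylVector P
  have hρL := hL.weylVector_mem hP hc
  have hρ := hL.weylVector_self hP hc
  have hq : ∀ r ∈ P, ∃ n : ℤ, (h + 1) * B z r = n := by
    intro r hr
    obtain ⟨n, hn⟩ := hL.int _ hqz r (hL.root_mem (hP.subset hr))
    exact ⟨n, by simpa using hn⟩
  have hlow := hL.weylVector_pair_le_mul hP (x := z) (q := h + 1)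
    (fun r hr => mul_pos (by linarith) (mem_positiveRoots.1 hr).2) hq
  have hhigh : ∀ r ∈ P, (h + 1) * B z r ≤ B r ρ + 1 := by
    refine hL.positive_induction_down hP hc ?_ ?_
    · intro r hr h1
      obtain ⟨n, hn⟩ := hq r hr
      have h2 := hz1 r (hP.subset hr)
      have h3 : n < h + 1 := by
        have : (n : ℚ) < h + 1 := by nlinarith
        exact_mod_cast this
      have h4 : (n : ℚ) ≤ h := by exact_mod_cast Int.lt_add_one_iff.1 h3
      rw [hn, h1]
      linarith
    · intro a _ b hb _ h1
      have := hlow b hb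
      rw [map_add, map_add, LinearMap.add_apply] at h1
      linarith
  set y := ((h : ℚ) + 1) • z - ρ with hy
  have hyL : y ∈ L := L.sub_mem hqz hρL
  have hyr : ∀ r ∈ P, B y r = (h + 1) * B z r - B r ρ := by
    intro r _
    rw [hy, map_sub, LinearMap.sub_apply, map_smul, LinearMap.smul_apply, smul_eq_mul, hL.symm ρ]
  have hsum : h * B y y = 2 * B y ρ := by
    rw [← hL.sum_positive_sq hP hc, pair_weylVector]
    refine Finset.sum_congr rfl fun r hr => ?_
    obtain ⟨n, hn⟩ := hL.int _ hyL r (hL.root_mem (hP.subset hr))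
    have h1 := hyr r hr
    have h2 := hlow r hr
    have h3 := hhigh r hr
    rw [hn] at h1 ⊢
    have h4 : 0 ≤ n := by
      have : (0 : ℚ) ≤ n := by linarith
      exact_mod_cast this
    have h5 : n ≤ 1 := by
      have : (n : ℚ) ≤ 1 := by linarith
      exact_mod_cast this
    interval_cases n <;> norm_num
  have hzz : (h + 1) * B z z = 2 * h + B y y := by
    have h1 := hL.self_add y ρ
    rw [hy, sub_add_cancel, ← hy, hρ] at h1
    simp only [map_smul, LinearMap.smul_apply, smul_eq_mul] at h1
    refine mul_left_cancel₀ (by positivity : (h : ℚ) + 1 ≠ 0) ?_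
    linarith
  have hy0 : y = 0 := hL.eq_zero_of_self_le_two hP hc hyL (by nlinarith) (by
    rw [← hsum, abs_of_nonneg (mul_nonneg h0.le (hL.self_nonneg y))])
  rw [hy0, map_zero, add_zero] at hzz
  have hzl : (h + 1) * B z (x - z) = B (x - z) ρ := by
    rw [hL.symm _ ρ, ← sub_eq_zero.1 (hy.symm.trans hy0)]
    simp
  have hll : 2 = 2 * B (x - z) ρ + (h + 1) * B (x - z) (x - z) := by
    have h1 := hL.self_add z (x - z)
    rw [add_sub_cancel, hx2] at h1
    linear_combination (h + 1) * h1 + hzz + 2 * hzl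
  have h1 := hL.weylVector_pair_le_self hP hc (L.neg_mem hz)
  simp only [map_neg, LinearMap.neg_apply, neg_neg] at h1
  obtain ⟨n, hn⟩ := hL.exists_even_nat hz
  rw [hn] at h1 hll
  have h2 : n ≤ 1 := by
    have : (n : ℚ) ≤ 1 := by linarith
    exact_mod_cast this
  interval_cases n
  · have h3 := hL.eq_zero_of_self (by rw [hn]; norm_num)
    rw [h3] at hll
    norm_num at hll
  · have h3 := hL.eq_zero_of_self_le_two hP hc hz (by rw [hn]; norm_num) (by
      have h4 : 2 * B (x - z) ρ = -(h * 2) := by push_cast at hll; linarith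
      rw [hn, h4, abs_neg, abs_of_nonneg (by positivity)]
      norm_num)
    rw [h3] at hn
    norm_num at hn

end IsNiemeier

end

section

variable {V : Type*} [AddCommGroup V] [Module ℚ V]

namespace IsNiemeier

variable {B : V →ₗ[ℚ] V →ₗ[ℚ] ℚ} {L : Submodule ℤ V}

local notation "R" => rootFinset B L

variable {h : ℕ} {P : Finset V}

theorem weylVector_pair_ne_zero (hL : IsNiemeier B L) (hP : IsPositiveSystem B L P) {s : V}
    (hs : s ∈ R) : B s (weylVector P) ≠ 0 := by
  by_cases h1 : s ∈ P
  · have h2 := hL.one_le_weylVector_pair hP h1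
    linarith
  · have h2 := hL.one_le_weylVector_pair hP ((hP.neg_iff s hs).2 h1)
    rw [map_neg, LinearMap.neg_apply] at h2
    linarith

theorem not_dvd_weylVector_pair (hL : IsNiemeier B L) (hP : IsPositiveSystem B L P)
    (hc : (R).card = 24 * h) {s : V} (hs : s ∈ R) {k q : ℤ} (hk : B s (weylVector P) = k)
    (hq : (h : ℤ) ≤ q) : ¬ q ∣ k := by
  intro hd
  have h1 := hL.abs_pair_weylVector_le hP hc hs
  have h2 := hL.weylVector_pair_ne_zero hP hs
  rw [hk] at h1 h2
  have h3 : |k| ≤ (h : ℤ) - 1 := by exact_mod_cast h1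
  exact h2 (by exact_mod_cast Int.eq_zero_of_abs_lt_dvd hd (by omega))

theorem not_isCoprime_and_not_dvd (hL : IsNiemeier B L) (hP : IsPositiveSystem B L P)
    (hc : (R).card = 24 * h) (hh : h ≠ 0) {x : V} (hx : x ∈ holyLattice B L (weylVector P) h)
    (hx2 : B x x = 2) {t : ℤ} (ht : B x (weylVector P) = t) :
    (¬ IsCoprime t h ∧ ¬ (h : ℤ) ∣ t) ∧ ¬ IsCoprime t (h + 1) ∧ ¬ (h + 1 : ℤ) ∣ t := by
  obtain ⟨-, hl⟩ := hx
  rw [ht] at hl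
  set ρ := weylVector P with hρ
  have hρL : ρ ∈ L := hL.weylVector_mem hP hc
  have hρ2 : B ρ ρ = 2 * h * (h + 1) := hL.weylVector_self hP hc
  set l := x - ((t : ℚ) / h) • ρ with hldef
  have h0 : (h : ℚ) ≠ 0 := by exact_mod_cast hh
  have h0' : (h + 1 : ℚ) ≠ 0 := by exact_mod_cast Nat.succ_ne_zero h
  have hint : ∀ r ∈ R, ∃ n k : ℤ, B l r = n ∧ B r ρ = k := by
    intro r hr
    obtain ⟨n, hn⟩ := hL.int l hl r (hL.root_mem hr)
    obtain ⟨k, hk⟩ := hL.int r (hL.root_mem hr) ρ hρL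
    exact ⟨n, k, hn, hk⟩
  have hxr : ∀ r, B x r = B l r + t / h * B r ρ := by
    intro r
    simp [hldef, hL.symm ρ r]
  set x' := l + ((t : ℚ) / (h + 1)) • ρ with hx'def
  have hx'x : x' = x - ((t : ℚ) / (h * (h + 1))) • ρ := by
    rw [hx'def, hldef, sub_add, ← sub_smul]
    congr 2
    field_simp
    ring
  have hx'2 : B x' x' = 2 := by
    rw [hx'x]
    simp only [map_sub, LinearMap.sub_apply, map_smul, LinearMap.smul_apply, smul_eq_mul, hρ2,
      hL.symm ρ x, ht, hx2]
    field_simp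
    ring
  have hzmem : ∀ u : ℤ, (u : ℚ) • ρ ∈ L := by
    intro u
    rw [Int.cast_smul_eq_zsmul]
    exact L.smul_mem _ hρL
  refine ⟨⟨fun hcop => ?_, ?_⟩, fun hcop => ?_, ?_⟩
  · have h1 := hL.le_self_of_mul_pair_int hc hh (x := x) ?_ ?_
    · rw [hx2] at h1
      linarith
    · intro r hr h2
      obtain ⟨n, k, hn, hk⟩ := hint r hr
      rw [hxr, hn, hk] at h2
      have h3 : (t : ℚ) * k = h * (-n) := by field_simp at h2; linarith
      have h4 : t * k = h * (-n) := by exact_mod_cast h3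
      exact hL.not_dvd_weylVector_pair hP hc hr hk le_rfl
        (hcop.symm.dvd_of_dvd_mul_left ⟨_, h4⟩)
    · intro r hr
      obtain ⟨n, k, hn, hk⟩ := hint r hr
      refine ⟨h * n + t * k, ?_⟩
      rw [hxr, hn, hk]
      push_cast
      field_simp
  · rintro ⟨u, rfl⟩
    have hxL : x ∈ L := by
      have := L.add_mem hl (hzmem u)
      rwa [hldef, Int.cast_mul, Int.cast_natCast, mul_div_cancel_left₀ _ h0, sub_add_cancel] at this
    exact hL.not_dvd_weylVector_pair hP hc (hL.mem_rootFinset.2 ⟨hxL, hx2⟩) ht le_rfl ⟨u, rfl⟩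
  · obtain ⟨r, hr, m, hm⟩ := hL.not_forall_pair_not_int hc hh hx'2 (by
      have : ((h + 1 : ℕ) : ℚ) • x' = ((h + 1 : ℕ) : ℚ) • l + (t : ℚ) • ρ := by
        rw [hx'def, smul_add, smul_smul]
        congr 2
        push_cast
        field_simp
      rw [this, Nat.cast_smul_eq_nsmul]
      exact L.add_mem (L.nsmul_mem hl _) (hzmem t))
    obtain ⟨n, k, hn, hk⟩ := hint r hr
    rw [hx'def, map_add, LinearMap.add_apply, map_smul, LinearMap.smul_apply, smul_eq_mul,
      hL.symm ρ r, hn, hk] at hm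
    have h3 : (t : ℚ) * k = (h + 1) * (m - n) := by field_simp at hm; linarith
    have h4 : t * k = (h + 1) * (m - n) := by exact_mod_cast h3
    exact hL.not_dvd_weylVector_pair hP hc hr hk (by omega)
      (hcop.symm.dvd_of_dvd_mul_left ⟨_, h4⟩)
  · rintro ⟨u, rfl⟩
    have hxL : x' ∈ L := by
      have : x' = l + (u : ℚ) • ρ := by
        rw [hx'def]
        push_cast
        rw [mul_div_cancel_left₀ _ h0']
      rw [this]
      exact L.add_mem hl (hzmem u)
    have h5 : B x' ρ = ((-((h + 1) * u) : ℤ) : ℚ) := by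
      rw [hx'x]
      simp only [map_sub, LinearMap.sub_apply, map_smul, LinearMap.smul_apply, smul_eq_mul, hρ2, ht]
      push_cast
      field_simp
      ring
    exact hL.not_dvd_weylVector_pair hP hc (hL.mem_rootFinset.2 ⟨hxL, hx'2⟩) h5 (q := h + 1)
      (by omega) (dvd_neg.2 ⟨u, rfl⟩)

end IsNiemeier

end

section

variable {α : Type*} [DecidableEq α]

/-- A connected graph on `X` with neighbourhoods `nb` and positive integer marks `c` such that twice
each mark is the sum of the neighbouring ones, as in a simply laced affine Dynkin diagram. -/
structure IsAffineDiagram (X : Finset α) (nb : α → Finset α) (c : α → ℕ) : Prop where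
  nb_subset : ∀ i ∈ X, nb i ⊆ X
  symm : ∀ i ∈ X, ∀ j ∈ nb i, i ∈ nb j
  irrefl : ∀ i ∈ X, i ∉ nb i
  pos : ∀ i ∈ X, 1 ≤ c i
  sum_nb : ∀ i ∈ X, ∑ j ∈ nb i, c j = 2 * c i
  connected : ∀ Y ⊆ X, Y.Nonempty → (∀ i ∈ Y, nb i ⊆ Y) → Y = X

/-- The set `T` of nodes is attached to the rest of the diagram by the single edge from `i` in `T`
to `j` outside `T`. -/
structure IsAffineDiagram.Front (X : Finset α) (nb : α → Finset α) (T : Finset α) (i j : α) :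
    Prop where
  subset : T ⊆ X
  mem : j ∈ X
  notMem : j ∉ T
  closed : ∀ t ∈ T, nb t ⊆ insert j T
  left_mem : i ∈ T
  left_mem_nb : i ∈ nb j
  eq_left : ∀ t ∈ T, t ∈ nb j → t = i

namespace IsAffineDiagram

variable {X T : Finset α} {nb : α → Finset α} {c : α → ℕ} {i j : α}

theorem nb_eq (hX : IsAffineDiagram X nb c) (hi : i ∈ X) {F : Finset α} (hF : F ⊆ nb i)
    (hs : 2 * c i ≤ ∑ k ∈ F, c k) : nb i = F := by
  refine (Finset.Subset.antisymm hF fun k hk => ?_).symm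
  by_contra hkF
  have h1 : ∑ k ∈ insert k F, c k ≤ ∑ k ∈ nb i, c k :=
    Finset.sum_le_sum_of_subset (Finset.insert_subset hk hF)
  rw [Finset.sum_insert hkF, hX.sum_nb i hi] at h1
  have := hX.pos k (hX.nb_subset i hi hk)
  omega

theorem exists_nb (hX : IsAffineDiagram X nb c) (hi : i ∈ X) {F : Finset α} (hF : F ⊆ nb i)
    (hs : ∑ k ∈ F, c k < 2 * c i) : ∃ k ∈ nb i, k ∉ F ∧ k ∈ X ∧ i ∈ nb k ∧ k ≠ i ∧ 1 ≤ c k ∧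
      c i ≤ 2 * c k ∧ insert k F ⊆ nb i ∧ c k + ∑ k ∈ F, c k = ∑ k ∈ insert k F, c k ∧
      ∑ k ∈ insert k F, c k ≤ 2 * c i := by
  have : ∃ k ∈ nb i, k ∉ F := by
    by_contra! hcon
    rw [← hX.sum_nb i hi] at hs
    exact absurd (Finset.sum_le_sum_of_subset (f := c) hcon) (by omega)
  obtain ⟨k, hk, hkF⟩ := this
  have hkX := hX.nb_subset i hi hk
  have hik := hX.symm i hi k hk
  refine ⟨k, hk, hkF, hkX, hik, ?_, hX.pos k hkX, ?_, Finset.insert_subset hk hF,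
    (Finset.sum_insert hkF).symm, ?_⟩
  · rintro rfl
    exact hX.irrefl _ hi hk
  · rw [← hX.sum_nb k hkX]
    exact Finset.single_le_sum (f := c) (fun _ _ => Nat.zero_le _) hik
  · rw [← hX.sum_nb i hi]
    exact Finset.sum_le_sum_of_subset (Finset.insert_subset hk hF)

theorem nb_eq_singleton (hX : IsAffineDiagram X nb c) (hi : i ∈ X) (hj : j ∈ nb i)
    (hs : 2 * c i ≤ c j) : nb i = {j} :=
  hX.nb_eq hi (Finset.singleton_subset_iff.2 hj) (by simpa using hs)

theorem Front.notMem_of_mem_nb (hX : IsAffineDiagram X nb c) (hT : Front X nb T i j) {u w : α}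
    (hu : u ∉ T) (huj : u ≠ j) (huX : u ∈ X) (hw : w ∈ nb u) : w ∉ T := by
  intro hwT
  have h1 := hT.closed w hwT (hX.symm u huX w hw)
  simp [hu, huj] at h1

theorem Front.advance (hX : IsAffineDiagram X nb c) (hT : Front X nb T i j) {F : Finset α} {k : α}
    (hF : nb j = insert k (insert i F)) (hkT : k ∉ T) (hkF : k ∉ F) (hFT : ∀ u ∈ F, nb u = {j}) :
    Front X nb (insert j (F ∪ T)) j k := by
  have hkj : k ∈ nb j := by simp [hF]
  have hkX := hX.nb_subset j hT.mem hkj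
  have hkj' : k ≠ j := fun h => hX.irrefl j hT.mem (h ▸ hkj)
  have hFj : F ⊆ nb j := fun u hu => by simp [hF, hu]
  refine ⟨?_, hkX, by simp [hkj', hkF, hkT], ?_, by simp, hX.symm j hT.mem k hkj, ?_⟩
  · exact Finset.insert_subset hT.mem
      (Finset.union_subset (hFj.trans (hX.nb_subset j hT.mem)) hT.subset)
  · intro t ht
    simp only [Finset.mem_insert, Finset.mem_union] at ht
    rcases ht with rfl | ht | ht
    · rw [hF]
      have := hT.left_mem
      grind
    · rw [hFT t ht]
      simp
    · have := hT.closed t ht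
      grind
  · intro t ht htk
    simp only [Finset.mem_insert, Finset.mem_union] at ht
    rcases ht with rfl | ht | ht
    · rfl
    · have := hX.symm k hkX t htk
      rw [hFT t ht] at this
      exact absurd (Finset.mem_singleton.1 this) hkj'
    · exact absurd ht (hT.notMem_of_mem_nb hX hkT hkj' hkX htk)

/-- The end of a diagram of type `D`. -/
theorem Front.sum_of_two (hX : IsAffineDiagram X nb c) (hT : Front X nb T i j) (hi : c i = 2)
    (hj : c j = 2) (hs : ∑ t ∈ T, c t + 2 = 2 * T.card) : ∑ t ∈ X, c t + 4 = 2 * X.card := by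
  induction hn : X.card - T.card generalizing T i j with
  | zero =>
    have := Finset.card_lt_card (Finset.ssubset_iff_of_subset hT.subset |>.2 ⟨j, hT.mem, hT.notMem⟩)
    omega
  | succ n ih =>
    obtain ⟨k, hk, hki, hkX, hjk, hkj, hk1, -, hins, hsum, hle⟩ := hX.exists_nb hT.mem
      (Finset.singleton_subset_iff.2 hT.left_mem_nb) (by simp [hi, hj])
    rw [Finset.sum_singleton] at hsum
    have hkT : k ∉ T := fun h => hki (by simp [hT.eq_left k h hk])
    obtain h2 | h2 : c k = 2 ∨ c k = 1 := by omega
    · have hF := hX.nb_eq hT.mem hins (by omega)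
      have hT' := hT.advance hX (F := ∅) (k := k) (by simpa using hF) hkT (by simp) (by simp)
      rw [Finset.empty_union] at hT'
      refine ih hT' hj h2 ?_ ?_
      · rw [Finset.sum_insert hT.notMem, Finset.card_insert_of_notMem hT.notMem]
        omega
      · rw [Finset.card_insert_of_notMem hT.notMem]
        omega
    · obtain ⟨l, hl, hlF, hlX, hjl, hlj, hl1, -, hins', hsum', hle'⟩ :=
        hX.exists_nb hT.mem hins (by omega)
      have hlT : l ∉ T := fun h => hlF (by simp [hT.eq_left l h hl])
      have hF := hX.nb_eq hT.mem hins' (by omega)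
      have hk' := hX.nb_eq_singleton hkX hjk (by omega)
      have hl' := hX.nb_eq_singleton hlX hjl (by omega)
      have hY : insert l (insert k (insert j T)) = X := by
        refine hX.connected _ ?_ ⟨l, by simp⟩ ?_
        · have := hT.subset; have := hT.mem; grind
        · intro t ht
          have := hT.left_mem
          have := hT.closed t
          grind
      have h3 : k ∉ insert j T := by simp [hkj, hkT]
      have h4 : l ∉ insert k (insert j T) := by grind
      rw [← hY, Finset.sum_insert h4, Finset.sum_insert h3, Finset.sum_insert hT.notMem,
        Finset.card_insert_of_notMem h4, Finset.card_insert_of_notMem h3,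
        Finset.card_insert_of_notMem hT.notMem]
      omega

end IsAffineDiagram

end

section

variable {α : Type*} [DecidableEq α]

namespace IsAffineDiagram

variable {X T : Finset α} {nb : α → Finset α} {c : α → ℕ} {i j : α}

theorem Front.sum_of_two_branches (hX : IsAffineDiagram X nb c) (hT : Front X nb T i j)
    (hij : c i + 1 = c j) (hj : 2 ≤ c j) (hs : 2 * ∑ t ∈ T, c t = c j * (c j - 1)) {k l : α}
    (hF : nb j = {l, k, i}) (hkl : k ≠ l) (hk : k ≠ i) (hl : l ≠ i) (hle : c k ≤ c l)
    (hsum : c k + c l = c j + 1) :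
    ∑ t ∈ X, c t + 4 = 2 * X.card ∨ ∑ t ∈ X, c t = 18 ∨ ∑ t ∈ X, c t = 30 ∨ ∑ t ∈ X, c t < 15 := by
  have hjX := hT.mem
  have hjT := hT.notMem
  have hkj : k ∈ nb j := by simp [hF]
  have hlj : l ∈ nb j := by simp [hF]
  have hjk := hX.symm j hjX k hkj
  have hjl := hX.symm j hjX l hlj
  have hkX := hX.nb_subset j hjX hkj
  have hlX := hX.nb_subset j hjX hlj
  have hkT : k ∉ T := fun h => hk (hT.eq_left k h hkj)
  have hlT : l ∉ T := fun h => hl (hT.eq_left l h hlj)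
  have hkj' : k ≠ j := fun h => hX.irrefl j hjX (h ▸ hkj)
  have hlj' : l ≠ j := fun h => hX.irrefl j hjX (h ▸ hlj)
  have hTX := hT.subset
  have hTj := hT.closed
  have hiT := hT.left_mem
  have hk2 : c j ≤ 2 * c k := by
    rw [← hX.sum_nb k hkX]
    exact Finset.single_le_sum (f := c) (fun _ _ => Nat.zero_le _) hjk
  have h3 : k ∉ insert j T := by simp [hkj', hkT]
  have h4 : l ∉ insert k (insert j T) := by grind
  rcases Nat.even_or_odd' (c j) with ⟨u, hu | hu⟩
  · have hku : c k = u := by omega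
    have hlu : c l = u + 1 := by omega
    have hk' := hX.nb_eq_singleton hkX hjk (by omega)
    obtain rfl | hu2 : u = 1 ∨ 2 ≤ u := by omega
    · left
      have hT' := hT.advance hX (F := {k}) (k := l) (by rw [hF, Finset.pair_comm]) hlT
        (by simpa using hkl.symm)
        (by simpa using hk')
      have h5 : ∑ t ∈ T, c t = 1 := by rw [hu] at hs; omega
      have h6 : T.card ≤ 1 := by
        have := Finset.card_nsmul_le_sum T c 1 fun t ht => hX.pos t (hTX ht)
        simpa [h5] using this
      have h7 := Finset.card_pos.2 ⟨i, hiT⟩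
      refine hT'.sum_of_two hX (by omega) (by omega) ?_
      rw [← Finset.insert_eq, Finset.sum_insert (by grind), Finset.sum_insert hkT,
        Finset.card_insert_of_notMem (by grind), Finset.card_insert_of_notMem hkT]
      omega
    · right
      obtain ⟨w, hw, hwj, hwX, hlw, hwl, hw1, hw2, hins, hsum, hle⟩ := hX.exists_nb hlX
        (Finset.singleton_subset_iff.2 hjl) (by rw [Finset.sum_singleton]; omega)
      rw [Finset.sum_singleton] at hsum
      have hlF := hX.nb_eq hlX hins (by omega)
      have hwT := hT.notMem_of_mem_nb hX hlT hlj' hlX hw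
      have h5 : w ∉ insert l (insert k (insert j T)) := by grind
      obtain rfl | rfl : u = 2 ∨ u = 3 := by omega
      · obtain ⟨z, hz, hzl, hzX, hwz, hzw, hz1, hz2, hins', hsum', hle'⟩ := hX.exists_nb hwX
          (Finset.singleton_subset_iff.2 hlw) (by rw [Finset.sum_singleton]; omega)
        rw [Finset.sum_singleton] at hsum'
        have hwF := hX.nb_eq hwX hins' (by omega)
        have hz' := hX.nb_eq_singleton hzX hwz (by omega)
        have hwj' : w ≠ j := by simpa using hwj
        have hzT := hT.notMem_of_mem_nb hX hwT hwj' hwX hz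
        have hcz : c z = 1 := by omega
        have hcw : c w = 2 := by omega
        have h6 : z ∉ insert w (insert l (insert k (insert j T))) := by grind
        have hY : insert z (insert w (insert l (insert k (insert j T)))) = X := by
          refine hX.connected _ (by grind (splits := 20)) ⟨z, by simp⟩ ?_
          intro t ht
          have := hTj t
          grind (splits := 20)
        rw [← hY, Finset.sum_insert h6, Finset.sum_insert h5, Finset.sum_insert h4,
          Finset.sum_insert h3, Finset.sum_insert hjT]
        rw [hu] at hs
        omega
      · have hw' := hX.nb_eq_singleton hwX hlw (by omega)
        have hY : insert w (insert l (insert k (insert j T))) = X := by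
          refine hX.connected _ (by grind) ⟨w, by simp⟩ ?_
          intro t ht
          have := hTj t
          grind
        rw [← hY, Finset.sum_insert h5, Finset.sum_insert h4,
          Finset.sum_insert h3, Finset.sum_insert hjT]
        rw [hu] at hs
        omega
  · have hku : c k = u + 1 := by omega
    have hlu : c l = u + 1 := by omega
    obtain ⟨w, hw, hwj, hwX, hkw, hwk, hw1, hw2, hins, hsum, hle⟩ := hX.exists_nb hkX
      (Finset.singleton_subset_iff.2 hjk) (by rw [Finset.sum_singleton]; omega)
    rw [Finset.sum_singleton] at hsum
    obtain rfl : u = 1 := by omega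
    obtain ⟨z, hz, hzj, hzX, hlz, hzl, hz1, hz2, hins', hsum', hle'⟩ := hX.exists_nb hlX
      (Finset.singleton_subset_iff.2 hjl) (by rw [Finset.sum_singleton]; omega)
    rw [Finset.sum_singleton] at hsum'
    have hkF := hX.nb_eq hkX hins (by omega)
    have hlF := hX.nb_eq hlX hins' (by omega)
    have hwT := hT.notMem_of_mem_nb hX hkT hkj' hkX hw
    have hzT := hT.notMem_of_mem_nb hX hlT hlj' hlX hz
    have hw' := hX.nb_eq_singleton hwX hkw (by omega)
    have hz' := hX.nb_eq_singleton hzX hlz (by omega)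
    have h5 : w ∉ insert l (insert k (insert j T)) := by grind
    have h6 : z ∉ insert w (insert l (insert k (insert j T))) := by grind
    have hY : insert z (insert w (insert l (insert k (insert j T)))) = X := by
      refine hX.connected _ (by grind) ⟨z, by simp⟩ ?_
      intro t ht
      have := hTj t
      grind (splits := 20)
    rw [← hY, Finset.sum_insert h6, Finset.sum_insert h5, Finset.sum_insert h4,
      Finset.sum_insert h3, Finset.sum_insert hjT]
    rw [hu] at hs
    omega

theorem Front.sum_cases (hX : IsAffineDiagram X nb c) (hT : Front X nb T i j)
    (hij : c i + 1 = c j) (hj : 2 ≤ c j) (hs : 2 * ∑ t ∈ T, c t = c j * (c j - 1)) :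
    ∑ t ∈ X, c t + 4 = 2 * X.card ∨ ∑ t ∈ X, c t = 18 ∨ ∑ t ∈ X, c t = 30 ∨ ∑ t ∈ X, c t < 15 := by
  induction hn : X.card - T.card generalizing T i j with
  | zero =>
    have := Finset.card_lt_card (Finset.ssubset_iff_of_subset hT.subset |>.2 ⟨j, hT.mem, hT.notMem⟩)
    omega
  | succ n ih =>
    obtain ⟨k, hk, hki, hkX, hjk, hkj, hk1, hk2, hins, hsum, hle⟩ := hX.exists_nb hT.mem
      (Finset.singleton_subset_iff.2 hT.left_mem_nb) (by rw [Finset.sum_singleton]; omega)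
    rw [Finset.sum_singleton] at hsum
    have hkT : k ∉ T := fun h => hki (by simp [hT.eq_left k h hk])
    obtain h2 | h2 : c k = c j + 1 ∨ c k ≤ c j := by omega
    · have hF := hX.nb_eq hT.mem hins (by omega)
      have hT' := hT.advance hX (F := ∅) (k := k) (by simpa using hF) hkT (by simp) (by simp)
      rw [Finset.empty_union] at hT'
      refine ih hT' h2.symm (by omega) ?_ ?_
      · rw [Finset.sum_insert hT.notMem, mul_add, hs, h2]
        obtain ⟨b, hb⟩ : ∃ b, c j = b + 1 := ⟨c j - 1, by omega⟩
        simp only [hb, Nat.add_sub_cancel]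
        ring
      · rw [Finset.card_insert_of_notMem hT.notMem]
        omega
    · obtain ⟨l, hl, hlF, hlX, hjl, hlj, hl1, hl2, hins', hsum', hle'⟩ :=
        hX.exists_nb hT.mem hins (by omega)
      have hlT : l ∉ T := fun h => hlF (by simp [hT.eq_left l h hl])
      have hki' : k ≠ i := by simpa using hki
      have hlk : l ≠ k ∧ l ≠ i := by simpa using hlF
      obtain h5 | h5 : c k + c l = c j + 1 ∨ c k + c l ≤ c j := by omega
      · have hF := hX.nb_eq hT.mem hins' (by omega)
        rcases le_total (c k) (c l) with h6 | h6
        · exact hT.sum_of_two_branches hX hij hj hs hF hlk.1.symm hki' hlk.2 h6 h5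
        · exact hT.sum_of_two_branches hX hij hj hs (hF.trans (Finset.insert_comm _ _ _)) hlk.1
            hlk.2 hki' h6 (by omega)
      · obtain ⟨m, hm, hmF, hmX, hjm, hmj, hm1, hm2, hins'', hsum'', hle''⟩ :=
          hX.exists_nb hT.mem hins' (by omega)
        have hF := hX.nb_eq hT.mem hins'' (by omega)
        have hmT : m ∉ T := fun h => hmF (by simp [hT.eq_left m h hm])
        have hk' := hX.nb_eq_singleton hkX hjk (by omega)
        have hl' := hX.nb_eq_singleton hlX hjl (by omega)
        have hm' := hX.nb_eq_singleton hmX hjm (by omega)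
        have h3 : k ∉ insert j T := by simp [hkj, hkT]
        have h4 : l ∉ insert k (insert j T) := by grind
        have h5 : m ∉ insert l (insert k (insert j T)) := by grind
        have hiT := hT.left_mem
        have hTX := hT.subset
        have hjX := hT.mem
        have hY : insert m (insert l (insert k (insert j T))) = X := by
          refine hX.connected _ (by grind) ⟨m, by simp⟩ ?_
          intro t ht
          have := hT.closed t
          grind
        have hcj : c j = 2 := by omega
        rw [← hY, Finset.sum_insert h5, Finset.sum_insert h4,
          Finset.sum_insert h3, Finset.sum_insert hT.notMem]
        rw [hcj] at hs
        omega

theorem sum_cases (hX : IsAffineDiagram X nb c) (hi : i ∈ X) (hci : c i = 1)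
    (h15 : 15 ≤ ∑ t ∈ X, c t) :
    ∑ t ∈ X, c t = X.card ∨ ∑ t ∈ X, c t + 4 = 2 * X.card ∨ ∑ t ∈ X, c t = 18 ∨
      ∑ t ∈ X, c t = 30 := by
  obtain ⟨j, hj, -, hjX, hij, hji, hj1, -, hins, hsum, hle⟩ :=
    hX.exists_nb hi (F := ∅) (by simp) (by simp [hci])
  rw [Finset.sum_empty] at hsum
  obtain h1 | h1 : c j = 1 ∨ c j = 2 := by omega
  · left
    have hY : {t ∈ X | c t = 1 ∧ ∃ s ∈ nb t, c s = 1} = X := by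
      refine hX.connected _ (Finset.filter_subset _ _) ⟨i, ?_⟩ ?_
      · simp only [Finset.mem_filter]
        exact ⟨hi, hci, j, hj, h1⟩
      · intro t ht k hk
        simp only [Finset.mem_filter] at ht ⊢
        obtain ⟨htX, hct, s, hs, hcs⟩ := ht
        refine ⟨hX.nb_subset t htX hk, ?_, t, hX.symm t htX k hk, hct⟩
        by_cases hks : k = s
        · rw [hks, hcs]
        · have h2 : ∑ r ∈ {k, s}, c r ≤ ∑ r ∈ nb t, c r :=
            Finset.sum_le_sum_of_subset (by grind)
          rw [hX.sum_nb t htX, Finset.sum_pair hks] at h2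
          have := hX.pos k (hX.nb_subset t htX hk)
          omega
    rw [Finset.card_eq_sum_ones]
    refine Finset.sum_congr rfl fun t ht => ?_
    rw [← hY, Finset.mem_filter] at ht
    exact ht.2.1
  · right
    have hiF := hX.nb_eq hi hins (by omega)
    have hT : Front X nb {i} i j := by
      refine ⟨by simpa using hi, hjX, by simpa using hji, ?_, by simp, hij, by simp⟩
      intro t ht
      rw [Finset.mem_singleton.1 ht, hiF]
      grind
    have := hT.sum_cases hX (by omega) (by omega) (by simp [hci, h1])
    omega

end IsAffineDiagram

end

section

variable {V : Type*} [AddCommGroup V] [Module ℚ V]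

/-- The simple roots together with the negatives of the highest roots. -/
noncomputable def affineRoots (B : V →ₗ[ℚ] V →ₗ[ℚ] ℚ) (L : Submodule ℤ V) (P : Finset V) (h : ℕ) :
    Finset V := {r ∈ rootFinset B L | B r (weylVector P) = 1 ∨ B r (weylVector P) = 1 - h}

/-- The affine simple roots joined to `i` in the affine Dynkin diagram. -/
noncomputable def affineNeighbors (B : V →ₗ[ℚ] V →ₗ[ℚ] ℚ) (L : Submodule ℤ V) (P : Finset V)
    (h : ℕ) (i : V) : Finset V := {j ∈ affineRoots B L P h | B i j = -1}

namespace IsNiemeier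

variable {B : V →ₗ[ℚ] V →ₗ[ℚ] ℚ} {L : Submodule ℤ V} {h : ℕ} {P : Finset V} {i j r v w : V}

local notation "R" => rootFinset B L

local notation "S" => affineRoots B L P h

local notation "nb" => affineNeighbors B L P h

theorem mem_affineRoots :
    r ∈ S ↔ r ∈ R ∧ (B r (weylVector P) = 1 ∨ B r (weylVector P) = 1 - h) := by
  simp [affineRoots]

theorem mem_affineNeighbors : j ∈ nb i ↔ j ∈ S ∧ B i j = -1 := by
  simp [affineNeighbors]

theorem mem_of_weylVector_pair_eq_one (hL : IsNiemeier B L) (hP : IsPositiveSystem B L P)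
    (hr : r ∈ R) (h1 : B r (weylVector P) = 1) : r ∈ P := by
  by_contra hcon
  have := hL.one_le_weylVector_pair hP ((hP.neg_iff r hr).2 hcon)
  rw [map_neg, LinearMap.neg_apply] at this
  linarith

theorem affineRoots_pair (hL : IsNiemeier B L) (hP : IsPositiveSystem B L P)
    (hc : (R).card = 24 * h) (hh : 3 ≤ h) (hi : i ∈ S) (hj : j ∈ S) (hij : i ≠ j) :
    B i j = 0 ∨ B i j = -1 := by
  rw [mem_affineRoots] at hi hj
  have hq : (3 : ℚ) ≤ h := by exact_mod_cast hh
  rcases hL.root_pair hi.1 hj.1 with h1 | h1 | h1 | h1 | h1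
  · exact .inl h1
  · have h2 := hL.sub_root hi.1 hj.1 h1
    have h3 := hL.weylVector_pair_ne_zero hP h2
    have h4 := abs_le.1 (hL.abs_pair_weylVector_le hP hc h2)
    rw [map_sub, LinearMap.sub_apply] at h3 h4
    rcases hi.2 with h5 | h5 <;> rcases hj.2 with h6 | h6 <;> rw [h5, h6] at h3 h4
    · exact absurd (sub_self _) h3
    · linarith
    · linarith
    · exact absurd (sub_self _) h3
  · exact .inr h1
  · exact absurd h1 hij
  · exfalso
    have h5 := hi.2
    rw [h1, map_neg, LinearMap.neg_apply] at h5
    rcases hj.2 with h6 | h6 <;> rw [h6] at h5 <;> rcases h5 with h5 | h5 <;> linarith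

theorem exists_affineRoots_sum_add
    (hv : ∃ b : V → ℕ, ∑ i ∈ S, b i • i = v ∧ ((∑ i ∈ S, b i : ℕ) : ℚ) = B v (weylVector P))
    {q : ℚ} (hw : ∃ b : V → ℕ, ∑ i ∈ S, b i • i = w ∧ ((∑ i ∈ S, b i : ℕ) : ℚ) = q) :
    ∃ b : V → ℕ, ∑ i ∈ S, b i • i = v + w ∧
      ((∑ i ∈ S, b i : ℕ) : ℚ) = B v (weylVector P) + q := by
  obtain ⟨b, hb, hb'⟩ := hv
  obtain ⟨d, hd, hd'⟩ := hw
  refine ⟨b + d, ?_, ?_⟩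
  · simp only [Pi.add_apply, add_smul, Finset.sum_add_distrib, hb, hd]
  · simp only [Pi.add_apply, Finset.sum_add_distrib, Nat.cast_add, hb', hd']

theorem exists_affineRoots_sum_single (hr : r ∈ S) :
    ∃ b : V → ℕ, ∑ i ∈ S, b i • i = r ∧ ∑ i ∈ S, b i = 1 := by
  classical
  refine ⟨Pi.single r 1, ?_, ?_⟩
  · rw [Finset.sum_eq_single r]
    · simp
    · intro i _ hi
      simp [hi]
    · exact fun h => absurd hr h
  · simp [Finset.sum_pi_single', hr]

theorem exists_affineRoots_sum_of_pos (hL : IsNiemeier B L) (hP : IsPositiveSystem B L P) :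
    ∀ r ∈ P, ∃ b : V → ℕ, ∑ i ∈ S, b i • i = r ∧
      ((∑ i ∈ S, b i : ℕ) : ℚ) = B r (weylVector P) := by
  refine hL.positive_induction hP ?_ ?_
  · intro r hr h1
    obtain ⟨b, hb, hb'⟩ := exists_affineRoots_sum_single
      (mem_affineRoots (h := h).2 ⟨hP.subset hr, .inl h1⟩)
    exact ⟨b, hb, by rw [hb', h1, Nat.cast_one]⟩
  · intro a _ b _ _ ha hb
    rw [map_add, LinearMap.add_apply]
    exact exists_affineRoots_sum_add ha hb

theorem exists_affineRoots_sum_of_neg (hL : IsNiemeier B L) (hP : IsPositiveSystem B L P)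
    (hc : (R).card = 24 * h) : ∀ r ∈ P, ∃ b : V → ℕ, ∑ i ∈ S, b i • i = -r ∧
      ((∑ i ∈ S, b i : ℕ) : ℚ) = h - B r (weylVector P) := by
  refine hL.positive_induction_down hP hc ?_ ?_
  · intro r hr h1
    obtain ⟨b, hb, hb'⟩ := exists_affineRoots_sum_single
      (mem_affineRoots (B := B) (L := L) (P := P) (h := h) (r := -r)|>.2
        ⟨(hL.neg_root_iff).2 (hP.subset hr), .inr (by
          rw [map_neg, LinearMap.neg_apply, h1]; ring)⟩)
    exact ⟨b, hb, by rw [hb', h1, Nat.cast_one]; ring⟩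
  · intro a _ b hb _ hab
    have := exists_affineRoots_sum_add (hL.exists_affineRoots_sum_of_pos hP b hb) hab
    rw [map_add, LinearMap.add_apply] at this
    convert this using 3
    · congr! 1
      abel
    · ring_nf

/-- Every affine simple root occurs in a linear relation whose coefficients are the marks of a
component of the affine Dynkin diagram. -/
theorem exists_affineRoots_relation (hL : IsNiemeier B L) (hP : IsPositiveSystem B L P)
    (hc : (R).card = 24 * h) (hr : r ∈ S) :
    ∃ b : V → ℕ, ∑ i ∈ S, b i • i = 0 ∧ ∑ i ∈ S, b i = h ∧ b r ≠ 0 := by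
  classical
  have hr' := mem_affineRoots.1 hr
  have key : ∃ b : V → ℕ, ∑ i ∈ S, b i • i = -r ∧ ((∑ i ∈ S, b i : ℕ) : ℚ) = h - 1 := by
    rcases hr'.2 with h1 | h1
    · rw [← h1]
      exact hL.exists_affineRoots_sum_of_neg hP hc r (hL.mem_of_weylVector_pair_eq_one hP hr'.1 h1)
    · have h2 : -r ∈ P := by
        rw [hP.neg_iff r hr'.1]
        intro h2
        have := hL.one_le_weylVector_pair hP h2
        have h3 : (0 : ℚ) ≤ h := Nat.cast_nonneg h
        have h4 : h = 0 := by
          have : (h : ℚ) = 0 := by linarith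
          exact_mod_cast this
        rw [h4, mul_zero, Finset.card_eq_zero] at hc
        simp [hc] at hr'
      have h3 := hL.exists_affineRoots_sum_of_pos (h := h) hP _ h2
      rwa [map_neg, LinearMap.neg_apply, h1, neg_sub] at h3
  obtain ⟨b, hb, hb'⟩ := key
  have hb'' : ((∑ i ∈ S, b i + 1 : ℕ) : ℚ) = h := by
    rw [Nat.cast_add, hb', Nat.cast_one]
    ring
  refine ⟨b + Pi.single r 1, ?_, ?_, by simp⟩
  · simp only [Pi.add_apply, add_smul, Finset.sum_add_distrib, hb]
    rw [Finset.sum_eq_single r]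
    · simp
    · intro i _ hi
      simp [hi]
    · exact fun h => absurd hr h
  · simp only [Pi.add_apply, Finset.sum_add_distrib, Finset.sum_pi_single', hr, if_true]
    exact_mod_cast hb''

end IsNiemeier

end

section

variable {V : Type*} [AddCommGroup V] [Module ℚ V]

namespace IsNiemeier

variable {B : V →ₗ[ℚ] V →ₗ[ℚ] ℚ} {L : Submodule ℤ V} {h : ℕ} {P : Finset V} {i j r : V}

local notation "R" => rootFinset B L

local notation "S" => affineRoots B L P h

local notation "nb" => affineNeighbors B L P h

theorem mem_affineNeighbors_comm (hL : IsNiemeier B L) (hi : i ∈ S) (hj : j ∈ nb i) : i ∈ nb j := by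
  rw [mem_affineNeighbors] at hj ⊢
  rw [hL.symm]
  exact ⟨hi, hj.2⟩

theorem self_notMem_affineNeighbors (hL : IsNiemeier B L) (hi : i ∈ S) : i ∉ nb i := by
  rw [mem_affineNeighbors, hL.root_self (mem_affineRoots.1 hi).1]
  norm_num

theorem pair_sum_affineRoots [DecidableEq V] (hL : IsNiemeier B L) (hP : IsPositiveSystem B L P)
    (hc : (R).card = 24 * h) (hh : 3 ≤ h) {Y : Finset V} (hY : Y ⊆ S) (b : V → ℕ) (hi : i ∈ S) :
    B i (∑ j ∈ Y, b j • j) = 2 * (if i ∈ Y then b i else 0 : ℕ) - (∑ j ∈ Y ∩ nb i, b j : ℕ) := by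
  have h1 : ∀ j ∈ Y, B i (b j • j) =
      2 * (if i = j then (b j : ℚ) else 0) - if j ∈ nb i then (b j : ℚ) else 0 := by
    intro j hj
    rw [map_nsmul, nsmul_eq_mul]
    by_cases hij : i = j
    · subst hij
      simp [hL.self_notMem_affineNeighbors hi, hL.root_self (mem_affineRoots.1 hi).1, mul_comm]
    · rcases hL.affineRoots_pair hP hc hh hi (hY hj) hij with h1 | h1
      · simp [mem_affineNeighbors, h1, hij]
      · simp [mem_affineNeighbors, h1, hij, hY hj]
  rw [map_sum, Finset.sum_congr rfl h1, Finset.sum_sub_distrib, ← Finset.mul_sum,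
    Finset.sum_ite_eq, Finset.sum_ite_mem]
  push_cast
  rfl

theorem eq_zero_of_forall_affineRoots (hL : IsNiemeier B L) (hP : IsPositiveSystem B L P)
    (hc : (R).card = 24 * h) (hh : h ≠ 0) {v : V} (hv : ∀ i ∈ S, B i v = 0) : v = 0 := by
  have h1 : ∀ r ∈ P, B r v = 0 := by
    refine hL.positive_induction hP (fun r hr h1 => hv r (mem_affineRoots.2 ⟨hP.subset hr, .inl h1⟩))
      fun a _ b _ _ ha hb => ?_
    rw [map_add, LinearMap.add_apply, ha, hb, add_zero]
  refine hL.eq_zero_of_forall_roots hc hh fun r hr => ?_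
  rw [hL.symm]
  by_cases hr' : r ∈ P
  · exact h1 r hr'
  · have := h1 _ ((hP.neg_iff r hr).2 hr')
    rwa [map_neg, LinearMap.neg_apply, neg_eq_zero] at this

theorem weylVector_pair_sum_affineRoots (hh : h ≠ 0) {Y : Finset V} (hY : Y ⊆ S) (b : V → ℕ)
    [DecidablePred fun i => B i (weylVector P) = 1 - h] :
    B (∑ j ∈ Y, b j • j) (weylVector P) =
      (∑ j ∈ Y, b j : ℕ) - h * (∑ j ∈ Y with B j (weylVector P) = 1 - h, b j : ℕ) := by
  rw [map_sum, LinearMap.sum_apply, Nat.cast_sum, Nat.cast_sum, Finset.sum_filter, Finset.mul_sum,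
    ← Finset.sum_sub_distrib]
  refine Finset.sum_congr rfl fun j hj => ?_
  rw [map_nsmul, LinearMap.smul_apply, nsmul_eq_mul]
  have h0 : (h : ℚ) ≠ 0 := by exact_mod_cast hh
  rcases (mem_affineRoots.1 (hY hj)).2 with h1 | h1
  · have h2 : ¬ (1 : ℚ) = 1 - h := fun h2 => h0 (by linarith)
    simp [h1, h2]
  · simp only [h1, if_true]
    ring

/-- The component of the affine Dynkin diagram containing `r`. -/
theorem exists_isAffineDiagram [DecidableEq V] (hL : IsNiemeier B L) (hP : IsPositiveSystem B L P)
    (hc : (R).card = 24 * h) (hh : 3 ≤ h) (hr : r ∈ S) :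
    ∃ X ⊆ S, ∃ c : V → ℕ, r ∈ X ∧ IsAffineDiagram X nb c ∧ ∑ i ∈ X, c i = h ∧
      ∃ θ ∈ X, c θ = 1 ∧ ∀ i ∈ X, B i (weylVector P) = 1 - h ↔ i = θ := by
  classical
  have h0 : h ≠ 0 := by omega
  have h0' : (h : ℚ) ≠ 0 := by exact_mod_cast h0
  obtain ⟨c, hc0, hch, hcr⟩ := hL.exists_affineRoots_relation hP hc hr
  have hnb : ∀ i ∈ S, nb i ⊆ S := fun i _ j hj => (mem_affineNeighbors.1 hj).1
  have hsum : ∀ i ∈ S, ∑ j ∈ nb i, c j = 2 * c i := by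
    intro i hi
    have h1 := hL.pair_sum_affineRoots hP hc hh subset_rfl c hi
    rw [hc0, map_zero, if_pos hi, Finset.inter_eq_right.2 (hnb i hi)] at h1
    have h2 : ((∑ j ∈ nb i, c j : ℕ) : ℚ) = ((2 * c i : ℕ) : ℚ) := by
      push_cast at h1 ⊢
      linarith
    exact_mod_cast h2
  have hle : ∀ i ∈ S, ∀ j ∈ nb i, c j ≤ 2 * c i := by
    intro i hi j hj
    rw [← hsum i hi]
    exact Finset.single_le_sum (f := c) (fun _ _ => Nat.zero_le _) hj
  set X := {i ∈ S | c i ≠ 0} with hX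
  have hXS : X ⊆ S := Finset.filter_subset _ _
  have hXpos : ∀ i ∈ X, 1 ≤ c i := fun i hi => Nat.one_le_iff_ne_zero.2 (Finset.mem_filter.1 hi).2
  have hXh : ∑ i ∈ X, c i = h := by rw [hX, Finset.sum_filter_ne_zero, hch]
  have hX0 : ∑ i ∈ X, c i • i = 0 := by
    rw [← hc0]
    refine Finset.sum_subset hXS fun i hi hiX => ?_
    have : c i = 0 := by
      by_contra hne
      exact hiX (Finset.mem_filter.2 ⟨hi, hne⟩)
    rw [this, zero_smul]
  have hΘ : ∑ i ∈ X with B i (weylVector P) = 1 - h, c i = 1 := by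
    have h1 := weylVector_pair_sum_affineRoots h0 hXS c
    rw [hX0, map_zero, LinearMap.zero_apply, hXh] at h1
    have h2 : (h : ℚ) * (∑ i ∈ X with B i (weylVector P) = 1 - h, c i : ℕ) = h * (1 : ℕ) := by
      push_cast at h1 ⊢
      linarith
    exact_mod_cast mul_left_cancel₀ h0' h2
  obtain ⟨θ, hθ, hθ1⟩ : ∃ θ ∈ X, B θ (weylVector P) = 1 - h := by
    by_contra! hcon
    rw [Finset.filter_false_of_mem hcon] at hΘ
    simp at hΘ
  have hθc : c θ = 1 ∧ ∀ i ∈ X, B i (weylVector P) = 1 - h ↔ i = θ := by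
    have h1 := Finset.sum_erase_add (s := {i ∈ X | B i (weylVector P) = 1 - h}) c
      (Finset.mem_filter.2 ⟨hθ, hθ1⟩)
    rw [hΘ] at h1
    have h2 := hXpos θ hθ
    refine ⟨by omega, fun i hi => ⟨fun hi1 => ?_, fun hi1 => hi1 ▸ hθ1⟩⟩
    by_contra hiθ
    have hiF : i ∈ {i ∈ X | B i (weylVector P) = 1 - h} := Finset.mem_filter.2 ⟨hi, hi1⟩
    have h3 := Finset.single_le_sum (f := c) (fun _ _ => Nat.zero_le _)
      (Finset.mem_erase.2 ⟨hiθ, hiF⟩)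
    have := hXpos i hi
    omega
  refine ⟨X, hXS, c, Finset.mem_filter.2 ⟨hr, hcr⟩, ⟨?_, ?_, ?_, hXpos, ?_, ?_⟩, hXh, θ, hθ, hθc⟩
  · intro i hi j hj
    have hjS := hnb i (hXS hi) hj
    have h1 := hle j hjS i (hL.mem_affineNeighbors_comm (hXS hi) hj)
    have h2 := hXpos i hi
    exact Finset.mem_filter.2 ⟨hjS, by omega⟩
  · exact fun i hi j hj => hL.mem_affineNeighbors_comm (hXS hi) hj
  · exact fun i hi => hL.self_notMem_affineNeighbors (hXS hi)
  · exact fun i hi => hsum i (hXS hi)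
  · intro Y hYX hYne hYnb
    have hv : ∑ j ∈ Y, c j • j = 0 := by
      refine hL.eq_zero_of_forall_affineRoots hP hc h0 fun i hi => ?_
      rw [hL.pair_sum_affineRoots hP hc hh (hYX.trans hXS) c hi]
      by_cases hiY : i ∈ Y
      · rw [if_pos hiY, Finset.inter_eq_right.2 (hYnb i hiY), hsum i hi]
        push_cast
        ring
      · have : Y ∩ nb i = ∅ := by
          rw [← Finset.disjoint_iff_inter_eq_empty, Finset.disjoint_left]
          exact fun j hjY hj => hiY (hYnb j hjY (hL.mem_affineNeighbors_comm hi hj))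
        simp [hiY, this]
    have h1 := weylVector_pair_sum_affineRoots h0 (hYX.trans hXS) c
    rw [hv, map_zero, LinearMap.zero_apply] at h1
    obtain ⟨y, hy⟩ := hYne
    have h2 : 1 ≤ ∑ j ∈ Y, c j :=
      (hXpos y (hYX hy)).trans (Finset.single_le_sum (f := c) (fun _ _ => Nat.zero_le _) hy)
    have h3 : ∑ j ∈ Y, c j = h * ∑ j ∈ Y with B j (weylVector P) = 1 - h, c j := by
      have : ((∑ j ∈ Y, c j : ℕ) : ℚ) =
          h * (∑ j ∈ Y with B j (weylVector P) = 1 - h, c j : ℕ) := by linarith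
      exact_mod_cast this
    have h4 : 1 ≤ ∑ j ∈ Y with B j (weylVector P) = 1 - h, c j := by
      by_contra hcon
      rw [Nat.lt_one_iff.1 (not_le.1 hcon)] at h3
      omega
    refine Finset.Subset.antisymm hYX fun i hi => ?_
    by_contra hiY
    have h5 : ∑ j ∈ insert i Y, c j ≤ ∑ j ∈ X, c j :=
      Finset.sum_le_sum_of_subset (Finset.insert_subset hi hYX)
    rw [Finset.sum_insert hiY, hXh] at h5
    have h6 := hXpos i hi
    nlinarith

end IsNiemeier

end

section

variable {V : Type*} [AddCommGroup V] [Module ℚ V]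

namespace IsNiemeier

variable {B : V →ₗ[ℚ] V →ₗ[ℚ] ℚ} {L : Submodule ℤ V} {h : ℕ} {P : Finset V} {i j r : V}

local notation "R" => rootFinset B L

local notation "S" => affineRoots B L P h

local notation "nb" => affineNeighbors B L P h

theorem card_simpleRoots (hL : IsNiemeier B L) (hP : IsPositiveSystem B L P)
    (hc : (R).card = 24 * h) (hh : 3 ≤ h) : Finset.card {i ∈ S | B i (weylVector P) = 1} = 24 := by
  classical
  set Δ := {i ∈ S | B i (weylVector P) = 1} with hΔ
  have hΔS : Δ ⊆ S := Finset.filter_subset _ _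
  have hh0 : h ≠ 0 := by omega
  have h0 : (h : ℚ) ≠ 0 := by exact_mod_cast hh0
  have hli : LinearIndependent ℚ (Subtype.val : Δ → V) := by
    rw [Fintype.linearIndependent_iff]
    intro g hg
    have h1 : ∑ i : Δ, |g i| • (i : V) = 0 := by
      refine hL.eq_zero_of_self (le_antisymm ?_ (hL.self_nonneg _))
      have h2 : B (∑ i : Δ, g i • (i : V)) (∑ i : Δ, g i • (i : V)) = 0 := by rw [hg]; simp
      rw [← h2]
      simp only [map_sum, LinearMap.sum_apply, map_smul, LinearMap.smul_apply, smul_eq_mul,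
        Finset.mul_sum]
      refine Finset.sum_le_sum fun i _ => Finset.sum_le_sum fun j _ => ?_
      by_cases hij : i = j
      · rw [hij, ← mul_assoc, ← mul_assoc, abs_mul_abs_self]
      · have h3 : B (j : V) i ≤ 0 := by
          rcases hL.affineRoots_pair hP hc hh (hΔS j.2) (hΔS i.2)
            (fun h => hij (Subtype.ext h.symm)) with h3 | h3 <;> rw [h3]
          norm_num
        rw [← mul_assoc, ← mul_assoc, ← abs_mul]
        exact mul_le_mul_of_nonpos_right (le_abs_self _) h3
    have h2 := congrArg (fun v => B v (weylVector P)) h1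
    simp only [map_sum, LinearMap.sum_apply, map_smul, LinearMap.smul_apply, smul_eq_mul,
      map_zero, LinearMap.zero_apply] at h2
    rw [Finset.sum_congr rfl (g := fun i => |g i|) fun i _ => by
      rw [(Finset.mem_filter.1 i.2).2, mul_one]] at h2
    intro i
    exact abs_eq_zero.1 ((Finset.sum_eq_zero_iff_of_nonneg fun i _ => abs_nonneg _).1 h2 i
      (Finset.mem_univ _))
  have hspan : ⊤ ≤ Submodule.span ℚ (Set.range (Subtype.val : Δ → V)) := by
    rw [Subtype.range_coe]
    have h1 : ∀ r ∈ P, r ∈ Submodule.span ℚ (Δ : Set V) := by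
      refine hL.positive_induction hP ?_ fun a _ b _ _ ha hb => Submodule.add_mem _ ha hb
      exact fun r hr h1 => Submodule.subset_span
        (Finset.mem_filter.2 ⟨mem_affineRoots.2 ⟨hP.subset hr, .inl h1⟩, h1⟩)
    have h2 : ∀ r ∈ R, r ∈ Submodule.span ℚ (Δ : Set V) := by
      intro r hr
      by_cases hr' : r ∈ P
      · exact h1 r hr'
      · exact (Submodule.neg_mem_iff _).1 (h1 _ ((hP.neg_iff r hr).2 hr'))
    intro x _
    have h3 : (2 * h : ℚ) • x ∈ Submodule.span ℚ (Δ : Set V) := by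
      rw [← hL.sum_roots_smul hc x]
      exact Submodule.sum_mem _ fun r hr => Submodule.smul_mem _ _ (h2 r hr)
    have := Submodule.smul_mem _ (2 * h : ℚ)⁻¹ h3
    rwa [inv_smul_smul₀ (by positivity)] at this
  have := Module.finrank_eq_card_basis (Module.Basis.mk hli hspan)
  rw [hL.finrank_eq, Fintype.card_coe] at this
  exact this.symm

/-- The affine Dynkin diagram is the union of its components, which are of types `A`, `D` and
`E` only, and the numbers of nodes minus one add up to the rank. -/
theorem exists_components (hL : IsNiemeier B L) (hP : IsPositiveSystem B L P)
    (hc : (R).card = 24 * h) (hh : 15 ≤ h) : h = 18 ∨ h = 30 ∨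
      ∃ a b : ℕ, 0 < a + b ∧ (0 < b → Even h) ∧ 2 * (a * (h - 1)) + b * (h + 2) = 48 := by
  classical
  by_cases h18 : h = 18
  · exact .inl h18
  by_cases h30 : h = 30
  · exact .inr (.inl h30)
  refine .inr (.inr ?_)
  have hq : (15 : ℚ) ≤ h := by exact_mod_cast hh
  have key := fun r (hr : r ∈ S) => hL.exists_isAffineDiagram hP hc (by omega) hr
  choose! X hXS c hrX hD hsum θ hθX hθc hθ using key
  have hcard : ∀ r ∈ S, h = (X r).card ∨ h + 4 = 2 * (X r).card := by
    intro r hr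
    have h1 := (hD r hr).sum_cases (hθX r hr) (hθc r hr) (by rw [hsum r hr]; exact hh)
    rw [hsum r hr] at h1
    omega
  have heq : ∀ r ∈ S, ∀ s ∈ S, ¬ Disjoint (X r) (X s) → X r = X s := by
    intro r hr s hs hrs
    have hne : (X r ∩ X s).Nonempty := by
      rwa [Finset.disjoint_iff_inter_eq_empty, ← ne_eq, ← Finset.nonempty_iff_ne_empty] at hrs
    have hcl : ∀ i ∈ X r ∩ X s, nb i ⊆ X r ∩ X s := fun i hi => Finset.subset_inter
      ((hD r hr).nb_subset i (Finset.mem_inter.1 hi).1)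
      ((hD s hs).nb_subset i (Finset.mem_inter.1 hi).2)
    rw [← (hD r hr).connected _ Finset.inter_subset_left hne hcl,
      (hD s hs).connected _ Finset.inter_subset_right hne hcl]
  set C := (S).image X with hC
  have hbi : C.biUnion id = S := by
    ext i
    simp only [hC, Finset.mem_biUnion, Finset.mem_image, id]
    constructor
    · rintro ⟨_, ⟨r, hr, rfl⟩, hi⟩
      exact hXS r hr hi
    · exact fun hi => ⟨_, ⟨i, hi, rfl⟩, hrX i hi⟩
  have hdisj : (C : Set (Finset V)).PairwiseDisjoint id := by
    intro Y hY Z hZ hYZ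
    simp only [hC, Finset.coe_image, Set.mem_image, Finset.mem_coe] at hY hZ
    obtain ⟨r, hr, rfl⟩ := hY
    obtain ⟨s, hs, rfl⟩ := hZ
    by_contra hcon
    exact hYZ (heq r hr s hs hcon)
  have h24 : ∑ Y ∈ C, ((Y.card : ℤ) - 1) = 24 := by
    have h1 : ∀ Y ∈ C, (Y.card : ℤ) - 1 =
        ∑ i ∈ Y, if B i (weylVector P) = 1 then (1 : ℤ) else 0 := by
      intro Y hY
      obtain ⟨r, hr, rfl⟩ := Finset.mem_image.1 hY
      have h2 : ∀ i ∈ X r, (if B i (weylVector P) = 1 then (1 : ℤ) else 0) =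
          1 - if i = θ r then 1 else 0 := by
        intro i hi
        have h3 := hθ r hr i hi
        rcases (mem_affineRoots.1 (hXS r hr hi)).2 with h4 | h4
        · have h5 : i ≠ θ r := by
            intro h5
            have h6 := h3.2 h5
            linarith
          simp [h4, h5]
        · have h5 : B i (weylVector P) ≠ 1 := by
            rw [h4]
            intro h5
            linarith
          rw [if_neg h5, if_pos (h3.1 h4), sub_self]
      rw [Finset.sum_congr rfl h2, Finset.sum_sub_distrib, Finset.sum_ite_eq', if_pos (hθX r hr)]
      simp
    rw [Finset.sum_congr rfl h1]
    have h2 := Finset.sum_biUnion (f := fun i => if B i (weylVector P) = 1 then (1 : ℤ) else 0) hdisj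
    simp only [id] at h2
    rw [← h2]
    rw [hbi, Finset.sum_ite, Finset.sum_const_zero, add_zero, Finset.sum_const,
      hL.card_simpleRoots hP hc (by omega)]
    rfl
  have hCc : ∀ Y ∈ C, h = Y.card ∨ h + 4 = 2 * Y.card := by
    intro Y hY
    obtain ⟨r, hr, rfl⟩ := Finset.mem_image.1 hY
    exact hcard r hr
  rw [← Finset.sum_filter_add_sum_filter_not C (fun Y => h = Y.card)] at h24
  have ha : ∑ Y ∈ C with h = Y.card, ((Y.card : ℤ) - 1) =
      (Finset.card {Y ∈ C | h = Y.card} : ℤ) * (h - 1) := by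
    rw [Finset.sum_congr rfl (g := fun _ => (h : ℤ) - 1), Finset.sum_const, nsmul_eq_mul]
    intro Y hY
    rw [← (Finset.mem_filter.1 hY).2]
  have hb : 2 * ∑ Y ∈ C with ¬ h = Y.card, ((Y.card : ℤ) - 1) =
      (Finset.card {Y ∈ C | ¬ h = Y.card} : ℤ) * (h + 2) := by
    rw [Finset.mul_sum, Finset.sum_congr rfl (g := fun _ => (h : ℤ) + 2), Finset.sum_const,
      nsmul_eq_mul]
    intro Y hY
    obtain ⟨h1, h2⟩ := Finset.mem_filter.1 hY
    have := hCc Y h1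
    omega
  set a := Finset.card {Y ∈ C | h = Y.card}
  set b := Finset.card {Y ∈ C | ¬ h = Y.card} with hbdef
  have h48 : 2 * (a * (h - 1)) + b * (h + 2) = 48 := by
    zify [show 1 ≤ h by omega]
    linarith
  refine ⟨a, b, ?_, ?_, h48⟩
  · rcases Nat.eq_zero_or_pos (a + b) with h1 | h1
    · obtain ⟨h2, h3⟩ := Nat.add_eq_zero_iff.1 h1
      simp [h2, h3] at h48
    · exact h1
  · intro hb0
    obtain ⟨Y, hY⟩ := Finset.card_pos.1 (hbdef ▸ hb0)
    obtain ⟨h1, h2⟩ := Finset.mem_filter.1 hY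
    have := hCc Y h1
    rw [Nat.even_iff]
    omega

end IsNiemeier

end

section

theorem exists_primes_dvd_natAbs {t : ℤ} {h : ℕ} (h1 : ¬ IsCoprime t h)
    (h2 : ¬ IsCoprime t (h + 1)) :
    ∃ p q : ℕ, p.Prime ∧ q.Prime ∧ p ∣ h ∧ q ∣ h + 1 ∧ p ≠ q ∧ p * q ∣ t.natAbs := by
  have h3 : ¬ Nat.Coprime t.natAbs h := by
    rwa [Int.isCoprime_iff_gcd_eq_one, Int.gcd_eq_natAbs, Int.natAbs_natCast] at h1
  have h4 : ¬ Nat.Coprime t.natAbs (h + 1) := by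
    rwa [← Nat.cast_succ, Int.isCoprime_iff_gcd_eq_one, Int.gcd_eq_natAbs, Int.natAbs_natCast] at h2
  obtain ⟨p, hp, hpt, hph⟩ := Nat.Prime.not_coprime_iff_dvd.1 h3
  obtain ⟨q, hq, hqt, hqh⟩ := Nat.Prime.not_coprime_iff_dvd.1 h4
  have hpq : p ≠ q := by
    rintro rfl
    exact hp.one_lt.ne' (Nat.dvd_one.1 ((Nat.dvd_add_right hph).1 hqh))
  exact ⟨p, q, hp, hq, hph, hqh, hpq,
    ((Nat.coprime_primes hp hq).2 hpq).mul_dvd_of_dvd_of_dvd hpt hqt⟩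

theorem sq_ge_of_not_isCoprime {t : ℤ} {h : ℕ} (h0 : t ≠ 0) (h1 : ¬ IsCoprime t h)
    (h2 : ¬ IsCoprime t (h + 1)) : 36 ≤ t ^ 2 := by
  obtain ⟨p, q, hp, hq, -, -, hpq, hd⟩ := exists_primes_dvd_natAbs h1 h2
  have h3 := Nat.le_of_dvd (Int.natAbs_pos.2 h0) hd
  have h4 := hp.two_le
  have h5 := hq.two_le
  have h6 : 6 ≤ p * q := by
    rcases Nat.lt_or_gt_of_ne hpq with h6 | h6
    · exact Nat.mul_le_mul h4 (show 3 ≤ q by omega)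
    · exact Nat.mul_le_mul (show 3 ≤ p by omega) h5
  have h7 : (6 : ℤ) ≤ |t| := by
    rw [Int.abs_eq_natAbs]
    exact_mod_cast h6.trans h3
  rw [← sq_abs]
  nlinarith

theorem sq_eq_or_ge_of_not_isCoprime {t : ℤ} (h0 : t ≠ 0) (h1 : ¬ IsCoprime t (25 : ℕ))
    (h2 : ¬ IsCoprime t ((25 : ℕ) + 1)) : t = 10 ∨ t = -10 ∨ 400 ≤ t ^ 2 := by
  obtain ⟨p, q, hp, hq, hph, hqh, -, hd⟩ := exists_primes_dvd_natAbs h1 h2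
  obtain rfl : p = 5 := (Nat.prime_dvd_prime_iff_eq hp Nat.prime_five).1
    (hp.dvd_of_dvd_pow (show p ∣ 5 ^ 2 from hph))
  have hq' : q = 2 ∨ q = 13 := by
    rcases hq.dvd_mul.1 (show q ∣ 2 * 13 from hqh) with h | h
    · exact .inl ((Nat.prime_dvd_prime_iff_eq hq Nat.prime_two).1 h)
    · exact .inr ((Nat.prime_dvd_prime_iff_eq hq (by norm_num)).1 h)
  have h4 : t.natAbs = 10 ∨ 20 ≤ t.natAbs := by
    obtain ⟨c, hc⟩ := hd
    have : t.natAbs ≠ 0 := Int.natAbs_ne_zero.2 h0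
    rcases hq' with rfl | rfl <;> omega
  rcases h4 with h4 | h4
  · omega
  · have h7 : (20 : ℤ) ≤ |t| := by
      rw [Int.abs_eq_natAbs]
      exact_mod_cast h4
    right; right
    rw [← sq_abs]
    nlinarith

theorem eq_of_components {h a b : ℕ} (hh : 15 ≤ h) (hab : 0 < a + b) (hb : 0 < b → Even h)
    (h48 : 2 * (a * (h - 1)) + b * (h + 2) = 48) : h = 16 ∨ h = 22 ∨ h = 25 ∨ h = 46 := by
  have h1 : h ≤ 46 := by
    by_contra hcon
    have h1 : a * 46 ≤ a * (h - 1) := Nat.mul_le_mul_left a (by omega)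
    have h2 : b * 49 ≤ b * (h + 2) := Nat.mul_le_mul_left b (by omega)
    omega
  rw [Nat.even_iff] at hb
  interval_cases h <;> omega

variable {V : Type*} [AddCommGroup V] [Module ℚ V]

namespace IsNiemeier

variable {B : V →ₗ[ℚ] V →ₗ[ℚ] ℚ} {L : Submodule ℤ V}

local notation "R" => rootFinset B L

local notation "N" => adjRoots B L

variable {h : ℕ} {P : Finset V}

theorem sum_sum_adjRoots (hL : IsNiemeier B L) (g : V → ℚ) :
    ∑ s ∈ R, ∑ a ∈ N s, g a = ∑ s ∈ R, ((N s).card : ℚ) * g s := by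
  rw [Finset.sum_comm' (t' := R) (s' := fun a => N a)]
  · simp
  · intro s a
    simp only [mem_adjRoots, hL.symm s a]
    tauto

/-- A linear functional cannot take the values `±10` on almost all roots. -/
theorem sum_roots_sq_ne (hL : IsNiemeier B L) {v : V}
    (hv : ∀ s ∈ R, B s v = 10 ∨ B s v = -10 ∨ 400 ≤ B s v ^ 2) (hne : (R).Nonempty) :
    12 * ∑ s ∈ R, B s v ^ 2 ≠ 1300 * (R).card := by
  classical
  intro hsum
  obtain ⟨k, hk, hk2, hN⟩ := hL.exists_coxeter hne
  have hk0 : (2 : ℚ) ≤ k := by exact_mod_cast hk2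
  set g : V → ℚ := fun s => B s v ^ 2 / 100 - 1 with hg
  have hg0 : ∀ s ∈ R, 0 ≤ g s := by
    intro s hs
    rcases hv s hs with h | h | h <;> simp only [hg] <;> [(rw [h]; norm_num); (rw [h]; norm_num);
      linarith]
  have hg3 : ∀ s ∈ R, g s ≠ 0 → 3 ≤ g s := by
    intro s hs h0
    rcases hv s hs with h | h | h <;> simp only [hg] at h0 ⊢
    · rw [h] at h0; norm_num at h0
    · rw [h] at h0; norm_num at h0
    · linarith
  have hgsum : ∑ s ∈ R, g s = 2 * k := by
    simp only [hg]
    rw [Finset.sum_sub_distrib, ← Finset.sum_div, Finset.sum_const, nsmul_one]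
    rw [hk] at hsum ⊢
    push_cast at hsum ⊢
    linarith
  obtain rfl | hk3 : k = 2 ∨ 3 ≤ k := by omega
  · have h1 : ∀ s ∈ R, g s = 0 := by
      intro s hs
      by_contra h0
      have h1 := hg3 s hs h0
      have h2 : g (-s) = g s := by simp [hg]
      have h3 : s ≠ -s := by
        intro h3
        have h4 := hL.root_self hs
        have h5 : B s s = -B s s := (congrArg (B s) h3).trans (map_neg _ _)
        linarith
      have h4 : ∑ r ∈ ({s, -s} : Finset V), g r ≤ ∑ r ∈ R, g r :=
        Finset.sum_le_sum_of_subset_of_nonneg (by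
          intro r hr
          simp only [Finset.mem_insert, Finset.mem_singleton] at hr
          rcases hr with rfl | rfl
          · exact hs
          · exact hL.neg_root hs) fun r hr _ => hg0 r hr
      rw [Finset.sum_pair h3, h2, hgsum] at h4
      push_cast at h4
      linarith
    rw [Finset.sum_eq_zero h1] at hgsum
    norm_num at hgsum
  · have h1 : ∀ s ∈ R, ∀ a ∈ N s, 3 ≤ g s + (g a + g (s - a)) := by
      intro s hs a ha
      have ha' := (mem_adjRoots.1 ha).1
      have hsa := (mem_adjRoots.1 (hL.sub_mem_adjRoots hs ha)).1
      by_contra hcon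
      have hz : ∀ r ∈ R, g r < 3 → B r v = 10 ∨ B r v = -10 := by
        intro r hr h3
        rcases hv r hr with h | h | h
        · exact .inl h
        · exact .inr h
        · simp only [hg] at h3; linarith
      have h2 := hg0 s hs
      have h3 := hg0 a ha'
      have h4 := hg0 _ hsa
      have h5 := hz s hs (by linarith)
      have h6 := hz a ha' (by linarith)
      have h7 := hz _ hsa (by linarith)
      rw [map_sub, LinearMap.sub_apply] at h7
      rcases h5 with h5 | h5 <;> rcases h6 with h6 | h6 <;> rw [h5, h6] at h7 <;> norm_num at h7
    have hNc : ∀ s ∈ R, ((N s).card : ℚ) = 2 * k - 4 := by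
      intro s hs
      rw [hN s hs, Nat.cast_sub (by omega)]
      push_cast
      ring
    have h2 : ∑ s ∈ R, ∑ a ∈ N s, (3 : ℚ) ≤ ∑ s ∈ R, ∑ a ∈ N s, (g s + (g a + g (s - a))) :=
      Finset.sum_le_sum fun s hs => Finset.sum_le_sum fun a ha => h1 s hs a ha
    have h3 : ∑ s ∈ R, ∑ a ∈ N s, (g s + (g a + g (s - a))) =
        3 * ∑ s ∈ R, ((N s).card : ℚ) * g s := by
      simp only [Finset.sum_add_distrib, Finset.sum_const, nsmul_eq_mul]
      rw [Finset.sum_congr rfl fun s hs => hL.sum_adjRoots_sub hs g, hL.sum_sum_adjRoots]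
      ring
    have h4 : ∑ s ∈ R, ((N s).card : ℚ) * g s = (2 * k - 4) * (2 * k) := by
      rw [Finset.sum_congr rfl (g := fun s => (2 * k - 4 : ℚ) * g s) fun s hs => by rw [hNc s hs],
        ← Finset.mul_sum, hgsum]
    have h5 : ∑ s ∈ R, ∑ a ∈ N s, (3 : ℚ) = 24 * k * ((2 * k - 4) * 3) := by
      rw [Finset.sum_congr rfl (g := fun _ => (2 * k - 4 : ℚ) * 3) fun s hs => by
        rw [Finset.sum_const, nsmul_eq_mul, hNc s hs], Finset.sum_const, nsmul_eq_mul, hk]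
      push_cast
      ring
    rw [h3, h4, h5] at h2
    have hk0 : (3 : ℚ) ≤ k := by exact_mod_cast hk3
    nlinarith [mul_pos (show (0 : ℚ) < k by linarith) (show (0 : ℚ) < 2 * k - 4 by linarith)]

theorem self_ne_two_of_mem_holyLattice (hL : IsNiemeier B L) (hP : IsPositiveSystem B L P)
    (hc : (R).card = 24 * h) (hh : h ≠ 0) {x : V} (hx : x ∈ holyLattice B L (weylVector P) h) :
    B x x ≠ 2 := by
  intro hx2
  set ρ := weylVector P with hρ
  have hM := hL.isNiemeier_holyLattice (hL.weylVector_mem hP hc) (hL.weylVector_self hP hc) hh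
  set M := holyLattice B L ρ h
  have hne : (rootFinset B M).Nonempty := ⟨x, hM.mem_rootFinset.2 ⟨hx, hx2⟩⟩
  obtain ⟨k, hk, hk2, -⟩ := hM.exists_coxeter hne
  have hk0 : (2 : ℚ) ≤ k := by exact_mod_cast hk2
  have key : ∀ s ∈ rootFinset B M, ∃ t : ℤ, B s ρ = t ∧
      (¬ IsCoprime t h ∧ ¬ (h : ℤ) ∣ t) ∧ ¬ IsCoprime t (h + 1) ∧ ¬ (h + 1 : ℤ) ∣ t := by
    intro s hs
    obtain ⟨hsM, hs2⟩ := hM.mem_rootFinset.1 hs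
    obtain ⟨t, ht⟩ := (mem_holyLattice.1 hsM).1
    exact ⟨t, ht, hL.not_isCoprime_and_not_dvd hP hc hh hsM hs2 ht⟩
  have hsum : ∑ s ∈ rootFinset B M, B s ρ ^ 2 = 2 * k * (2 * h * (h + 1)) := by
    rw [← hL.weylVector_self hP hc, ← hM.sum_roots_sq' hk]
    exact Finset.sum_congr rfl fun s _ => by rw [hL.symm]
  have h15 : 15 ≤ h := by
    have h1 : ∑ s ∈ rootFinset B M, (36 : ℚ) ≤ ∑ s ∈ rootFinset B M, B s ρ ^ 2 := by
      refine Finset.sum_le_sum fun s hs => ?_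
      obtain ⟨t, ht, ⟨h1, h2⟩, h3, -⟩ := key s hs
      rw [ht]
      exact_mod_cast sq_ge_of_not_isCoprime (by rintro rfl; exact h2 (dvd_zero _)) h1 h3
    rw [hsum, Finset.sum_const, hk, nsmul_eq_mul] at h1
    push_cast at h1
    by_contra hcon
    have h2 : (h : ℚ) ≤ 14 := by exact_mod_cast (by omega : h ≤ 14)
    have h3 : (0 : ℚ) ≤ h := Nat.cast_nonneg h
    have h4 : (h : ℚ) * (h + 1) ≤ 14 * 15 := by nlinarith
    nlinarith
  have hprime : ¬ (h + 1).Prime := by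
    intro hp
    obtain ⟨x', hx'⟩ := hne
    obtain ⟨t, -, -, h3, h4⟩ := key x' hx'
    refine h3 (IsCoprime.symm ?_)
    have : Prime ((h + 1 : ℕ) : ℤ) := Nat.prime_iff_prime_int.1 hp
    push_cast at this
    exact (this.coprime_iff_not_dvd).2 h4
  have hcases : h = 18 ∨ h = 30 ∨ h = 16 ∨ h = 22 ∨ h = 25 ∨ h = 46 := by
    rcases hL.exists_components hP hc h15 with h1 | h1 | ⟨a, b, hab, hb, h48⟩
    · exact .inl h1
    · exact .inr (.inl h1)
    · exact .inr (.inr (eq_of_components h15 hab hb h48))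
  obtain rfl : h = 25 := by
    rcases hcases with rfl | rfl | rfl | rfl | rfl | rfl
    all_goals first | rfl | exact absurd (by norm_num) hprime
  refine hM.sum_roots_sq_ne (v := ρ) (fun s hs => ?_) hne ?_
  · obtain ⟨t, ht, ⟨h1, h2⟩, h3, -⟩ := key s hs
    rw [ht]
    rcases sq_eq_or_ge_of_not_isCoprime (by rintro rfl; exact h2 (dvd_zero _)) h1 h3 with h | h | h
    · exact .inl (by exact_mod_cast h)
    · exact .inr (.inl (by exact_mod_cast h))
    · exact .inr (.inr (by exact_mod_cast h))
  · rw [hsum, hk]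
    push_cast
    ring

end IsNiemeier

end

/-- For a Niemeier lattice `N` with nonempty root set, Coxeter number `h` and Weyl vector
`ρ`, there is no `y ∈ N` and integers `m, n` with `B(y,y) = 2 + 2mn` and
`B(y,ρ) = m(h+1) + nh`.  Equivalently, in `II₂₅,₁ = N ⊕ U` the norm-0 vector
`w = ρ + h·e + (h+1)·f` has no roots of `II₂₅,₁` orthogonal to it, so `w` corresponds to the
Leech lattice and every holy construction yields the Leech lattice. -/
theorem niemeier_holy_construction_no_orthogonal_roots
    (V : Type*) [AddCommGroup V] [Module ℚ V]
    (L : Submodule ℤ V) (hfg : L.FG)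
    (hspan : Submodule.span ℚ (L : Set V) = ⊤)
    (hrank : Module.finrank ℚ V = 24)
    (B : V →ₗ[ℚ] V →ₗ[ℚ] ℚ)
    (hsymm : ∀ x y : V, B x y = B y x)
    (hint : ∀ x ∈ L, ∀ y ∈ L, ∃ n : ℤ, B x y = (n : ℚ))
    (hpos : ∀ x ∈ L, x ≠ 0 → 0 < B x x)
    (heven : ∀ x ∈ L, ∃ n : ℤ, B x x = 2 * (n : ℚ))
    (hunimod : ∀ v : V, (∀ y ∈ L, ∃ n : ℤ, B v y = (n : ℚ)) → v ∈ L)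
    (hne : {x : V | x ∈ L ∧ B x x = 2}.Nonempty)
    (f : V →ₗ[ℚ] ℚ)
    (hf : ∀ x ∈ L, B x x = 2 → f x ≠ 0)
    (h : ℚ) (hh : h = ({x : V | x ∈ L ∧ B x x = 2}.ncard : ℚ) / 24)
    (ρ : V)
    (hρ : ρ = (2⁻¹ : ℚ) • ∑ᶠ x ∈ {x : V | x ∈ L ∧ B x x = 2 ∧ 0 < f x}, x) :
    ¬ ∃ y ∈ L, ∃ m n : ℤ,
      B y y = 2 + 2 * (m : ℚ) * (n : ℚ) ∧
      B y ρ = (m : ℚ) * (h + 1) + (n : ℚ) * h := by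
  have hL : IsNiemeier B L := ⟨hfg, hspan, hrank, hsymm, hint, hpos, heven, hunimod⟩
  have hR : ((rootFinset B L : Finset V) : Set V) = {x : V | x ∈ L ∧ B x x = 2} := by
    ext x
    exact hL.mem_rootFinset
  obtain ⟨k, hk, hk2, -⟩ := hL.exists_coxeter
    (by rw [← Finset.coe_nonempty, hR]; exact hne)
  have hk0 : (k : ℚ) ≠ 0 := by exact_mod_cast (by omega : k ≠ 0)
  obtain rfl : h = k := by
    rw [hh, ← hR, Set.ncard_coe_finset, hk]
    push_cast
    ring
  have hP := hL.isPositiveSystem_positiveRoots f fun r hr =>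
    hf r (hL.mem_rootFinset.1 hr).1 (hL.mem_rootFinset.1 hr).2
  obtain rfl : ρ = weylVector (positiveRoots B L f) := by
    rw [hρ, weylVector, ← finsum_mem_coe_finset]
    have hset : {x : V | x ∈ L ∧ B x x = 2 ∧ 0 < f x} = (positiveRoots B L f : Set V) := by
      ext x
      simp [IsNiemeier.mem_positiveRoots, hL.mem_rootFinset, and_assoc]
    rw [hset]
  rintro ⟨y, hy, m, n, hyy, hyρ⟩
  have hρL := hL.weylVector_mem hP hk
  have hρρ := hL.weylVector_self hP hk
  set ρ := weylVector (positiveRoots B L f)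
  have hxρ : B (y - ((m : ℚ) / k) • ρ) ρ = ((n * k - m * (k + 1) : ℤ) : ℚ) := by
    rw [map_sub, LinearMap.sub_apply, map_smul, LinearMap.smul_apply, smul_eq_mul, hyρ, hρρ]
    push_cast
    field_simp
    ring
  refine hL.self_ne_two_of_mem_holyLattice hP hk (by omega) (x := y - ((m : ℚ) / k) • ρ)
    (IsNiemeier.mem_holyLattice.2 ⟨⟨_, hxρ⟩, ?_⟩) ?_
  · have : y - ((m : ℚ) / k) • ρ - (B (y - ((m : ℚ) / k) • ρ) ρ / k) • ρ = y - (n - m) • ρ := by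
      rw [hxρ, sub_sub, ← add_smul, ← Int.cast_smul_eq_zsmul ℚ]
      congr 2
      push_cast
      field_simp
      ring
    rw [this]
    exact L.sub_mem hy (L.smul_mem _ hρL)
  · simp only [map_sub, LinearMap.sub_apply, map_smul, LinearMap.smul_apply, smul_eq_mul, hρρ,
      hsymm ρ y, hyρ, hyy]
    field_simp
    ring
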